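/- arXiv:1512.03272 — 3 statements merged into one kernel-verified Lean document; each statement's English description precedes it below -/
import Mathlib

section
/- For every ε > 0 there is a constant C(ε) such that J_{6,3}(X) ≤ C(ε) · X^{6+ε} for all real X ≥ 1. (The cubic case of the main conjecture in Vinogradov's mean value theorem, at the critical number of variables s = 6.) -/
/-- `Jcount s k X` is the number of `2s`-tuples `(x₁,…,x_{2s})` of positive integers
with each `xᵢ ≤ X` satisfying `x₁ʲ+⋯+x_sʲ = x_{s+1}ʲ+⋯+x_{2s}ʲ` for all `1 ≤ j ≤ k`.
The tuple is encoded as a pair of `s`-tuples (the two sides of the system). -/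
noncomputable def Jcount (s k : ℕ) (X : ℝ) : ℕ :=
  Nat.card {xy : (Fin s → ℕ) × (Fin s → ℕ) //
    (∀ i, 1 ≤ xy.1 i ∧ (xy.1 i : ℝ) ≤ X) ∧
    (∀ i, 1 ≤ xy.2 i ∧ (xy.2 i : ℝ) ≤ X) ∧
    ∀ j ∈ Finset.Icc 1 k, ∑ i, xy.1 i ^ j = ∑ i, xy.2 i ^ j}

namespace VinogradovCubic

open Finset
open scoped BigOperators ComplexConjugate

section Fourier

variable {G : Type*} [AddCommGroup G]

/-- The exponential sum `∑_{x ∈ A} ψ(φ(x))` over a finite set `A`. -/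
noncomputable def expSum (φ : ℕ → G) (A : Finset ℕ) (ψ : AddChar G ℂ) : ℂ :=
  ∑ x ∈ A, ψ (φ x)

open scoped Classical in
/-- The number of ways to write `g` as a difference of two sums of `v` elements of `φ(B)`. -/
noncomputable def rep (φ : ℕ → G) (B : Finset ℕ) (v : ℕ) (g : G) : ℕ :=
  #{yz ∈ Fintype.piFinset (fun _ : Fin v => B) ×ˢ Fintype.piFinset (fun _ : Fin v => B) |
    g + ∑ i, φ (yz.1 i) = ∑ i, φ (yz.2 i)}

theorem map_sum_eq_prod {ι : Type*} (ψ : AddChar G ℂ) (s : Finset ι) (g : ι → G) :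
    ψ (∑ i ∈ s, g i) = ∏ i ∈ s, ψ (g i) := by
  classical
  induction s using Finset.induction_on with
  | empty => simp
  | insert a s ha ih => rw [sum_insert ha, prod_insert ha, AddChar.map_add_eq_mul, ih]

theorem expSum_pow (φ : ℕ → G) (B : Finset ℕ) (ψ : AddChar G ℂ) (v : ℕ) :
    expSum φ B ψ ^ v = ∑ y ∈ Fintype.piFinset (fun _ : Fin v => B), ψ (∑ i, φ (y i)) := by
  have h := prod_univ_sum (fun _ : Fin v => B) (fun _ x => ψ (φ x))
  simp only [prod_const, card_univ, Fintype.card_fin] at h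
  rw [expSum, h]
  exact sum_congr rfl fun y _ => (map_sum_eq_prod ψ univ fun i => φ (y i)).symm

theorem norm_pow_two_mul (z : ℂ) (v : ℕ) : ((‖z‖ ^ (2 * v) : ℝ) : ℂ) = z ^ v * conj (z ^ v) := by
  rw [Complex.mul_conj', norm_pow, mul_comm 2 v, pow_mul]
  norm_cast

variable [Finite G]

/-- The mixed moment of two exponential sums. -/
noncomputable def moment (φ : ℕ → G) (A B : Finset ℕ) (u v : ℕ) : ℝ :=
  𝔼 ψ : AddChar G ℂ, ‖expSum φ A ψ‖ ^ u * ‖expSum φ B ψ‖ ^ v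

theorem moment_nonneg (φ : ℕ → G) (A B : Finset ℕ) (u v : ℕ) : 0 ≤ moment φ A B u v :=
  expect_nonneg fun _ _ => by positivity

theorem rep_eq_expect (φ : ℕ → G) (B : Finset ℕ) (v : ℕ) (g : G) :
    (rep φ B v g : ℂ) = 𝔼 ψ : AddChar G ℂ, ψ g * ((‖expSum φ B ψ‖ ^ (2 * v) : ℝ) : ℂ) := by
  classical
  have h : ∀ ψ : AddChar G ℂ, ψ g * ((‖expSum φ B ψ‖ ^ (2 * v) : ℝ) : ℂ) =
      ∑ yz ∈ Fintype.piFinset (fun _ : Fin v => B) ×ˢ Fintype.piFinset (fun _ : Fin v => B),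
        ψ (g + ∑ i, φ (yz.1 i) - ∑ i, φ (yz.2 i)) := by
    intro ψ
    rw [norm_pow_two_mul, expSum_pow, map_sum, sum_mul_sum, mul_sum, sum_product]
    refine sum_congr rfl fun y _ => ?_
    rw [mul_sum]
    refine sum_congr rfl fun z _ => ?_
    rw [sub_eq_add_neg, AddChar.map_add_eq_mul, AddChar.map_add_eq_mul, AddChar.map_neg_eq_conj,
      mul_assoc]
  simp_rw [h]
  rw [expect_sum_comm]
  simp_rw [AddChar.expect_apply_eq_ite, sub_eq_zero]
  rw [rep, card_filter]
  push_cast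
  rfl

theorem moment_two_eq (φ : ℕ → G) (A B : Finset ℕ) (v : ℕ) :
    moment φ A B 2 (2 * v) = ∑ x ∈ A ×ˢ A, (rep φ B v (φ x.1 - φ x.2) : ℝ) := by
  have h : ((moment φ A B 2 (2 * v) : ℝ) : ℂ) =
      ∑ x ∈ A ×ˢ A, (rep φ B v (φ x.1 - φ x.2) : ℂ) := by
    simp_rw [rep_eq_expect]
    rw [← expect_sum_comm, moment, Complex.ofReal_expect]
    refine expect_congr rfl fun ψ _ => ?_
    rw [← sum_mul, Complex.ofReal_mul, show 2 = 2 * 1 from rfl, norm_pow_two_mul, pow_one, mul_one]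
    congr 1
    rw [expSum, map_sum, sum_mul_sum, sum_product]
    simp_rw [sub_eq_add_neg, AddChar.map_add_eq_mul, AddChar.map_neg_eq_conj]
  exact_mod_cast h

theorem expect_four_eq (φ : ℕ → G) (A₁ A₂ A₃ A₄ B : Finset ℕ) (v : ℕ) :
    ((∑ x ∈ (A₁ ×ˢ A₂) ×ˢ (A₃ ×ˢ A₄),
      rep φ B v (φ x.1.1 + φ x.1.2 - (φ x.2.1 + φ x.2.2)) : ℕ) : ℂ) =
    𝔼 ψ : AddChar G ℂ, expSum φ A₁ ψ * expSum φ A₂ ψ *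
      (conj (expSum φ A₃ ψ) * conj (expSum φ A₄ ψ)) *
        ((‖expSum φ B ψ‖ ^ (2 * v) : ℝ) : ℂ) := by
  push_cast
  simp_rw [rep_eq_expect]
  rw [← expect_sum_comm]
  refine expect_congr rfl fun ψ _ => ?_
  rw [← sum_mul]
  push_cast
  congr 1
  simp only [expSum, map_sum]
  rw [sum_mul_sum, sum_mul_sum, ← sum_product', ← sum_product', sum_mul_sum, ← sum_product']
  refine sum_congr rfl fun x _ => ?_
  rw [sub_eq_add_neg, AddChar.map_add_eq_mul, AddChar.map_neg_eq_conj, AddChar.map_add_eq_mul,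
    AddChar.map_add_eq_mul, map_mul]

theorem moment_four_eq (φ : ℕ → G) (A B : Finset ℕ) (v : ℕ) :
    moment φ A B 4 (2 * v) = ∑ x ∈ (A ×ˢ A) ×ˢ (A ×ˢ A),
      (rep φ B v (φ x.1.1 + φ x.1.2 - (φ x.2.1 + φ x.2.2)) : ℝ) := by
  have h : ((moment φ A B 4 (2 * v) : ℝ) : ℂ) = ((∑ x ∈ (A ×ˢ A) ×ˢ (A ×ˢ A),
      rep φ B v (φ x.1.1 + φ x.1.2 - (φ x.2.1 + φ x.2.2)) : ℕ) : ℂ) := by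
    rw [expect_four_eq, moment, Complex.ofReal_expect]
    refine expect_congr rfl fun ψ _ => ?_
    rw [Complex.ofReal_mul, show 4 = 2 * 2 from rfl, norm_pow_two_mul, map_pow]
    ring
  exact_mod_cast h

theorem four_mul_le (a b c d : ℝ) : a * b * (c * d) ≤ (a ^ 4 + b ^ 4 + c ^ 4 + d ^ 4) / 4 := by
  nlinarith [sq_nonneg (a * b - c * d), sq_nonneg (a ^ 2 - b ^ 2), sq_nonneg (c ^ 2 - d ^ 2)]

theorem sum_rep_four_le (φ : ℕ → G) (A₁ A₂ A₃ A₄ B : Finset ℕ) (v : ℕ) :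
    ∑ x ∈ (A₁ ×ˢ A₂) ×ˢ (A₃ ×ˢ A₄),
      (rep φ B v (φ x.1.1 + φ x.1.2 - (φ x.2.1 + φ x.2.2)) : ℝ) ≤
    (moment φ A₁ B 4 (2 * v) + moment φ A₂ B 4 (2 * v) + moment φ A₃ B 4 (2 * v) +
      moment φ A₄ B 4 (2 * v)) / 4 := by
  have h := congrArg norm (expect_four_eq φ A₁ A₂ A₃ A₄ B v)
  rw [Complex.norm_natCast] at h
  push_cast at h
  rw [h]
  simp only [moment]
  rw [← expect_add_distrib, ← expect_add_distrib, ← expect_add_distrib, expect_div]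
  refine (RCLike.norm_expect_le (K := ℂ)).trans (expect_le_expect fun ψ _ => ?_)
  rw [← add_mul, ← add_mul, ← add_mul, mul_div_right_comm]
  simp only [norm_mul, norm_pow, RCLike.norm_conj, Complex.norm_real, norm_norm]
  gcongr
  exact four_mul_le _ _ _ _

theorem moment_zero_eq (φ : ℕ → G) (A B : Finset ℕ) (v : ℕ) :
    moment φ A B 0 (2 * v) = (rep φ B v 0 : ℝ) := by
  have h : ((moment φ A B 0 (2 * v) : ℝ) : ℂ) = (rep φ B v 0 : ℂ) := by
    rw [rep_eq_expect, moment, Complex.ofReal_expect]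
    simp
  exact_mod_cast h

theorem expect_pow_le_of_pow_eq {ι : Type*} [Fintype ι] [Nonempty ι] {m n : ℕ}
    (hm : 0 < m) (hn : 0 < n) {F P Q : ι → ℝ} (hF : ∀ i, 0 ≤ F i) (hP : ∀ i, 0 ≤ P i)
    (hQ : ∀ i, 0 ≤ Q i) (h : ∀ i, F i ^ (m + n) = P i ^ m * Q i ^ n) :
    (𝔼 i, F i) ^ (m + n) ≤ (𝔼 i, P i) ^ m * (𝔼 i, Q i) ^ n := by
  have hm' : (0 : ℝ) < m := by exact_mod_cast hm
  have hn' : (0 : ℝ) < n := by exact_mod_cast hn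
  have hpq : Real.HolderConjugate (((m : ℝ) + n) / m) ((m + n) / n) := by
    rw [Real.holderConjugate_iff]
    constructor
    · rw [lt_div_iff₀ hm']; linarith
    · field_simp
  have key := Real.inner_le_Lp_mul_Lq_of_nonneg univ hpq
    (f := fun i => P i ^ ((m : ℝ) / (m + n))) (g := fun i => Q i ^ ((n : ℝ) / (m + n)))
    (fun i _ => Real.rpow_nonneg (hP i) _) (fun i _ => Real.rpow_nonneg (hQ i) _)
  have hFi : ∀ i, F i = P i ^ ((m : ℝ) / (m + n)) * Q i ^ ((n : ℝ) / (m + n)) := by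
    intro i
    refine (pow_left_inj₀ (hF i) (mul_nonneg (Real.rpow_nonneg (hP i) _)
      (Real.rpow_nonneg (hQ i) _)) (by omega : m + n ≠ 0)).1 ?_
    rw [h i, mul_pow, ← Real.rpow_natCast, ← Real.rpow_natCast, ← Real.rpow_natCast,
      ← Real.rpow_natCast, ← Real.rpow_mul (hP i), ← Real.rpow_mul (hQ i)]
    push_cast
    congr 2 <;> field_simp
  have hPi : ∀ i, (P i ^ ((m : ℝ) / (m + n))) ^ (((m : ℝ) + n) / m) = P i := by
    intro i
    rw [← Real.rpow_mul (hP i)]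
    have : (m : ℝ) / (m + n) * (((m : ℝ) + n) / m) = 1 := by field_simp
    rw [this, Real.rpow_one]
  have hQi : ∀ i, (Q i ^ ((n : ℝ) / (m + n))) ^ (((m : ℝ) + n) / n) = Q i := by
    intro i
    rw [← Real.rpow_mul (hQ i)]
    have : (n : ℝ) / (m + n) * (((m : ℝ) + n) / n) = 1 := by field_simp
    rw [this, Real.rpow_one]
  simp_rw [hPi, hQi, ← hFi, one_div_div] at key
  have hSP : 0 ≤ ∑ i, P i := sum_nonneg fun i _ => hP i
  have hSQ : 0 ≤ ∑ i, Q i := sum_nonneg fun i _ => hQ i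
  have key2 := pow_le_pow_left₀ (sum_nonneg fun i _ => hF i) key (m + n)
  rw [mul_pow, ← Real.rpow_natCast (_ ^ _), ← Real.rpow_natCast (_ ^ _), ← Real.rpow_mul hSP,
    ← Real.rpow_mul hSQ] at key2
  have e1 : (m : ℝ) / (m + n) * ((m + n : ℕ) : ℝ) = m := by push_cast; field_simp
  have e2 : (n : ℝ) / (m + n) * ((m + n : ℕ) : ℝ) = n := by push_cast; field_simp
  rw [e1, e2, Real.rpow_natCast, Real.rpow_natCast] at key2
  simp_rw [Fintype.expect_eq_sum_div_card, div_pow]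
  rw [div_mul_div_comm, ← pow_add]
  gcongr

end Fourier

theorem sum_le_sum_of_cover {α ι : Type*} {s : Finset α} {R : Finset ι} {t : ι → Finset α}
    {w : α → ℝ} (hw : ∀ x, 0 ≤ w x) (h : ∀ x ∈ s, w x ≠ 0 → ∃ i ∈ R, x ∈ t i) :
    ∑ x ∈ s, w x ≤ ∑ i ∈ R, ∑ x ∈ t i, w x := by
  classical
  calc ∑ x ∈ s, w x ≤ ∑ x ∈ s, ∑ i ∈ R, if x ∈ t i then w x else 0 := by
        refine sum_le_sum fun x hx => ?_
        by_cases h0 : w x = 0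
        · simp [h0]
        · obtain ⟨i, hi, hxi⟩ := h x hx h0
          have := single_le_sum (f := fun i => if x ∈ t i then w x else 0)
            (fun j _ => by split_ifs <;> simp [hw x]) hi
          simpa [hxi] using this
    _ = ∑ i ∈ R, ∑ x ∈ s with x ∈ t i, w x := by
        rw [sum_comm]
        simp_rw [sum_filter]
    _ ≤ ∑ i ∈ R, ∑ x ∈ t i, w x := by
        refine sum_le_sum fun i _ => sum_le_sum_of_subset_of_nonneg ?_ fun x _ _ => hw x
        exact fun x hx => (mem_filter.1 hx).2

/-- The twisted cubic over `ZMod N`. -/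
def curve (N : ℕ) (x : ℕ) : ZMod N × ZMod N × ZMod N := (x, x ^ 2, x ^ 3)

/-- The elements of `[1, X]` congruent to `ξ` modulo `q`. -/
def residueClass (X q : ℕ) (ξ : ℤ) : Finset ℕ := {x ∈ Icc 1 X | (x : ℤ) ≡ ξ [ZMOD q]}

theorem mem_residueClass {X q x : ℕ} {ξ : ℤ} :
    x ∈ residueClass X q ξ ↔ (1 ≤ x ∧ x ≤ X) ∧ (x : ℤ) ≡ ξ [ZMOD q] := by
  simp [residueClass]

theorem sum_pow_le {X m j : ℕ} {x : Fin m → ℕ} (hx : ∀ i, 1 ≤ x i ∧ x i ≤ X) (hj : j ≤ 3) :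
    ∑ i, x i ^ j ≤ m * X ^ 3 := by
  calc ∑ i, x i ^ j ≤ ∑ _i : Fin m, X ^ 3 := sum_le_sum fun i _ =>
        (Nat.pow_le_pow_right (hx i).1 hj).trans (Nat.pow_le_pow_left (hx i).2 3)
    _ = m * X ^ 3 := by simp

theorem sum_curve_eq_iff {X m : ℕ} (hm : m ≤ 6) {x y : Fin m → ℕ}
    (hx : ∀ i, 1 ≤ x i ∧ x i ≤ X) (hy : ∀ i, 1 ≤ y i ∧ y i ≤ X) :
    ∑ i, curve (6 * X ^ 3 + 1) (x i) = ∑ i, curve (6 * X ^ 3 + 1) (y i) ↔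
      ∀ j ∈ Icc 1 3, ∑ i, x i ^ j = ∑ i, y i ^ j := by
  have hb : ∀ z : Fin m → ℕ, (∀ i, 1 ≤ z i ∧ z i ≤ X) → ∀ j ≤ 3,
      ∑ i, z i ^ j < 6 * X ^ 3 + 1 := fun z hz j hj =>
    Nat.lt_succ_of_le ((sum_pow_le hz hj).trans (Nat.mul_le_mul_right _ hm))
  have key : ∀ j ≤ 3, ((∑ i, (x i : ZMod (6 * X ^ 3 + 1)) ^ j = ∑ i, (y i : ZMod _) ^ j) ↔
      ∑ i, x i ^ j = ∑ i, y i ^ j) := by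
    intro j hj
    have := ZMod.natCast_eq_natCast_iff' (∑ i, x i ^ j) (∑ i, y i ^ j) (6 * X ^ 3 + 1)
    rw [Nat.mod_eq_of_lt (hb x hx j hj), Nat.mod_eq_of_lt (hb y hy j hj)] at this
    rw [← this]
    push_cast
    rfl
  have h1 := key 1 (by norm_num)
  have h2 := key 2 (by norm_num)
  have h3 := key 3 (by norm_num)
  rw [show Icc 1 3 = {1, 2, 3} from rfl]
  simp only [mem_insert, mem_singleton, forall_eq_or_imp, forall_eq, ← h1, ← h2, ← h3]
  simp only [curve, Prod.ext_iff, Prod.fst_sum, Prod.snd_sum, pow_one]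

theorem exists_of_rep_ne_zero {G : Type*} [AddCommGroup G] {φ : ℕ → G} {B : Finset ℕ} {v : ℕ}
    {g : G} (h : rep φ B v g ≠ 0) :
    ∃ y z : Fin v → ℕ, (∀ i, y i ∈ B) ∧ (∀ i, z i ∈ B) ∧ g + ∑ i, φ (y i) = ∑ i, φ (z i) := by
  classical
  rw [rep, card_ne_zero] at h
  obtain ⟨⟨y, z⟩, hyz⟩ := h
  simp only [mem_filter, mem_product, Fintype.mem_piFinset] at hyz
  exact ⟨y, z, hyz.1.1, hyz.1.2, hyz.2⟩

theorem dvd_pow_of_mem_residueClass {X p b x : ℕ} {η : ℤ} (hx : x ∈ residueClass X (p ^ b) η)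
    (j : ℕ) : (p : ℤ) ^ (j * b) ∣ ((x : ℤ) - η) ^ j := by
  have h := (mem_residueClass.1 hx).2.symm.dvd
  push_cast at h
  rw [mul_comm, pow_mul]
  exact pow_dvd_pow_of_dvd h j

theorem dvd_of_rep_two_ne_zero {X p b x₁ x₂ : ℕ} {η : ℤ} (h1 : 1 ≤ x₁ ∧ x₁ ≤ X)
    (h2 : 1 ≤ x₂ ∧ x₂ ≤ X)
    (h : rep (curve (6 * X ^ 3 + 1)) (residueClass X (p ^ b) η) 5
      (curve (6 * X ^ 3 + 1) x₁ - curve (6 * X ^ 3 + 1) x₂) ≠ 0) :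
    (p : ℤ) ^ (3 * b) ∣ ((x₁ : ℤ) - η) ^ 3 - ((x₂ : ℤ) - η) ^ 3 := by
  obtain ⟨y, z, hy, hz, hyz⟩ := exists_of_rep_ne_zero h
  have key := (sum_curve_eq_iff (X := X) (x := Fin.cons x₁ y) (y := Fin.cons x₂ z) le_rfl
    (fun i => by
      refine Fin.cases h1 (fun i => ?_) i
      exact (mem_residueClass.1 (hy i)).1)
    (fun i => by
      refine Fin.cases h2 (fun i => ?_) i
      exact (mem_residueClass.1 (hz i)).1)).1 (by
      rw [Fin.sum_univ_succ, Fin.sum_univ_succ (n := 5)]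
      simp only [Fin.cons_zero, Fin.cons_succ]
      rw [← hyz]
      abel)
  have k1 := key 1 (by simp)
  have k2 := key 2 (by simp)
  have k3 := key 3 (by simp)
  simp only [Fin.sum_univ_succ (n := 5), Fin.cons_zero, Fin.cons_succ,
    Fin.sum_univ_five] at k1 k2 k3
  zify at k1 k2 k3
  have hd : (p : ℤ) ^ (3 * b) ∣ ∑ i, ((z i : ℤ) - η) ^ 3 - ∑ i, ((y i : ℤ) - η) ^ 3 :=
    dvd_sub (dvd_sum fun i _ => dvd_pow_of_mem_residueClass (hz i) 3)
      (dvd_sum fun i _ => dvd_pow_of_mem_residueClass (hy i) 3)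
  convert hd using 1
  simp only [Fin.sum_univ_five]
  linear_combination k3 - 3 * η * k2 + 3 * η ^ 2 * k1

theorem dvd_of_rep_four_ne_zero {X p b x₁ x₂ x₃ x₄ : ℕ} {η : ℤ} (h1 : 1 ≤ x₁ ∧ x₁ ≤ X)
    (h2 : 1 ≤ x₂ ∧ x₂ ≤ X) (h3 : 1 ≤ x₃ ∧ x₃ ≤ X) (h4 : 1 ≤ x₄ ∧ x₄ ≤ X)
    (h : rep (curve (6 * X ^ 3 + 1)) (residueClass X (p ^ b) η) 4
      (curve (6 * X ^ 3 + 1) x₁ + curve (6 * X ^ 3 + 1) x₂ -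
        (curve (6 * X ^ 3 + 1) x₃ + curve (6 * X ^ 3 + 1) x₄)) ≠ 0) :
    (p : ℤ) ^ (2 * b) ∣ ((x₁ : ℤ) - η) ^ 2 + ((x₂ : ℤ) - η) ^ 2 -
      ((x₃ : ℤ) - η) ^ 2 - ((x₄ : ℤ) - η) ^ 2 ∧
    (p : ℤ) ^ (2 * b) ∣ ((x₁ : ℤ) - η) ^ 3 + ((x₂ : ℤ) - η) ^ 3 -
      ((x₃ : ℤ) - η) ^ 3 - ((x₄ : ℤ) - η) ^ 3 := by
  obtain ⟨y, z, hy, hz, hyz⟩ := exists_of_rep_ne_zero h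
  have key := (sum_curve_eq_iff (X := X) (x := Fin.cons x₁ (Fin.cons x₂ y : Fin 5 → ℕ))
    (y := Fin.cons x₃ (Fin.cons x₄ z : Fin 5 → ℕ)) le_rfl
    (fun i => by
      refine Fin.cases h1 (fun i => Fin.cases h2 (fun i => ?_) i) i
      exact (mem_residueClass.1 (hy i)).1)
    (fun i => by
      refine Fin.cases h3 (fun i => Fin.cases h4 (fun i => ?_) i) i
      exact (mem_residueClass.1 (hz i)).1)).1 (by
      simp only [Fin.sum_univ_succ (n := 5), Fin.sum_univ_succ (n := 4), Fin.cons_zero,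
        Fin.cons_succ]
      rw [← hyz]
      abel)
  have k1 := key 1 (by simp)
  have k2 := key 2 (by simp)
  have k3 := key 3 (by simp)
  simp only [Fin.sum_univ_succ (n := 5), Fin.sum_univ_succ (n := 4), Fin.cons_zero, Fin.cons_succ,
    Fin.sum_univ_four] at k1 k2 k3
  zify at k1 k2 k3
  have hd (j : ℕ) : (p : ℤ) ^ (j * b) ∣ ∑ i, ((z i : ℤ) - η) ^ j - ∑ i, ((y i : ℤ) - η) ^ j :=
    dvd_sub (dvd_sum fun i _ => dvd_pow_of_mem_residueClass (hz i) j)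
      (dvd_sum fun i _ => dvd_pow_of_mem_residueClass (hy i) j)
  constructor
  · obtain ⟨c, hc⟩ := hd 2
    refine ⟨c, ?_⟩
    simp only [Fin.sum_univ_four] at hc
    linear_combination hc - 2 * η * k1 + k2
  · refine (pow_dvd_pow _ (by omega : 2 * b ≤ 3 * b)).trans ?_
    obtain ⟨c, hc⟩ := hd 3
    refine ⟨c, ?_⟩
    simp only [Fin.sum_univ_four] at hc
    linear_combination hc - 3 * η * k2 + 3 * η ^ 2 * k1 + k3


theorem not_dvd_of_five_le {p : ℕ} (hp : p.Prime) (h5 : 5 ≤ p) : ¬p ∣ 12 := by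
  rw [show 12 = 2 * 2 * 3 from rfl, hp.dvd_mul, hp.dvd_mul]
  rintro ((h | h) | h) <;> have := Nat.le_of_dvd (by norm_num) h <;> omega

theorem dvd_sub_of_dvd_cube_sub {p k : ℕ} (hp : p.Prime) (h5 : 5 ≤ p) {u₁ u₂ : ℤ}
    (hu : ¬(p : ℤ) ∣ u₁) (h12 : (p : ℤ) ∣ u₁ - u₂) (h : (p : ℤ) ^ k ∣ u₁ ^ 3 - u₂ ^ 3) :
    (p : ℤ) ^ k ∣ u₁ - u₂ := by
  have hp' : Prime (p : ℤ) := Nat.prime_iff_prime_int.1 hp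
  have hw : ¬(p : ℤ) ∣ u₁ ^ 2 + u₁ * u₂ + u₂ ^ 2 := by
    intro hd
    have h3 : (p : ℤ) ∣ 12 * u₁ ^ 2 := by
      have := (hd.add (h12.mul_right (2 * u₁ + u₂))).mul_left 4
      convert! this using 1
      ring
    rcases hp'.dvd_mul.1 h3 with h3 | h3
    · exact not_dvd_of_five_le hp h5 (by exact_mod_cast h3)
    · exact hu (hp'.dvd_of_dvd_pow h3)
  have hc : IsCoprime ((p : ℤ) ^ k) (u₁ ^ 2 + u₁ * u₂ + u₂ ^ 2) :=
    ((Prime.coprime_iff_not_dvd hp').2 hw).pow_left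
  refine hc.dvd_of_dvd_mul_right ?_
  convert! h using 1
  ring

theorem dvd_of_dvd_quadratic_cubic {p k : ℕ} (hp : p.Prime) (h5 : 5 ≤ p) {u₁ u₂ u₃ u₄ : ℤ}
    (hu : ¬(p : ℤ) ∣ u₁) (h12 : (p : ℤ) ∣ u₁ - u₂) (h13 : (p : ℤ) ∣ u₁ - u₃)
    (h14 : (p : ℤ) ∣ u₁ - u₄) (hQ : (p : ℤ) ^ k ∣ u₁ ^ 2 + u₂ ^ 2 - u₃ ^ 2 - u₄ ^ 2)
    (hC : (p : ℤ) ^ k ∣ u₁ ^ 3 + u₂ ^ 3 - u₃ ^ 3 - u₄ ^ 3) :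
    (p : ℤ) ^ k ∣ u₁ + u₂ - u₃ - u₄ ∧ (p : ℤ) ^ k ∣ (u₁ - u₃) * (u₁ - u₄) := by
  have hp' : Prime (p : ℤ) := Nat.prime_iff_prime_int.1 hp
  have h12' : ¬(p : ℤ) ∣ 12 := fun h => not_dvd_of_five_le hp h5 (by exact_mod_cast h)
  set w : ℤ := 3 * (u₃ - u₄) ^ 2 - 2 * (u₁ + u₂) ^ 2 - 2 * (u₁ + u₂) * (u₃ + u₄) +
    (u₃ + u₄) ^ 2 with hw_def
  have hw : ¬(p : ℤ) ∣ w := by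
    intro hd
    obtain ⟨e₂, he₂⟩ := h12
    obtain ⟨e₃, he₃⟩ := h13
    obtain ⟨e₄, he₄⟩ := h14
    obtain rfl : u₂ = u₁ - p * e₂ := by linarith
    obtain rfl : u₃ = u₁ - p * e₃ := by linarith
    obtain rfl : u₄ = u₁ - p * e₄ := by linarith
    have h3 : (p : ℤ) ∣ 12 * u₁ ^ 2 := by
      rw [← dvd_neg, ← dvd_sub_right hd]
      exact ⟨12 * u₁ * e₂ + 3 * p * (e₃ - e₄) ^ 2 - 2 * p * e₂ ^ 2 - 2 * p * e₂ * (e₃ + e₄)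
        + p * (e₃ + e₄) ^ 2, by rw [hw_def]; ring⟩
    rcases hp'.dvd_mul.1 h3 with h3 | h3
    · exact h12' h3
    · exact hu (hp'.dvd_of_dvd_pow h3)
  have hc : IsCoprime ((p : ℤ) ^ k) w := ((Prime.coprime_iff_not_dvd hp').2 hw).pow_left
  have hsum : (p : ℤ) ^ k ∣ u₁ + u₂ - u₃ - u₄ := by
    refine hc.dvd_of_dvd_mul_right ?_
    have := (hC.mul_left 4).sub (hQ.mul_left (6 * (u₁ + u₂)))
    convert! this using 1
    rw [hw_def]
    ring
  refine ⟨hsum, ?_⟩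
  have h2 : ¬(p : ℤ) ∣ 2 := fun h => h12' (h.trans (by norm_num))
  have hc2 : IsCoprime ((p : ℤ) ^ k) 2 := ((Prime.coprime_iff_not_dvd hp').2 h2).pow_left
  refine hc2.dvd_of_dvd_mul_left ?_
  have := hQ.sub (hsum.mul_right (u₃ + u₄ - u₁ + u₂))
  convert! this using 1
  ring

theorem exists_pow_dvd_of_pow_dvd_mul {p k : ℕ} (hp : p.Prime) {x y : ℤ}
    (h : (p : ℤ) ^ k ∣ x * y) : ∃ i ≤ k, (p : ℤ) ^ i ∣ x ∧ (p : ℤ) ^ (k - i) ∣ y := by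
  have h' : p ^ k ∣ x.natAbs * y.natAbs := by
    rw [← Int.natAbs_mul, ← Int.natCast_dvd]
    exact_mod_cast h
  obtain ⟨c, d, hc, hd, hcd⟩ := exists_dvd_and_dvd_of_dvd_mul h'
  obtain ⟨i, hi, rfl⟩ := (Nat.dvd_prime_pow hp).1 (Dvd.intro d hcd.symm)
  have hd' : d = p ^ (k - i) := by
    refine Nat.eq_of_mul_eq_mul_left (pow_pos hp.pos i) ?_
    rw [← hcd, ← pow_add, Nat.add_sub_cancel' hi]
  subst hd'
  exact ⟨i, hi, by exact_mod_cast Int.natCast_dvd.2 hc, by exact_mod_cast Int.natCast_dvd.2 hd⟩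

theorem exists_modEq_add_mul {p k m : ℕ} (hp : 0 < p) (hkm : k ≤ m) {x y : ℤ}
    (h : (p : ℤ) ^ k ∣ x - y) :
    ∃ t ∈ range (p ^ (m - k)), x ≡ y + p ^ k * t [ZMOD (p ^ m : ℕ)] := by
  obtain ⟨e, he⟩ := h
  have hpos : (0 : ℤ) < (p : ℤ) ^ (m - k) := by positivity
  have h0 := Int.emod_nonneg e hpos.ne'
  have h1 := Int.emod_lt_of_pos e hpos
  refine ⟨(e % (p : ℤ) ^ (m - k)).toNat, ?_, ?_⟩
  · rw [mem_range]
    zify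
    rwa [Int.toNat_of_nonneg h0]
  · rw [Int.toNat_of_nonneg h0, Int.emod_def]
    refine Int.ModEq.symm (Int.modEq_iff_dvd.2 ⟨e / (p : ℤ) ^ (m - k), ?_⟩)
    push_cast
    have : (p : ℤ) ^ m = p ^ k * p ^ (m - k) := by rw [← pow_add, Nat.add_sub_cancel' hkm]
    rw [this]
    linear_combination he

theorem dvd_sub_of_mem_residueClass {X q x : ℕ} {ξ : ℤ} (h : x ∈ residueClass X q ξ) :
    (q : ℤ) ∣ (x : ℤ) - ξ :=
  (mem_residueClass.1 h).2.symm.dvd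

theorem moment_two_le {p X a b : ℕ} (hp : p.Prime) (h5 : 5 ≤ p) (ha : 1 ≤ a) (hab : a ≤ 3 * b)
    {ξ η : ℤ} (hξη : ¬(p : ℤ) ∣ ξ - η) {K : ℝ}
    (hK : ∀ ξ' : ℤ, (p : ℤ) ∣ ξ' - ξ → moment (curve (6 * X ^ 3 + 1))
      (residueClass X (p ^ (3 * b)) ξ') (residueClass X (p ^ b) η) 2 10 ≤ K) :
    moment (curve (6 * X ^ 3 + 1)) (residueClass X (p ^ a) ξ) (residueClass X (p ^ b) η) 2 10 ≤
      (p : ℝ) ^ (3 * b - a) * K := by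
  have hpa : (p : ℤ) ∣ (p : ℤ) ^ a := dvd_pow_self _ (by omega)
  have hcover := sum_le_sum_of_cover
    (s := residueClass X (p ^ a) ξ ×ˢ residueClass X (p ^ a) ξ) (R := range (p ^ (3 * b - a)))
    (t := fun t => residueClass X (p ^ (3 * b)) (ξ + p ^ a * t) ×ˢ
      residueClass X (p ^ (3 * b)) (ξ + p ^ a * t))
    (w := fun x => (rep (curve (6 * X ^ 3 + 1)) (residueClass X (p ^ b) η) 5
      (curve (6 * X ^ 3 + 1) x.1 - curve (6 * X ^ 3 + 1) x.2) : ℝ))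
    (fun _ => Nat.cast_nonneg _) (by
      rintro ⟨x₁, x₂⟩ hx hne
      rw [mem_product] at hx
      obtain ⟨hx₁, hx₂⟩ := hx
      dsimp only at hx₁ hx₂ hne
      have hd₁ := dvd_sub_of_mem_residueClass hx₁
      have hd₂ := dvd_sub_of_mem_residueClass hx₂
      push_cast at hd₁ hd₂
      have hd := dvd_of_rep_two_ne_zero (mem_residueClass.1 hx₁).1 (mem_residueClass.1 hx₂).1
        (by exact_mod_cast hne)
      have hsub := dvd_sub_of_dvd_cube_sub hp h5 (u₁ := x₁ - η) (u₂ := x₂ - η)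
        (fun h => hξη (by
          have := h.sub (hpa.trans hd₁)
          convert! this using 1
          ring))
        (by
          have := (hpa.trans hd₁).sub (hpa.trans hd₂)
          convert! this using 1
          ring) hd
      rw [sub_sub_sub_cancel_right] at hsub
      obtain ⟨t, ht, htx⟩ := exists_modEq_add_mul hp.pos hab hd₁
      refine ⟨t, ht, mem_product.2 ⟨mem_residueClass.2 ⟨(mem_residueClass.1 hx₁).1, htx⟩,
        mem_residueClass.2 ⟨(mem_residueClass.1 hx₂).1, Int.ModEq.trans ?_ htx⟩⟩⟩
      exact Int.modEq_iff_dvd.2 (by exact_mod_cast hsub))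
  rw [show (10 : ℕ) = 2 * 5 from rfl] at hK ⊢
  rw [moment_two_eq]
  refine hcover.trans ((sum_le_card_nsmul _ _ K fun t _ => ?_).trans (by simp))
  rw [← moment_two_eq]
  exact hK _ (by simpa using hpa.mul_right _)

theorem moment_four_le {p X a b : ℕ} (hp : p.Prime) (h5 : 5 ≤ p) (ha : 1 ≤ a) (hab : a ≤ b)
    {ξ η : ℤ} (hξη : ¬(p : ℤ) ∣ ξ - η) {K : ℝ}
    (hK : ∀ ξ' : ℤ, (p : ℤ) ∣ ξ' - ξ → moment (curve (6 * X ^ 3 + 1))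
      (residueClass X (p ^ (2 * b - a)) ξ') (residueClass X (p ^ b) η) 4 8 ≤ K) :
    moment (curve (6 * X ^ 3 + 1)) (residueClass X (p ^ a) ξ) (residueClass X (p ^ b) η) 4 8 ≤
      (2 * b) * (p : ℝ) ^ (4 * (b - a)) * K := by
  have hpa : (p : ℤ) ∣ (p : ℤ) ^ a := dvd_pow_self _ (by omega)
  set c := 2 * (b - a) with hc
  have hcover := sum_le_sum_of_cover
    (s := (residueClass X (p ^ a) ξ ×ˢ residueClass X (p ^ a) ξ) ×ˢ
      (residueClass X (p ^ a) ξ ×ˢ residueClass X (p ^ a) ξ))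
    (R := (range (c + 1)).sigma fun i => range (p ^ c) ×ˢ range (p ^ (c - i)) ×ˢ range (p ^ i))
    (t := fun r => (residueClass X (p ^ (2 * b - a)) (ξ + p ^ a * r.2.1) ×ˢ
        residueClass X (p ^ (2 * b - a)) (ξ + p ^ a * r.2.1 + p ^ (a + r.1) * r.2.2.1 +
          p ^ (2 * b - a - r.1) * r.2.2.2)) ×ˢ
      (residueClass X (p ^ (2 * b - a)) (ξ + p ^ a * r.2.1 + p ^ (a + r.1) * r.2.2.1) ×ˢ
        residueClass X (p ^ (2 * b - a)) (ξ + p ^ a * r.2.1 + p ^ (2 * b - a - r.1) * r.2.2.2)))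
    (w := fun x => (rep (curve (6 * X ^ 3 + 1)) (residueClass X (p ^ b) η) 4
      (curve (6 * X ^ 3 + 1) x.1.1 + curve (6 * X ^ 3 + 1) x.1.2 -
        (curve (6 * X ^ 3 + 1) x.2.1 + curve (6 * X ^ 3 + 1) x.2.2)) : ℝ))
    (fun _ => Nat.cast_nonneg _) (by
      rintro ⟨⟨x₁, x₂⟩, ⟨x₃, x₄⟩⟩ hx hne
      simp only [mem_product] at hx
      obtain ⟨⟨hx₁, hx₂⟩, hx₃, hx₄⟩ := hx
      dsimp only at hne
      have hd₁ := dvd_sub_of_mem_residueClass hx₁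
      have hd₂ := dvd_sub_of_mem_residueClass hx₂
      have hd₃ := dvd_sub_of_mem_residueClass hx₃
      have hd₄ := dvd_sub_of_mem_residueClass hx₄
      push_cast at hd₁ hd₂ hd₃ hd₄
      rw [mem_residueClass] at hx₁ hx₂ hx₃ hx₄
      obtain ⟨hQ, hC⟩ := dvd_of_rep_four_ne_zero hx₁.1 hx₂.1 hx₃.1 hx₄.1 (by exact_mod_cast hne)
      have hdiff : ∀ y : ℤ, (p : ℤ) ^ a ∣ y - ξ → (p : ℤ) ^ a ∣ (x₁ - η) - (y - η) := by
        intro y hy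
        have := hd₁.sub hy
        convert! this using 1
        ring
      obtain ⟨hS, hP⟩ := dvd_of_dvd_quadratic_cubic hp h5 (u₁ := x₁ - η)
        (fun h => hξη (by
          have := h.sub (hpa.trans hd₁)
          convert! this using 1
          ring)) (hpa.trans (hdiff _ hd₂)) (hpa.trans (hdiff _ hd₃)) (hpa.trans (hdiff _ hd₄)) hQ hC
      have h₃ := hdiff _ hd₃
      have h₄ := hdiff _ hd₄
      rw [sub_sub_sub_cancel_right] at h₃ h₄
      rw [sub_sub_sub_cancel_right, sub_sub_sub_cancel_right] at hP
      obtain ⟨i, hi, hi₃, hi₄⟩ : ∃ i ≤ c, (p : ℤ) ^ (a + i) ∣ (x₁ : ℤ) - x₃ ∧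
          (p : ℤ) ^ (2 * b - a - i) ∣ (x₁ : ℤ) - x₄ := by
        obtain ⟨j, hj, hj₃, hj₄⟩ := exists_pow_dvd_of_pow_dvd_mul hp hP
        rcases le_or_gt j a with hja | hja
        · exact ⟨0, by omega, h₃, (pow_dvd_pow _ (by omega)).trans hj₄⟩
        · rcases le_or_gt j (2 * b - a) with hjb | hjb
          · exact ⟨j - a, by omega, (pow_dvd_pow _ (by omega)).trans hj₃,
              (pow_dvd_pow _ (by omega)).trans hj₄⟩
          · exact ⟨c, le_rfl, (pow_dvd_pow _ (by omega)).trans hj₃,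
              (pow_dvd_pow _ (by omega)).trans h₄⟩
      obtain ⟨t, ht, htx⟩ := exists_modEq_add_mul hp.pos (by omega : a ≤ 2 * b - a) hd₁
      obtain ⟨α, hα, hαx⟩ := exists_modEq_add_mul hp.pos (by omega : a + i ≤ 2 * b - a)
        (dvd_sub_comm.1 hi₃)
      obtain ⟨β, hβ, hβx⟩ := exists_modEq_add_mul hp.pos (by omega : 2 * b - a - i ≤ 2 * b - a)
        (dvd_sub_comm.1 hi₄)
      rw [show 2 * b - a - a = c by omega] at ht
      rw [show 2 * b - a - (a + i) = c - i by omega] at hα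
      rw [show 2 * b - a - (2 * b - a - i) = i by omega] at hβ
      have htx₃ := hαx.trans (htx.add_right _)
      have htx₄ := hβx.trans (htx.add_right _)
      have htx₂ : (x₂ : ℤ) ≡ x₃ + x₄ - x₁ [ZMOD (p ^ (2 * b - a) : ℕ)] := by
        refine (Int.modEq_iff_dvd.2 ?_).symm
        push_cast
        refine (pow_dvd_pow _ (by omega : 2 * b - a ≤ 2 * b)).trans ?_
        convert! hS using 1
        ring
      refine ⟨⟨i, t, α, β⟩, ?_, ?_⟩
      · simp only [mem_sigma, mem_product]
        exact ⟨mem_range.2 (by omega), ht, hα, hβ⟩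
      · simp only [mem_product, mem_residueClass]
        refine ⟨⟨⟨hx₁.1, htx⟩, hx₂.1, ?_⟩, ⟨hx₃.1, htx₃⟩, hx₄.1, htx₄⟩
        have := htx₂.trans ((htx₃.add htx₄).sub htx)
        convert! this using 1
        ring)
  rw [show (8 : ℕ) = 2 * 4 from rfl] at hK ⊢
  rw [moment_four_eq]
  have hK0 : 0 ≤ K := (moment_nonneg _ _ _ _ _).trans (hK ξ (by simp))
  refine hcover.trans ((sum_le_card_nsmul _ _ K fun r hr => ?_).trans ?_)
  · have hrc := mem_range.1 (mem_sigma.1 hr).1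
    refine (sum_rep_four_le _ _ _ _ _ _ _).trans ?_
    have hdv : ∀ k ≥ a, ∀ z : ℤ, (p : ℤ) ∣ (p : ℤ) ^ k * z := fun k hk z =>
      (dvd_pow_self _ (by omega)).mul_right _
    have d₁ := hdv a le_rfl r.2.1
    have d₂ := hdv (a + r.1) (by omega) r.2.2.1
    have d₃ := hdv (2 * b - a - r.1) (by omega) r.2.2.2
    have m₁ := hK (ξ + p ^ a * r.2.1) (by simpa using d₁)
    have m₂ := hK (ξ + p ^ a * r.2.1 + p ^ (a + r.1) * r.2.2.1 +
      p ^ (2 * b - a - r.1) * r.2.2.2) (by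
        convert! (d₁.add d₂).add d₃ using 1
        ring)
    have m₃ := hK (ξ + p ^ a * r.2.1 + p ^ (a + r.1) * r.2.2.1) (by
      convert! d₁.add d₂ using 1
      ring)
    have m₄ := hK (ξ + p ^ a * r.2.1 + p ^ (2 * b - a - r.1) * r.2.2.2) (by
      convert! d₁.add d₃ using 1
      ring)
    linarith
  · rw [card_sigma, nsmul_eq_mul]
    refine mul_le_mul_of_nonneg_right ?_ hK0
    have hcard : ∀ i ∈ range (c + 1),
        #(range (p ^ c) ×ˢ range (p ^ (c - i)) ×ˢ range (p ^ i)) = p ^ (2 * c) := by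
      intro i hi
      rw [card_product, card_product, card_range, card_range, card_range, ← pow_add, ← pow_add]
      congr 1
      have := mem_range.1 hi
      omega
    rw [sum_congr rfl hcard, sum_const, card_range, smul_eq_mul,
      show 2 * c = 4 * (b - a) by omega]
    push_cast
    refine mul_le_mul_of_nonneg_right ?_ (by positivity)
    exact_mod_cast (by omega : c + 1 ≤ 2 * b)

theorem moment_four_pow_le {G : Type*} [AddCommGroup G] [Finite G] (φ : ℕ → G) (A B : Finset ℕ) :
    moment φ A B 4 8 ^ 3 ≤ moment φ B A 4 8 * moment φ A B 2 10 ^ 2 := by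
  have := expect_pow_le_of_pow_eq (m := 1) (n := 2) one_pos two_pos
    (F := fun ψ : AddChar G ℂ => ‖expSum φ A ψ‖ ^ 4 * ‖expSum φ B ψ‖ ^ 8)
    (P := fun ψ => ‖expSum φ B ψ‖ ^ 4 * ‖expSum φ A ψ‖ ^ 8)
    (Q := fun ψ => ‖expSum φ A ψ‖ ^ 2 * ‖expSum φ B ψ‖ ^ 10)
    (fun _ => by positivity) (fun _ => by positivity) (fun _ => by positivity)
    (fun _ => by ring)
  simpa [moment] using this

theorem moment_two_pow_le {G : Type*} [AddCommGroup G] [Finite G] (φ : ℕ → G) (A B : Finset ℕ) :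
    moment φ A B 2 10 ^ 4 ≤ moment φ B A 4 8 * moment φ A B 0 12 ^ 3 := by
  have := expect_pow_le_of_pow_eq (m := 1) (n := 3) one_pos three_pos
    (F := fun ψ : AddChar G ℂ => ‖expSum φ A ψ‖ ^ 2 * ‖expSum φ B ψ‖ ^ 10)
    (P := fun ψ => ‖expSum φ B ψ‖ ^ 4 * ‖expSum φ A ψ‖ ^ 8)
    (Q := fun ψ => ‖expSum φ A ψ‖ ^ 0 * ‖expSum φ B ψ‖ ^ 12)
    (fun _ => by positivity) (fun _ => by positivity) (fun _ => by positivity)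
    (fun _ => by ring)
  simpa [moment] using this

theorem moment_four_pow_le_diagonal {G : Type*} [AddCommGroup G] [Finite G] (φ : ℕ → G)
    (A B : Finset ℕ) :
    moment φ A B 4 8 ^ 3 ≤ moment φ B A 0 12 * moment φ A B 0 12 ^ 2 := by
  have := expect_pow_le_of_pow_eq (m := 1) (n := 2) one_pos two_pos
    (F := fun ψ : AddChar G ℂ => ‖expSum φ A ψ‖ ^ 4 * ‖expSum φ B ψ‖ ^ 8)
    (P := fun ψ => ‖expSum φ B ψ‖ ^ 0 * ‖expSum φ A ψ‖ ^ 12)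
    (Q := fun ψ => ‖expSum φ A ψ‖ ^ 0 * ‖expSum φ B ψ‖ ^ 12)
    (fun _ => by positivity) (fun _ => by positivity) (fun _ => by positivity)
    (fun _ => by ring)
  simpa [moment] using this

/-- The number of solutions of the cubic Vinogradov system in six pairs of variables from `B`. -/
def solutionCount (B : Finset ℕ) : ℕ :=
  #{yz ∈ Fintype.piFinset (fun _ : Fin 6 => B) ×ˢ Fintype.piFinset (fun _ : Fin 6 => B) |
    ∀ j ∈ Icc 1 3, ∑ i, yz.1 i ^ j = ∑ i, yz.2 i ^ j}

theorem Jcount_eq_solutionCount {X : ℝ} (hX : 0 ≤ X) :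
    Jcount 6 3 X = solutionCount (Icc 1 ⌊X⌋₊) := by
  rw [Jcount, solutionCount]
  refine Nat.subtype_card _ fun yz => ?_
  simp only [mem_filter, mem_product, Fintype.mem_piFinset, Finset.mem_Icc, Nat.le_floor_iff hX,
    and_assoc]

theorem moment_zero_eq_solutionCount {X : ℕ} {B : Finset ℕ} (hB : ∀ x ∈ B, 1 ≤ x ∧ x ≤ X)
    (A : Finset ℕ) : moment (curve (6 * X ^ 3 + 1)) A B 0 12 = solutionCount B := by
  rw [show 12 = 2 * 6 from rfl, moment_zero_eq, rep, solutionCount]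
  norm_cast
  congr 1
  ext ⟨y, z⟩
  simp only [mem_filter, mem_product, Fintype.mem_piFinset, zero_add]
  refine and_congr_right fun h => ?_
  exact sum_curve_eq_iff le_rfl (fun i => hB _ (h.1 i)) (fun i => hB _ (h.2 i))

theorem sum_pow_eq_of_affine {P s : ℤ} (hP : P ≠ 0) {y z : Fin 6 → ℤ}
    (h : ∀ j ∈ Icc 1 3, ∑ i, (P * y i + s) ^ j = ∑ i, (P * z i + s) ^ j) :
    ∀ j ∈ Icc 1 3, ∑ i, y i ^ j = ∑ i, z i ^ j := by
  rw [show Icc 1 3 = {1, 2, 3} from rfl] at h ⊢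
  simp only [mem_insert, mem_singleton, forall_eq_or_imp, forall_eq, Fin.sum_univ_six] at h ⊢
  obtain ⟨h1, h2, h3⟩ := h
  have e1 : y 0 ^ 1 + y 1 ^ 1 + y 2 ^ 1 + y 3 ^ 1 + y 4 ^ 1 + y 5 ^ 1 =
      z 0 ^ 1 + z 1 ^ 1 + z 2 ^ 1 + z 3 ^ 1 + z 4 ^ 1 + z 5 ^ 1 :=
    mul_left_cancel₀ hP (by linear_combination h1)
  have e2 : y 0 ^ 2 + y 1 ^ 2 + y 2 ^ 2 + y 3 ^ 2 + y 4 ^ 2 + y 5 ^ 2 =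
      z 0 ^ 2 + z 1 ^ 2 + z 2 ^ 2 + z 3 ^ 2 + z 4 ^ 2 + z 5 ^ 2 :=
    mul_left_cancel₀ (pow_ne_zero 2 hP) (by linear_combination h2 - 2 * P * s * e1)
  refine ⟨e1, e2, mul_left_cancel₀ (pow_ne_zero 3 hP) ?_⟩
  linear_combination h3 - 3 * P ^ 2 * s * e2 - 3 * P * s ^ 2 * e1

theorem solutionCount_residueClass_le {X q : ℕ} (hq : 0 < q) (η : ℤ) :
    solutionCount (residueClass X q η) ≤ solutionCount (Icc 1 (X / q + 1)) := by
  have hx : ∀ x ∈ residueClass X q η, (x : ℤ) = q * ((x / q + 1 : ℕ) : ℤ) + (η % q - q) := by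
    intro x hx
    have h1 : (x : ℤ) % q = η % q := (mem_residueClass.1 hx).2
    have h2 := Int.emod_add_mul_ediv (x : ℤ) q
    push_cast
    linarith
  refine card_le_card_of_injOn
    (fun yz => (fun i => yz.1 i / q + 1, fun i => yz.2 i / q + 1)) ?_ ?_
  · rintro ⟨y, z⟩ hyz
    simp only [coe_filter, mem_product, Fintype.mem_piFinset, Set.mem_ofPred_eq] at hyz ⊢
    obtain ⟨⟨hy, hz⟩, h⟩ := hyz
    have hmem : ∀ x ∈ residueClass X q η, x / q + 1 ∈ Icc 1 (X / q + 1) := fun x hx =>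
      mem_Icc.2 ⟨Nat.le_add_left 1 _,
        Nat.succ_le_succ (Nat.div_le_div_right (mem_residueClass.1 hx).1.2)⟩
    refine ⟨⟨fun i => hmem _ (hy i), fun i => hmem _ (hz i)⟩, fun j hj => ?_⟩
    have := sum_pow_eq_of_affine (P := q) (s := η % q - q) (by exact_mod_cast hq.ne')
      (y := fun i => ((y i / q + 1 : ℕ) : ℤ)) (z := fun i => ((z i / q + 1 : ℕ) : ℤ))
      (fun j hj => by
        simp_rw [← hx _ (hy _), ← hx _ (hz _)]
        exact_mod_cast h j hj) j hj
    exact_mod_cast this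
  · rintro ⟨y, z⟩ hyz ⟨y', z'⟩ hyz' heq
    simp only [coe_filter, mem_product, Fintype.mem_piFinset, Set.mem_ofPred_eq] at hyz hyz'
    simp only [Prod.mk.injEq, funext_iff] at heq
    have hinj : ∀ x ∈ residueClass X q η, ∀ x' ∈ residueClass X q η,
        x / q + 1 = x' / q + 1 → x = x' := by
      intro x h x' h' e
      have h1 := hx x h
      rw [e, ← hx x' h'] at h1
      exact_mod_cast h1
    ext i
    · exact hinj _ (hyz.1.1 i) _ (hyz'.1.1 i) (heq.1 i)
    · exact hinj _ (hyz.1.2 i) _ (hyz'.1.2 i) (heq.2 i)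

theorem solutionCount_Icc_le (M : ℕ) : solutionCount (Icc 1 M) ≤ M ^ 12 := by
  refine (card_filter_le _ _).trans ?_
  simp [← pow_add]

theorem sum_pow_twelve_le {ι : Type*} [DecidableEq ι] (s : Finset ι) (a : ι → ℝ)
    (ha : ∀ i, 0 ≤ a i) :
    (∑ i ∈ s, a i) ^ 12 ≤ 2 ^ 12 * ∑ i ∈ s, a i ^ 12 +
      (2 * #s : ℝ) ^ 12 * ∑ x ∈ s.offDiag, a x.1 ^ 4 * a x.2 ^ 8 := by
  rcases s.eq_empty_or_nonempty with rfl | hs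
  · simp
  have hS : 0 ≤ ∑ i ∈ s, a i := sum_nonneg fun i _ => ha i
  have hn1 : 0 ≤ ∑ i ∈ s, a i ^ 12 := sum_nonneg fun i _ => by have := ha i; positivity
  have hn2 : 0 ≤ ∑ x ∈ s.offDiag, a x.1 ^ 4 * a x.2 ^ 8 :=
    sum_nonneg fun x _ => by have := ha x.1; have := ha x.2; positivity
  obtain ⟨i, hi, himax⟩ := exists_max_image s a hs
  by_cases h : ∑ i ∈ s, a i ≤ 2 * a i
  · have h1 : (∑ i ∈ s, a i) ^ 12 ≤ 2 ^ 12 * a i ^ 12 := by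
      rw [← mul_pow]
      exact pow_le_pow_left₀ hS h 12
    have h2 : a i ^ 12 ≤ ∑ i ∈ s, a i ^ 12 :=
      single_le_sum (f := fun i => a i ^ 12) (fun j _ => by have := ha j; positivity) hi
    have h3 : 0 ≤ (2 * #s : ℝ) ^ 12 * ∑ x ∈ s.offDiag, a x.1 ^ 4 * a x.2 ^ 8 := by positivity
    linarith
  · push Not at h
    have herase := add_sum_erase s a hi
    have hne : (s.erase i).Nonempty := by
      by_contra hemp
      rw [not_nonempty_iff_eq_empty.1 hemp, sum_empty] at herase
      have := ha i
      linarith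
    obtain ⟨k, hk, hkmax⟩ := exists_max_image (s.erase i) a hne
    have hks := mem_of_mem_erase hk
    have h1 : ∑ j ∈ s.erase i, a j ≤ #s * a k := by
      refine (sum_le_card_nsmul _ _ (a k) hkmax).trans ?_
      rw [nsmul_eq_mul]
      exact mul_le_mul_of_nonneg_right (by exact_mod_cast card_le_card (erase_subset i s)) (ha k)
    have h2 : ∑ i ∈ s, a i ≤ 2 * #s * a k := by linarith
    have h3 : (∑ i ∈ s, a i) ^ 12 ≤ (2 * #s : ℝ) ^ 12 * (a i ^ 4 * a k ^ 8) := by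
      refine (pow_le_pow_left₀ hS h2 12).trans ?_
      rw [mul_pow]
      gcongr
      calc a k ^ 12 = a k ^ 4 * a k ^ 8 := by ring
        _ ≤ a i ^ 4 * a k ^ 8 := by
          have := himax k hks
          have := ha k
          gcongr
    have h4 : a i ^ 4 * a k ^ 8 ≤ ∑ x ∈ s.offDiag, a x.1 ^ 4 * a x.2 ^ 8 :=
      single_le_sum (f := fun x : ι × ι => a x.1 ^ 4 * a x.2 ^ 8)
        (fun x _ => by have := ha x.1; have := ha x.2; positivity)
        (mem_offDiag.2 ⟨hi, hks, (ne_of_mem_erase hk).symm⟩ : (i, k) ∈ s.offDiag)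
    have h5 := mul_le_mul_of_nonneg_left h4 (by positivity : (0 : ℝ) ≤ (2 * #s : ℝ) ^ 12)
    linarith

theorem expSum_eq_sum_residueClass {G : Type*} [AddCommGroup G] (φ : ℕ → G) {X p : ℕ}
    (hp : 0 < p) (ψ : AddChar G ℂ) :
    expSum φ (Icc 1 X) ψ = ∑ ξ ∈ range p, expSum φ (residueClass X p ξ) ψ := by
  simp only [expSum]
  rw [← sum_fiberwise_of_maps_to (s := Icc 1 X) (t := range p) (g := fun x => x % p)
    fun x _ => mem_range.2 (Nat.mod_lt x hp)]
  refine sum_congr rfl fun ξ hξ => sum_congr ?_ fun _ _ => rfl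
  ext x
  rw [mem_filter, residueClass, mem_filter, Int.natCast_modEq_iff, Nat.ModEq,
    Nat.mod_eq_of_lt (mem_range.1 hξ)]

theorem solutionCount_le_split {X p : ℕ} (hp : 0 < p) :
    (solutionCount (Icc 1 X) : ℝ) ≤
      2 ^ 12 * ∑ ξ ∈ range p, (solutionCount (residueClass X p ξ) : ℝ) +
      (2 * p : ℝ) ^ 12 * ∑ x ∈ (range p).offDiag, moment (curve (6 * X ^ 3 + 1))
        (residueClass X p x.1) (residueClass X p x.2) 4 8 := by
  have hpt : ∀ ψ : AddChar (ZMod (6 * X ^ 3 + 1) × ZMod (6 * X ^ 3 + 1) × ZMod (6 * X ^ 3 + 1)) ℂ,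
      ‖expSum (curve (6 * X ^ 3 + 1)) (Icc 1 X) ψ‖ ^ 12 ≤
        2 ^ 12 * ∑ ξ ∈ range p,
          ‖expSum (curve (6 * X ^ 3 + 1)) (residueClass X p ξ) ψ‖ ^ 12 +
        (2 * p : ℝ) ^ 12 * ∑ x ∈ (range p).offDiag,
          ‖expSum (curve (6 * X ^ 3 + 1)) (residueClass X p x.1) ψ‖ ^ 4 *
          ‖expSum (curve (6 * X ^ 3 + 1)) (residueClass X p x.2) ψ‖ ^ 8 := by
    intro ψ
    have h := sum_pow_twelve_le (range p)
      (fun ξ : ℕ => ‖expSum (curve (6 * X ^ 3 + 1)) (residueClass X p ξ) ψ‖)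
      (fun _ => norm_nonneg _)
    rw [card_range] at h
    refine le_trans ?_ h
    rw [expSum_eq_sum_residueClass _ hp]
    exact pow_le_pow_left₀ (norm_nonneg _) (norm_sum_le _ _) 12
  have h := expect_le_expect (s := univ) fun ψ _ => hpt ψ
  rw [expect_add_distrib, ← mul_expect, ← mul_expect, expect_sum_comm, expect_sum_comm] at h
  have hfull := moment_zero_eq_solutionCount (X := X) (B := Icc 1 X)
    (fun x hx => mem_Icc.1 hx) ∅
  have hres : ∀ ξ : ℤ, moment (curve (6 * X ^ 3 + 1)) ∅ (residueClass X p ξ) 0 12 =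
      solutionCount (residueClass X p ξ) := fun ξ =>
    moment_zero_eq_solutionCount (fun x hx => (mem_residueClass.1 hx).1) ∅
  simp only [moment, pow_zero, one_mul] at hfull hres
  rw [hfull] at h
  simp_rw [hres] at h
  exact h

theorem pow_mul_rpow_pow {p : ℝ} (hp : 0 < p) (c x : ℝ) (n : ℕ) :
    (c * p ^ x) ^ n = c ^ n * p ^ (x * n) := by
  rw [mul_pow, Real.rpow_mul_natCast hp.le]

theorem le_of_pow_four_le {p A c I V W b d u : ℝ} (hp : 0 < p) (hA : 0 ≤ A) (hc : 0 ≤ c)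
    (hV : 0 ≤ V) (hI : I ^ 4 ≤ W * V ^ 3)
    (hWle : W ≤ c ^ 2 * A * p ^ (-2 * b - 4 * (3 * b) - u * (3 * (3 * b) - b)))
    (hVle : V ≤ A * p ^ (-(6 + d) * b)) :
    I ≤ √c * A * p ^ ((-32 * b - 8 * u * b - 3 * d * b) / 4) := by
  refine le_of_pow_le_pow_left₀ (n := 4) (by norm_num) (by positivity) ?_
  calc I ^ 4 ≤ W * V ^ 3 := hI
    _ ≤ (c ^ 2 * A * p ^ (-2 * b - 4 * (3 * b) - u * (3 * (3 * b) - b))) *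
        (A * p ^ (-(6 + d) * b)) ^ 3 := by gcongr
    _ = (√c ^ 2) ^ 2 * A ^ 4 * (p ^ (-2 * b - 4 * (3 * b) - u * (3 * (3 * b) - b)) *
        p ^ (-(6 + d) * b * (3 : ℕ))) := by
      rw [pow_mul_rpow_pow hp, Real.sq_sqrt hc]
      ring
    _ = _ := by
      rw [pow_mul_rpow_pow hp, ← Real.rpow_add hp, mul_pow, ← pow_mul]
      congr 2
      push_cast
      ring

theorem le_of_pow_three_le {p A c m U I a b d u : ℝ} (hp : 0 < p) (hA : 0 ≤ A) (hc : 0 ≤ c)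
    (hI : 0 ≤ I) (hm : m ^ 3 ≤ U * I ^ 2)
    (hUle : U ≤ c ^ 2 * A * p ^ (-2 * b - 4 * (2 * b - a) - u * (3 * (2 * b - a) - b)))
    (hIle : I ≤ p ^ (a + b) * (√c * A * p ^ ((-32 * b - 8 * u * b - 3 * d * b) / 4))) :
    m ≤ c * A * p ^ (2 * a - 8 * b - u * (3 * b - a) - d * b / 2) := by
  have hIle' : I ≤ √c * A * p ^ (a + b + (-32 * b - 8 * u * b - 3 * d * b) / 4) := by
    rw [Real.rpow_add hp]
    exact hIle.trans_eq (by ring)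
  refine le_of_pow_le_pow_left₀ (n := 3) (by norm_num) (by positivity) ?_
  calc m ^ 3 ≤ U * I ^ 2 := hm
    _ ≤ (c ^ 2 * A * p ^ (-2 * b - 4 * (2 * b - a) - u * (3 * (2 * b - a) - b))) *
        (√c * A * p ^ (a + b + (-32 * b - 8 * u * b - 3 * d * b) / 4)) ^ 2 := by gcongr
    _ = c ^ 2 * (√c ^ 2) * A ^ 3 * (p ^ (-2 * b - 4 * (2 * b - a) - u * (3 * (2 * b - a) - b)) *
        p ^ ((a + b + (-32 * b - 8 * u * b - 3 * d * b) / 4) * (2 : ℕ))) := by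
      rw [pow_mul_rpow_pow hp]
      ring
    _ = _ := by
      rw [pow_mul_rpow_pow hp, ← Real.rpow_add hp, mul_pow, Real.sq_sqrt hc, ← pow_succ]
      congr 2
      push_cast
      ring

/-- Bounds for the mixed moments, given a bound for the number of solutions of the system in
each residue class. -/
theorem moment_four_le_of_solutionCount_le {p X B : ℕ} (hp : p.Prime) (h5 : 5 ≤ p) (hB : 1 ≤ B)
    {A d : ℝ} (hA : 0 ≤ A) (hd : 0 ≤ d)
    (hV : ∀ b ≤ B, ∀ η : ℤ,
      (solutionCount (residueClass X (p ^ b) η) : ℝ) ≤ A * (p : ℝ) ^ (-(6 + d) * b))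
    (n : ℕ) : ∀ a b : ℕ, 1 ≤ a → a ≤ b → 3 ^ n * b ≤ B → ∀ ξ η : ℤ, ¬(p : ℤ) ∣ ξ - η →
      moment (curve (6 * X ^ 3 + 1)) (residueClass X (p ^ a) ξ) (residueClass X (p ^ b) η) 4 8 ≤
        (2 * B : ℝ) ^ 2 * A * (p : ℝ) ^ (-2 * a - 4 * b - n * d / 6 * (3 * b - a) : ℝ) := by
  have hp1 : (1 : ℝ) ≤ p := by exact_mod_cast hp.one_le
  have hp0 : (0 : ℝ) < p := by linarith
  have hB1 : (1 : ℝ) ≤ B := by exact_mod_cast hB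
  have hV' : ∀ b ≤ B, ∀ η : ℤ, ∀ S, moment (curve (6 * X ^ 3 + 1)) S
      (residueClass X (p ^ b) η) 0 12 ≤ A * (p : ℝ) ^ (-(6 + d) * b) := by
    intro b hb η S
    rw [moment_zero_eq_solutionCount fun x hx => (mem_residueClass.1 hx).1]
    exact hV b hb η
  induction n with
  | zero =>
    intro a b ha hab hb ξ η _
    rw [pow_zero, one_mul] at hb
    have h1 : moment (curve (6 * X ^ 3 + 1)) (residueClass X (p ^ a) ξ)
        (residueClass X (p ^ b) η) 4 8 ≤ A * (p : ℝ) ^ (-2 * a - 4 * b : ℝ) := by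
      refine le_of_pow_le_pow_left₀ (n := 3) (by norm_num) (by positivity) ?_
      refine (moment_four_pow_le_diagonal _ _ _).trans ?_
      calc _ ≤ (A * (p : ℝ) ^ (-(6 + d) * a)) * (A * (p : ℝ) ^ (-(6 + d) * b)) ^ 2 := by
            have h0 := moment_nonneg (curve (6 * X ^ 3 + 1)) (residueClass X (p ^ a) ξ)
              (residueClass X (p ^ b) η) 0 12
            gcongr
            · exact hV' a (hab.trans hb) ξ _
            · exact hV' b hb η _
        _ = A ^ 3 * (p : ℝ) ^ (-(6 + d) * a + -(6 + d) * b * 2) := by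
            rw [pow_mul_rpow_pow hp0, Real.rpow_add hp0]
            push_cast
            ring
        _ ≤ _ := by
            rw [pow_mul_rpow_pow hp0]
            gcongr
            push_cast
            nlinarith [mul_nonneg hd (Nat.cast_nonneg (α := ℝ) a),
              mul_nonneg hd (Nat.cast_nonneg (α := ℝ) b)]
    have h2 : A * (p : ℝ) ^ (-2 * a - 4 * b : ℝ) ≤
        (2 * B : ℝ) ^ 2 * (A * (p : ℝ) ^ (-2 * a - 4 * b : ℝ)) :=
      le_mul_of_one_le_left (by positivity) (one_le_pow₀ (by linarith))
    refine (h1.trans h2).trans_eq ?_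
    rw [mul_assoc]
    simp
  | succ n ih =>
    intro a b ha hab hb ξ η hξη
    have hbB : 3 * b ≤ B := le_trans
      (by rw [pow_succ, mul_assoc]; exact Nat.le_mul_of_pos_left _ (by positivity)) hb
    rw [pow_succ, mul_assoc] at hb
    have hbB' : b ≤ B := by omega
    have hbBr : (b : ℝ) ≤ B := by exact_mod_cast hbB'
    have hcast : ((2 * b - a : ℕ) : ℝ) = 2 * b - a := by
      rw [Nat.cast_sub (by omega)]
      push_cast
      ring
    have hm' : ∀ ξ' : ℤ, (p : ℤ) ∣ ξ' - ξ → moment (curve (6 * X ^ 3 + 1))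
        (residueClass X (p ^ (2 * b - a)) ξ') (residueClass X (p ^ b) η) 4 8 ≤
        2 * B * A * (p : ℝ) ^ (2 * a - 8 * b - n * d / 6 * (3 * b - a) - d * b / 2 : ℝ) := by
      intro ξ' hξ'
      have hξ'η : ¬(p : ℤ) ∣ ξ' - η := fun h => hξη (by simpa using dvd_sub h hξ')
      have hηξ' : ¬(p : ℤ) ∣ η - ξ' := fun h => hξ'η (by rwa [dvd_sub_comm])
      refine le_of_pow_three_le hp0 hA (by positivity) (moment_nonneg _ _ _ _ _)
        (moment_four_pow_le _ _ _) (c := 2 * B) ?_ ?_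
      · have := ih b (2 * b - a) (ha.trans hab) (by omega)
          (le_trans (Nat.mul_le_mul_left _ (by omega)) hb) η ξ' hηξ'
        rwa [hcast] at this
      · refine (moment_two_le (K := √(2 * B) * A *
          (p : ℝ) ^ ((-32 * b - 8 * (n * d / 6) * b - 3 * d * b) / 4 : ℝ))
          hp h5 (by omega) (by omega) hξ'η fun ξ'' hξ'' => ?_).trans_eq ?_
        · have hηξ'' : ¬(p : ℤ) ∣ η - ξ'' := fun h => hηξ' (by simpa using dvd_add h hξ'')
          refine le_of_pow_four_le hp0 hA (by positivity) (moment_nonneg _ _ _ _ _)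
            (moment_two_pow_le _ _ _) (b := b) ?_ (hV' b hbB' η _)
          have := ih b (3 * b) (ha.trans hab) (by omega) hb η ξ'' hηξ''
          push_cast at this
          exact this
        · congr 1
          rw [← Real.rpow_natCast, Nat.cast_sub (by omega), hcast]
          push_cast
          congr 1
          ring
    refine (moment_four_le hp h5 ha hab hξη hm').trans ?_
    calc 2 * b * (p : ℝ) ^ (4 * (b - a)) *
          (2 * B * A * (p : ℝ) ^ (2 * a - 8 * b - n * d / 6 * (3 * b - a) - d * b / 2 : ℝ))
        ≤ 2 * B * (p : ℝ) ^ (4 * (b - a)) *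
          (2 * B * A * (p : ℝ) ^ (2 * a - 8 * b - n * d / 6 * (3 * b - a) - d * b / 2 : ℝ)) := by
          gcongr
      _ = (2 * B) ^ 2 * A * (p : ℝ) ^ (4 * (b - a) +
          (2 * a - 8 * b - n * d / 6 * (3 * b - a) - d * b / 2) : ℝ) := by
          rw [Real.rpow_add hp0, ← Real.rpow_natCast, Nat.cast_mul, Nat.cast_sub hab]
          push_cast
          ring
      _ ≤ _ := by
          gcongr
          push_cast
          nlinarith [mul_nonneg hd (Nat.cast_nonneg (α := ℝ) a)]

theorem solutionCount_residueClass_le_rpow {C d : ℝ} (hC : 0 ≤ C) (hd : 0 ≤ d)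
    (h : ∀ M : ℕ, 1 ≤ M → (solutionCount (Icc 1 M) : ℝ) ≤ C * (M : ℝ) ^ (6 + d))
    {X q : ℕ} (hq : 0 < q) (hqX : q ≤ X) (η : ℤ) :
    (solutionCount (residueClass X q η) : ℝ) ≤
      C * 2 ^ (6 + d) * (X : ℝ) ^ (6 + d) * (q : ℝ) ^ (-(6 + d)) := by
  have hq0 : (0 : ℝ) < q := by exact_mod_cast hq
  have hX0 : (0 : ℝ) ≤ X := Nat.cast_nonneg X
  have h1 : ((X / q + 1 : ℕ) : ℝ) ≤ 2 * X / q := by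
    have h2 : ((X / q : ℕ) : ℝ) ≤ X / q := Nat.cast_div_le
    have h3 : (1 : ℝ) ≤ X / q := (one_le_div hq0).2 (by exact_mod_cast hqX)
    push_cast
    rw [mul_div_assoc]
    linarith
  calc (solutionCount (residueClass X q η) : ℝ)
      ≤ solutionCount (Icc 1 (X / q + 1)) := by exact_mod_cast solutionCount_residueClass_le hq η
    _ ≤ C * ((X / q + 1 : ℕ) : ℝ) ^ (6 + d) := h _ (Nat.le_add_left 1 _)
    _ ≤ C * (2 * X / q : ℝ) ^ (6 + d) := by gcongr
    _ = _ := by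
      rw [Real.div_rpow (by positivity) hq0.le, Real.mul_rpow (by norm_num) hX0,
        Real.rpow_neg hq0.le]
      ring

theorem solutionCount_le_div_prime {C d : ℝ} (hC : 0 ≤ C) (hd : 0 ≤ d)
    (h : ∀ M : ℕ, 1 ≤ M → (solutionCount (Icc 1 M) : ℝ) ≤ C * (M : ℝ) ^ (6 + d))
    {n p X : ℕ} (hn : 27 ≤ n * d) (hp : p.Prime) (h5 : 5 ≤ p) (hpX : p ^ 3 ^ n ≤ X) :
    (solutionCount (Icc 1 X) : ℝ) ≤
      2 ^ 13 * ((2 * 3 ^ n) ^ 2 * (C * 2 ^ (6 + d))) * (X : ℝ) ^ (6 + d) * (p : ℝ)⁻¹ := by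
  have hp1 : (1 : ℝ) ≤ p := by exact_mod_cast hp.one_le
  have hp0 : (0 : ℝ) < p := by linarith
  have hB : 1 ≤ 3 ^ n := Nat.one_le_pow _ _ (by norm_num)
  have hBr : (1 : ℝ) ≤ 3 ^ n := one_le_pow₀ (by norm_num)
  set A := C * 2 ^ (6 + d) * (X : ℝ) ^ (6 + d) with hA
  have hA0 : 0 ≤ A := by positivity
  have hV : ∀ b : ℕ, b ≤ 3 ^ n → ∀ η : ℤ,
      (solutionCount (residueClass X (p ^ b) η) : ℝ) ≤ A * (p : ℝ) ^ (-(6 + d) * b) := by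
    intro b hb η
    have := solutionCount_residueClass_le_rpow hC hd h (pow_pos hp.pos b)
      ((Nat.pow_le_pow_right hp.pos hb).trans hpX) η
    rw [Nat.cast_pow, ← Real.rpow_natCast_mul hp0.le, mul_comm (b : ℝ)] at this
    exact this
  have h1 : ∑ ξ ∈ range p, (solutionCount (residueClass X p ξ) : ℝ) ≤ A * (p : ℝ)⁻¹ := by
    refine (sum_le_card_nsmul _ _ (A * (p : ℝ) ^ (-2 : ℝ)) fun ξ _ => ?_).trans_eq ?_
    · have := hV 1 hB ξ
      rw [pow_one, Nat.cast_one, mul_one] at this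
      refine this.trans ?_
      gcongr
      linarith
    · rw [card_range, nsmul_eq_mul, Real.rpow_neg hp0.le, Real.rpow_two]
      field_simp
  have h2 : ∑ x ∈ (range p).offDiag, moment (curve (6 * X ^ 3 + 1))
      (residueClass X p x.1) (residueClass X p x.2) 4 8 ≤
      (2 * 3 ^ n) ^ 2 * A * ((p : ℝ) ^ 13)⁻¹ := by
    refine (sum_le_card_nsmul _ _ ((2 * 3 ^ n) ^ 2 * A * ((p : ℝ) ^ 15)⁻¹) ?_).trans ?_
    · rintro ⟨ξ, η⟩ hx
      rw [mem_offDiag, mem_range, mem_range] at hx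
      have hξη : ¬(p : ℤ) ∣ (ξ : ℤ) - η := by
        intro hdvd
        have := (Nat.modEq_iff_dvd.2 hdvd).eq_of_lt_of_lt hx.2.1 hx.1
        exact hx.2.2 this.symm
      have := moment_four_le_of_solutionCount_le hp h5 hB hA0 hd hV n 1 1 le_rfl le_rfl
        (by rw [mul_one]) ξ η hξη
      simp only [pow_one] at this
      refine this.trans ?_
      push_cast
      gcongr
      rw [← Real.rpow_natCast, ← Real.rpow_neg hp0.le]
      refine Real.rpow_le_rpow_of_exponent_le hp1 ?_
      push_cast
      linarith
    · rw [nsmul_eq_mul]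
      calc (#(range p).offDiag : ℝ) * ((2 * 3 ^ n) ^ 2 * A * ((p : ℝ) ^ 15)⁻¹)
          ≤ (p ^ 2 : ℝ) * ((2 * 3 ^ n) ^ 2 * A * ((p : ℝ) ^ 15)⁻¹) := by
            gcongr
            rw [offDiag_card, card_range, sq]
            exact_mod_cast Nat.sub_le _ _
        _ = _ := by field_simp
  have h3 : A * (p : ℝ)⁻¹ ≤ (2 * 3 ^ n) ^ 2 * (A * (p : ℝ)⁻¹) :=
    le_mul_of_one_le_left (by positivity) (one_le_pow₀ (by linarith))
  calc (solutionCount (Icc 1 X) : ℝ)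
      ≤ 2 ^ 12 * ∑ ξ ∈ range p, (solutionCount (residueClass X p ξ) : ℝ) +
        (2 * p : ℝ) ^ 12 * ∑ x ∈ (range p).offDiag, moment (curve (6 * X ^ 3 + 1))
          (residueClass X p x.1) (residueClass X p x.2) 4 8 := solutionCount_le_split hp.pos
    _ ≤ 2 ^ 12 * ((2 * 3 ^ n) ^ 2 * (A * (p : ℝ)⁻¹)) +
        (2 * p : ℝ) ^ 12 * ((2 * 3 ^ n) ^ 2 * A * ((p : ℝ) ^ 13)⁻¹) := by
      have := h1.trans h3
      gcongr
    _ = 2 ^ 13 * ((2 * 3 ^ n) ^ 2 * (C * 2 ^ (6 + d))) * (X : ℝ) ^ (6 + d) * (p : ℝ)⁻¹ := by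
      rw [hA]
      field_simp
      ring

/-- The statement that the number of solutions in `[1, M]` is `O(M ^ (6 + d))`. -/
def HasExponent (d : ℝ) : Prop :=
  ∃ C : ℝ, ∀ M : ℕ, 1 ≤ M → (solutionCount (Icc 1 M) : ℝ) ≤ C * (M : ℝ) ^ (6 + d)

theorem HasExponent.mono {d e : ℝ} (hde : d ≤ e) (h : HasExponent d) : HasExponent e := by
  obtain ⟨C, hC⟩ := h
  refine ⟨|C|, fun M hM => (hC M hM).trans ?_⟩
  have : (1 : ℝ) ≤ M := by exact_mod_cast hM
  gcongr
  exact le_abs_self C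

theorem hasExponent_six : HasExponent 6 := by
  refine ⟨1, fun M _ => ?_⟩
  rw [one_mul, show (6 + 6 : ℝ) = (12 : ℕ) by norm_num, Real.rpow_natCast]
  exact_mod_cast solutionCount_Icc_le M

theorem exists_prime_of_pow_le {X B : ℕ} (hB : 0 < B) (hX : 10 ^ B ≤ X) :
    ∃ p : ℕ, p.Prime ∧ 5 ≤ p ∧ p ^ B ≤ X ∧ (p : ℝ)⁻¹ ≤ 2 * (X : ℝ) ^ (-(B : ℝ)⁻¹) := by
  have hB0 : (B : ℝ) ≠ 0 := by exact_mod_cast hB.ne'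
  have hX0 : (0 : ℝ) < X := by exact_mod_cast (pow_pos (by norm_num) B).trans_le hX
  set Y := (X : ℝ) ^ (B : ℝ)⁻¹ with hY
  have hYB : Y ^ B = X := Real.rpow_inv_natCast_pow hX0.le hB.ne'
  have hY0 : 0 ≤ Y := by positivity
  have hY10 : 10 ≤ Y := by
    refine le_of_pow_le_pow_left₀ hB.ne' hY0 ?_
    rw [hYB]
    exact_mod_cast hX
  have hm5 : 5 ≤ ⌊Y / 2⌋₊ := Nat.le_floor (by push_cast; linarith)
  obtain ⟨p, hp, hlt, hle⟩ := Nat.exists_prime_lt_and_le_two_mul ⌊Y / 2⌋₊ (by omega)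
  have h1 : (p : ℝ) ≤ Y := by
    have h2 : (⌊Y / 2⌋₊ : ℝ) ≤ Y / 2 := Nat.floor_le (by positivity)
    have h3 : (p : ℝ) ≤ 2 * ⌊Y / 2⌋₊ := by exact_mod_cast hle
    linarith
  have h4 : Y / 2 ≤ p := ((Nat.floor_lt (by positivity)).1 hlt).le
  refine ⟨p, hp, by omega, ?_, ?_⟩
  · have : (p : ℝ) ^ B ≤ Y ^ B := by gcongr
    rw [hYB] at this
    exact_mod_cast this
  · rw [Real.rpow_neg hX0.le, ← hY]
    refine (inv_anti₀ (by positivity) h4).trans_eq ?_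
    field_simp

theorem HasExponent.sub {d : ℝ} (hd : 0 ≤ d) {n : ℕ} (hn : 27 ≤ n * d) (h : HasExponent d) :
    HasExponent (d - ((3 ^ n : ℕ) : ℝ)⁻¹) := by
  obtain ⟨C, hC⟩ := h
  have hC0 : 0 ≤ C := by
    have := hC 1 le_rfl
    rw [Nat.cast_one, Real.one_rpow, mul_one] at this
    exact (Nat.cast_nonneg _).trans this
  set B := 3 ^ n with hB
  have hBpos : 0 < B := by positivity
  set K := (2 * 3 ^ n : ℝ) ^ 2 * (C * 2 ^ (6 + d)) with hK
  have hK0 : 0 ≤ K := by positivity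
  refine ⟨2 ^ 14 * K + 10 * C, fun X hX => ?_⟩
  have hX0 : (0 : ℝ) < X := by exact_mod_cast hX
  have hsplit : (X : ℝ) ^ (6 + (d - (B : ℝ)⁻¹)) =
      (X : ℝ) ^ (6 + d) * (X : ℝ) ^ (-(B : ℝ)⁻¹) := by
    rw [← Real.rpow_add hX0]
    ring_nf
  rw [hsplit, add_mul]
  rcases le_or_gt (10 ^ B) X with hlarge | hsmall
  · obtain ⟨p, hp, h5, hpX, hinv⟩ := exists_prime_of_pow_le hBpos hlarge
    refine ((solutionCount_le_div_prime hC0 hd hC hn hp h5 hpX).trans ?_).trans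
      (le_add_of_nonneg_right (by positivity))
    calc 2 ^ 13 * K * (X : ℝ) ^ (6 + d) * (p : ℝ)⁻¹
        ≤ 2 ^ 13 * K * (X : ℝ) ^ (6 + d) * (2 * (X : ℝ) ^ (-(B : ℝ)⁻¹)) := by gcongr
      _ = _ := by ring
  · refine (hC X hX).trans (le_add_of_nonneg_of_le (by positivity) ?_)
    have h1 : 1 ≤ 10 * (X : ℝ) ^ (-(B : ℝ)⁻¹) := by
      have h2 : (X : ℝ) ^ (B : ℝ)⁻¹ ≤ 10 := by
        refine le_of_pow_le_pow_left₀ hBpos.ne' (by norm_num) ?_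
        rw [Real.rpow_inv_natCast_pow hX0.le hBpos.ne']
        exact_mod_cast hsmall.le
      rw [Real.rpow_neg hX0.le, ← div_eq_mul_inv, one_le_div (by positivity)]
      exact h2
    calc C * (X : ℝ) ^ (6 + d) ≤ C * (X : ℝ) ^ (6 + d) * (10 * (X : ℝ) ^ (-(B : ℝ)⁻¹)) :=
          le_mul_of_one_le_right (by positivity) h1
      _ = _ := by ring

theorem hasExponent_of_pos {ε : ℝ} (hε : 0 < ε) : HasExponent ε := by
  obtain ⟨n, hn⟩ := exists_nat_ge (27 / ε)
  rw [div_le_iff₀ hε] at hn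
  set δ := ((3 ^ n : ℕ) : ℝ)⁻¹ with hδ
  have hδ0 : 0 < δ := by positivity
  have hmain : ∀ k : ℕ, HasExponent (max ε (6 - k * δ)) := by
    intro k
    induction k with
    | zero => exact hasExponent_six.mono (by simp)
    | succ k ih =>
      rcases le_total (6 - k * δ) ε with hle | hle
      · rw [max_eq_left hle] at ih
        exact ih.mono (le_max_left _ _)
      · rw [max_eq_right hle] at ih
        refine (ih.sub (n := n) (hε.le.trans hle) (hn.trans (by gcongr))).mono ?_
        refine le_trans (le_of_eq ?_) (le_max_right _ _)
        rw [Nat.cast_succ]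
        ring
  obtain ⟨k, hk⟩ := exists_nat_ge (6 / δ)
  rw [div_le_iff₀ hδ0] at hk
  have := hmain k
  rwa [max_eq_left (by linarith)] at this

end VinogradovCubic

/-- The cubic case of the main conjecture in Vinogradov's mean value theorem at the
critical number of variables `s = 6`: for every `ε > 0` there is `C(ε)` with
`J_{6,3}(X) ≤ C(ε) · X^(6+ε)` for all real `X ≥ 1`. -/
theorem vinogradov_cubic_critical :
    ∀ ε : ℝ, 0 < ε → ∃ C : ℝ, ∀ X : ℝ, 1 ≤ X →
      (Jcount 6 3 X : ℝ) ≤ C * X ^ (6 + ε) := by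
  intro ε hε
  obtain ⟨C, hC⟩ := VinogradovCubic.hasExponent_of_pos hε
  refine ⟨|C|, fun X hX => ?_⟩
  rw [VinogradovCubic.Jcount_eq_solutionCount (zero_le_one.trans hX)]
  refine (hC _ (Nat.le_floor (by simpa using hX))).trans ?_
  gcongr
  · exact le_abs_self C
  · exact Nat.floor_le (zero_le_one.trans hX)
end

section
/- For every positive integer s and every ε > 0 there is a constant C(s,ε) such that J_{s,3}(X) ≤ C(s,ε) · X^{ε}(X^{s} + X^{2s−6}) for all real X ≥ 1. (The main conjecture for k = 3 in all numbers of variables, deduced from the critical case s = 6 via the trivial inequalities J_{s+t,k}(X) ≤ X^{2t} J_{s,k}(X) and J_{s,k}(X) ≤ J_{s+t,k}(X)^{s/(s+t)}.) -/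
section

open Finset ComplexConjugate

/-- Two integer families have equal power sums of every degree at most three. -/
def EqualPowerSums {ι : Type*} [Fintype ι] (u w : ι → ℤ) : Prop :=
  ∀ j ≤ 3, ∑ i, u i ^ j = ∑ i, w i ^ j

theorem EqualPowerSums.add_const {ι : Type*} [Fintype ι] {u w : ι → ℤ}
    (h : EqualPowerSums u w) (c : ℤ) :
    EqualPowerSums (fun i => u i + c) (fun i => w i + c) := by
  intro j hj
  simp only [add_pow]
  rw [Finset.sum_comm, Finset.sum_comm (s := univ) (t := range (j + 1))]
  refine Finset.sum_congr rfl fun m hm => ?_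
  simp only [← Finset.sum_mul]
  rw [h m (by have := Finset.mem_range.mp hm; omega)]

theorem EqualPowerSums.of_mul {ι : Type*} [Fintype ι] {u w : ι → ℤ} {q : ℤ} (hq : q ≠ 0)
    (h : EqualPowerSums (fun i => q * u i) (fun i => q * w i)) : EqualPowerSums u w := by
  intro j hj
  have := h j hj
  simp only [mul_pow, ← Finset.mul_sum] at this
  exact mul_left_cancel₀ (pow_ne_zero j hq) this

/-- The moment curve modulo `M`. -/
def momentCurve (M : ℕ) (x : ℤ) : ZMod M × ZMod M × ZMod M :=
  ((x : ZMod M), (x : ZMod M) ^ 2, (x : ZMod M) ^ 3)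

theorem EqualPowerSums.sum_momentCurve_eq {ι : Type*} [Fintype ι] {u w : ι → ℤ} (M : ℕ)
    (h : EqualPowerSums u w) : ∑ i, momentCurve M (u i) = ∑ i, momentCurve M (w i) := by
  have key (j : ℕ) (hj : j ≤ 3) : ∑ i, (u i : ZMod M) ^ j = ∑ i, (w i : ZMod M) ^ j := by
    exact_mod_cast congrArg (Int.cast : ℤ → ZMod M) (h j hj)
  refine Prod.ext ?_ (Prod.ext ?_ ?_)
  · simpa [momentCurve, Prod.fst_sum, Prod.snd_sum] using key 1 (by norm_num)
  · simpa [momentCurve, Prod.fst_sum, Prod.snd_sum] using key 2 (by norm_num)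
  · simpa [momentCurve, Prod.fst_sum, Prod.snd_sum] using key 3 (by norm_num)

theorem equalPowerSums_of_sum_momentCurve_eq {ι : Type*} [Fintype ι] {u w : ι → ℤ} {M N : ℕ}
    (hM : Fintype.card ι * N ^ 3 < M) (hu : ∀ i, u i ∈ Icc (1 : ℤ) N)
    (hw : ∀ i, w i ∈ Icc (1 : ℤ) N)
    (h : ∑ i, momentCurve M (u i) = ∑ i, momentCurve M (w i)) : EqualPowerSums u w := by
  have bound (x : ι → ℤ) (hx : ∀ i, x i ∈ Icc (1 : ℤ) N) (j : ℕ) (hj : j ≤ 3) :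
      0 ≤ ∑ i, x i ^ j ∧ ∑ i, x i ^ j < M := by
    have h1 (i : ι) : 1 ≤ x i ∧ x i ≤ N := Finset.mem_Icc.mp (hx i)
    refine ⟨Finset.sum_nonneg fun i _ => pow_nonneg (by linarith [h1 i]) j, ?_⟩
    have h2 : ∑ i, x i ^ j ≤ ∑ _i : ι, (N : ℤ) ^ 3 := by
      refine Finset.sum_le_sum fun i _ => ?_
      calc x i ^ j ≤ x i ^ 3 := pow_le_pow_right₀ (h1 i).1 hj
        _ ≤ (N : ℤ) ^ 3 := pow_le_pow_left₀ (by linarith [h1 i]) (h1 i).2 3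
    rw [Finset.sum_const, Finset.card_univ, nsmul_eq_mul] at h2
    exact h2.trans_lt (by exact_mod_cast hM)
  have key (j : ℕ) (hj : j ≤ 3) (e : ∑ i, (u i : ZMod M) ^ j = ∑ i, (w i : ZMod M) ^ j) :
      ∑ i, u i ^ j = ∑ i, w i ^ j := by
    have e' : ((∑ i, u i ^ j : ℤ) : ZMod M) = ((∑ i, w i ^ j : ℤ) : ZMod M) := by
      push_cast; exact e
    have e2 := (ZMod.intCast_eq_intCast_iff _ _ _).mp e'
    have hu' := bound u hu j hj
    have hw' := bound w hw j hj
    rwa [Int.ModEq, Int.emod_eq_of_lt hu'.1 hu'.2, Int.emod_eq_of_lt hw'.1 hw'.2] at e2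
  have e1 := congrArg Prod.fst h
  have e2 := congrArg (fun z => z.2.1) h
  have e3 := congrArg (fun z => z.2.2) h
  simp only [momentCurve, Prod.fst_sum, Prod.snd_sum] at e1 e2 e3
  intro j hj
  refine key j hj ?_
  interval_cases j
  · simp
  · simpa using e1
  · exact e2
  · exact e3

/-- The cubic exponential sum over `A` at a character of `(ℤ/M)³`. -/
noncomputable def expSum (M : ℕ) (A : Finset ℤ)
    (ψ : AddChar (ZMod M × ZMod M × ZMod M) ℂ) : ℂ :=
  ∑ x ∈ A, ψ (momentCurve M x)

/-- The mixed moment of the exponential sums over `A` and `B`. -/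
noncomputable def mixedMoment (M : ℕ) [NeZero M] (m l : ℕ) (A B : Finset ℤ) : ℝ :=
  (Fintype.card (ZMod M × ZMod M × ZMod M) : ℝ)⁻¹ *
    ∑ ψ : AddChar (ZMod M × ZMod M × ZMod M) ℂ, ‖expSum M A ψ‖ ^ (2 * m) * ‖expSum M B ψ‖ ^ (2 * l)

theorem mixedMoment_nonneg (M : ℕ) [NeZero M] (m l : ℕ) (A B : Finset ℤ) :
    0 ≤ mixedMoment M m l A B := by
  unfold mixedMoment; positivity

theorem prod_expSum {ι : Type*} [Fintype ι] [DecidableEq ι] (M : ℕ) (A : ι → Finset ℤ)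
    (ψ : AddChar (ZMod M × ZMod M × ZMod M) ℂ) :
    ∏ i, expSum M (A i) ψ = ∑ x ∈ Fintype.piFinset A, ψ (∑ i, momentCurve M (x i)) := by
  simp only [expSum, Finset.prod_univ_sum]
  refine Finset.sum_congr rfl fun x _ => ?_
  exact (map_prod ψ.toMonoidHom (fun i => Multiplicative.ofAdd (momentCurve M (x i))) univ).symm

theorem sum_prod_expSum_mul_conj {ι : Type*} [Fintype ι] [DecidableEq ι] (M : ℕ) [NeZero M]
    (A A' : ι → Finset ℤ) :
    ∑ ψ : AddChar (ZMod M × ZMod M × ZMod M) ℂ,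
      (∏ i, expSum M (A i) ψ) * conj (∏ i, expSum M (A' i) ψ) =
    (Fintype.card (ZMod M × ZMod M × ZMod M) : ℂ) *
      (#{xy ∈ Fintype.piFinset A ×ˢ Fintype.piFinset A' |
        ∑ i, momentCurve M (xy.1 i) = ∑ i, momentCurve M (xy.2 i)} : ℂ) := by
  have h (ψ : AddChar (ZMod M × ZMod M × ZMod M) ℂ) :
      (∏ i, expSum M (A i) ψ) * conj (∏ i, expSum M (A' i) ψ) =
        ∑ xy ∈ Fintype.piFinset A ×ˢ Fintype.piFinset A',
          ψ (∑ i, momentCurve M (xy.1 i) - ∑ i, momentCurve M (xy.2 i)) := by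
    rw [prod_expSum, prod_expSum, map_sum, Finset.sum_mul_sum, Finset.sum_product]
    simp only [sub_eq_add_neg, AddChar.map_add_eq_mul, AddChar.map_neg_eq_conj]
  simp only [h]
  rw [Finset.sum_comm]
  simp only [AddChar.sum_apply_eq_ite, sub_eq_zero]
  rw [← Finset.sum_filter, Finset.sum_const, nsmul_eq_mul, mul_comm]

/-- The number of solutions in `A` of the cubic Vinogradov system with `s` variables per side. -/
noncomputable def solutionCount (s : ℕ) (A : Finset ℤ) : ℕ := by
  classical exact #{xy ∈ Fintype.piFinset (fun _ : Fin s => A) ×ˢ Fintype.piFinset fun _ : Fin s => A |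
    EqualPowerSums xy.1 xy.2}

theorem mixedMoment_zero_eq_solutionCount {M N s : ℕ} [NeZero M] {A : Finset ℤ} (B : Finset ℤ)
    (hA : A ⊆ Icc (1 : ℤ) N) (hM : s * N ^ 3 < M) :
    mixedMoment M s 0 A B = solutionCount s A := by
  classical
  have h := sum_prod_expSum_mul_conj M (fun _ : Fin s => A) (fun _ : Fin s => A)
  have e (ψ : AddChar (ZMod M × ZMod M × ZMod M) ℂ) :
      (∏ _i : Fin s, expSum M A ψ) * conj (∏ _i : Fin s, expSum M A ψ) =
        ((‖expSum M A ψ‖ ^ (2 * s) : ℝ) : ℂ) := by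
    rw [Complex.mul_conj, Finset.prod_const, Finset.card_univ, Fintype.card_fin, map_pow,
      Complex.normSq_eq_norm_sq, ← pow_mul]
  simp only [e] at h
  rw [← Complex.ofReal_sum] at h
  have h' : ∑ ψ : AddChar (ZMod M × ZMod M × ZMod M) ℂ, ‖expSum M A ψ‖ ^ (2 * s) =
      (Fintype.card (ZMod M × ZMod M × ZMod M) : ℝ) *
      (#{xy ∈ Fintype.piFinset (fun _ : Fin s => A) ×ˢ Fintype.piFinset (fun _ : Fin s => A) |
        ∑ i, momentCurve M (xy.1 i) = ∑ i, momentCurve M (xy.2 i)} : ℝ) := by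
    exact_mod_cast h
  have hc : (Fintype.card (ZMod M × ZMod M × ZMod M) : ℝ) ≠ 0 := by
    exact_mod_cast Fintype.card_ne_zero
  simp only [mixedMoment, mul_zero, pow_zero, mul_one]
  rw [h', inv_mul_cancel_left₀ hc, solutionCount]
  congr 2
  ext xy
  simp only [Finset.mem_filter, Finset.mem_product, Fintype.mem_piFinset]
  refine and_congr_right fun hxy => ⟨fun he => ?_, fun he => he.sum_momentCurve_eq M⟩
  exact equalPowerSums_of_sum_momentCurve_eq (by simpa using hM) (fun i => hA (hxy.1 i))
    (fun i => hA (hxy.2 i)) he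

theorem sq_prod_le_sum_pow {m : ℕ} (hm : 0 < m) (a : Fin m → ℝ) (ha : ∀ i, 0 ≤ a i) :
    (∏ i, a i) ^ 2 ≤ ∑ i, a i ^ (2 * m) := by
  have : Nonempty (Fin m) := ⟨⟨0, hm⟩⟩
  obtain ⟨i₀, -, hi₀⟩ := Finset.exists_max_image univ a Finset.univ_nonempty
  calc (∏ i, a i) ^ 2 ≤ (∏ _i : Fin m, a i₀) ^ 2 := by
        gcongr with i hi
        · exact Finset.prod_nonneg fun i _ => ha i
        · exact fun i _ => ha i
        · exact hi₀ i hi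
    _ = a i₀ ^ (2 * m) := by simp [← pow_mul, mul_comm]
    _ ≤ ∑ i, a i ^ (2 * m) :=
        Finset.single_le_sum (f := fun i => a i ^ (2 * m)) (fun i _ => pow_nonneg (ha i) _)
          (Finset.mem_univ i₀)

theorem mixedMoment_le_card_mul {M N m l : ℕ} [NeZero M] {κ : Type*} (hm : 0 < m)
    (hM : (m + l) * N ^ 3 < M) {K : Finset κ} {A B : Finset ℤ} {A' : κ → Finset ℤ}
    (hA : ∀ ψ, expSum M A ψ = ∑ k ∈ K, expSum M (A' k) ψ)
    (hA' : ∀ k ∈ K, A' k ⊆ Icc (1 : ℤ) N) (hB : B ⊆ Icc (1 : ℤ) N)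
    (S : Finset ((Fin m → κ) × (Fin m → κ)))
    (hSK : ∀ kk ∈ S, ∀ i, kk.1 i ∈ K ∧ kk.2 i ∈ K)
    (hS : ∀ (k k' : Fin m → κ) (x x' : Fin m → ℤ) (y y' : Fin l → ℤ),
      (∀ i, k i ∈ K) → (∀ i, k' i ∈ K) → (∀ i, x i ∈ A' (k i)) → (∀ i, x' i ∈ A' (k' i)) →
      (∀ i, y i ∈ B) → (∀ i, y' i ∈ B) →
      EqualPowerSums (Sum.elim x y) (Sum.elim x' y') → (k, k') ∈ S)
    {D : ℝ} (hD : ∀ k ∈ K, mixedMoment M m l (A' k) B ≤ D) :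
    mixedMoment M m l A B ≤ #S * (2 * m * D) := by
  classical
  set c : ℝ := (Fintype.card (ZMod M × ZMod M × ZMod M) : ℝ) with hc
  have hc0 : 0 < c := by
    rw [hc]; exact_mod_cast Fintype.card_pos
  have hD' (k : κ) (hk : k ∈ K) : ∑ ψ, ‖expSum M (A' k) ψ‖ ^ (2 * m) * ‖expSum M B ψ‖ ^ (2 * l)
      ≤ c * D := by
    have := hD k hk
    rwa [mixedMoment, inv_mul_le_iff₀ hc0] at this
  let T (kk : (Fin m → κ) × (Fin m → κ)) (ψ : AddChar (ZMod M × ZMod M × ZMod M) ℂ) : ℂ :=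
    ((∏ i, expSum M (A' (kk.1 i)) ψ) * expSum M B ψ ^ l) *
      conj ((∏ i, expSum M (A' (kk.2 i)) ψ) * expSum M B ψ ^ l)
  let Q := Fintype.piFinset (fun _ : Fin m => K) ×ˢ Fintype.piFinset fun _ : Fin m => K
  have hexp (ψ : AddChar (ZMod M × ZMod M × ZMod M) ℂ) :
      ((‖expSum M A ψ‖ ^ (2 * m) * ‖expSum M B ψ‖ ^ (2 * l) : ℝ) : ℂ) = ∑ kk ∈ Q, T kk ψ := by
    have h1 : ((‖expSum M A ψ‖ ^ (2 * m) * ‖expSum M B ψ‖ ^ (2 * l) : ℝ) : ℂ) =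
        (expSum M A ψ ^ m * expSum M B ψ ^ l) * conj (expSum M A ψ ^ m * expSum M B ψ ^ l) := by
      rw [Complex.mul_conj, map_mul, map_pow, map_pow, Complex.normSq_eq_norm_sq,
        Complex.normSq_eq_norm_sq, ← pow_mul, ← pow_mul]
    have h2 : expSum M A ψ ^ m = ∑ k ∈ Fintype.piFinset (fun _ : Fin m => K),
        ∏ i, expSum M (A' (k i)) ψ := by
      rw [← Finset.prod_univ_sum (fun _ => K) fun _ k => expSum M (A' k) ψ, ← hA,
        Finset.prod_const, Finset.card_univ, Fintype.card_fin]
    rw [h1, h2, Finset.sum_mul, map_sum, Finset.sum_mul_sum, Finset.sum_product]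
  have hvanish (kk : (Fin m → κ) × (Fin m → κ)) (hkk : kk ∈ Q) (hkS : kk ∉ S) :
      ∑ ψ, T kk ψ = 0 := by
    have hQ := Finset.mem_product.mp hkk
    simp only [Fintype.mem_piFinset] at hQ
    have h := sum_prod_expSum_mul_conj M
      (Sum.elim (fun i => A' (kk.1 i)) fun _ : Fin l => B)
      (Sum.elim (fun i => A' (kk.2 i)) fun _ : Fin l => B)
    simp only [Fintype.prod_sum_type, Sum.elim_inl, Sum.elim_inr, Finset.prod_const,
      Finset.card_univ, Fintype.card_fin] at h
    simp only [T, h]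
    rw [Finset.filter_eq_empty_iff.mpr, Finset.card_empty, Nat.cast_zero, mul_zero]
    rintro ⟨u, w⟩ huw he
    simp only [Finset.mem_product, Fintype.mem_piFinset] at huw
    have hin (v : Fin m ⊕ Fin l → ℤ) (k : Fin m → κ) (hk : ∀ i, k i ∈ K)
        (hv : ∀ i, v i ∈ Sum.elim (fun i => A' (k i)) (fun _ : Fin l => B) i) (i) :
        v i ∈ Icc (1 : ℤ) N := by
      rcases i with i | i
      · exact hA' _ (hk i) (hv (Sum.inl i))
      · exact hB (hv (Sum.inr i))
    have hP : EqualPowerSums u w :=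
      equalPowerSums_of_sum_momentCurve_eq (N := N) (by simpa using hM) (hin u _ hQ.1 huw.1)
        (hin w _ hQ.2 huw.2) (by simpa [Fintype.sum_sum_type] using he)
    refine hkS (hS kk.1 kk.2 (u ∘ Sum.inl) (w ∘ Sum.inl) (u ∘ Sum.inr) (w ∘ Sum.inr) hQ.1 hQ.2
      (fun i => huw.1 (Sum.inl i)) (fun i => huw.2 (Sum.inl i)) (fun i => huw.1 (Sum.inr i))
      (fun i => huw.2 (Sum.inr i)) ?_)
    simpa [Sum.elim_comp_inl_inr] using hP
  have hSQ : S ⊆ Q := fun kk hkk => by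
    simp only [Q, Finset.mem_product, Fintype.mem_piFinset]
    exact ⟨fun i => (hSK kk hkk i).1, fun i => (hSK kk hkk i).2⟩
  have hT (kk : (Fin m → κ) × (Fin m → κ)) (ψ : AddChar (ZMod M × ZMod M × ZMod M) ℂ) :
      ‖T kk ψ‖ ≤ ∑ i, (‖expSum M (A' (kk.1 i)) ψ‖ ^ (2 * m) * ‖expSum M B ψ‖ ^ (2 * l) +
        ‖expSum M (A' (kk.2 i)) ψ‖ ^ (2 * m) * ‖expSum M B ψ‖ ^ (2 * l)) := by
    have h1 := sq_prod_le_sum_pow hm (fun i => ‖expSum M (A' (kk.1 i)) ψ‖)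
      fun i => norm_nonneg _
    have h2 := sq_prod_le_sum_pow hm (fun i => ‖expSum M (A' (kk.2 i)) ψ‖)
      fun i => norm_nonneg _
    have h3 : ‖T kk ψ‖ = (∏ i, ‖expSum M (A' (kk.1 i)) ψ‖) * (∏ i, ‖expSum M (A' (kk.2 i)) ψ‖) *
        ‖expSum M B ψ‖ ^ (2 * l) := by
      simp only [T, norm_mul, RCLike.norm_conj, norm_prod, norm_pow]
      ring
    rw [h3, Finset.sum_add_distrib, ← Finset.sum_mul, ← Finset.sum_mul, ← add_mul]
    refine mul_le_mul_of_nonneg_right ?_ (by positivity)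
    nlinarith [sq_nonneg ((∏ i, ‖expSum M (A' (kk.1 i)) ψ‖) - ∏ i, ‖expSum M (A' (kk.2 i)) ψ‖),
      sq_nonneg (∏ i, ‖expSum M (A' (kk.1 i)) ψ‖), sq_nonneg (∏ i, ‖expSum M (A' (kk.2 i)) ψ‖)]
  have hsum : ((∑ ψ, ‖expSum M A ψ‖ ^ (2 * m) * ‖expSum M B ψ‖ ^ (2 * l) : ℝ) : ℂ) =
      ∑ kk ∈ S, ∑ ψ, T kk ψ := by
    rw [Complex.ofReal_sum, Finset.sum_congr rfl fun ψ _ => hexp ψ, Finset.sum_comm]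
    exact (Finset.sum_subset hSQ hvanish).symm
  have hfin : ∑ ψ, ‖expSum M A ψ‖ ^ (2 * m) * ‖expSum M B ψ‖ ^ (2 * l) ≤
      #S * (2 * m * (c * D)) := by
    calc _ ≤ ‖((∑ ψ, ‖expSum M A ψ‖ ^ (2 * m) * ‖expSum M B ψ‖ ^ (2 * l) : ℝ) : ℂ)‖ := by
          rw [Complex.norm_real]; exact le_abs_self _
      _ ≤ ∑ kk ∈ S, ∑ ψ, ‖T kk ψ‖ := by
          rw [hsum]
          exact (norm_sum_le _ _).trans (Finset.sum_le_sum fun kk _ => norm_sum_le _ _)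
      _ ≤ ∑ kk ∈ S, 2 * m * (c * D) := by
          refine Finset.sum_le_sum fun kk hkk => ?_
          refine (Finset.sum_le_sum fun ψ _ => hT kk ψ).trans ?_
          rw [Finset.sum_comm]
          calc _ ≤ ∑ _i : Fin m, (c * D + c * D) := by
                refine Finset.sum_le_sum fun i _ => ?_
                rw [Finset.sum_add_distrib]
                exact add_le_add (hD' _ (hSK kk hkk i).1) (hD' _ (hSK kk hkk i).2)
            _ = 2 * m * (c * D) := by
                rw [Finset.sum_const, Finset.card_univ, Fintype.card_fin, nsmul_eq_mul]; ring
      _ = #S * (2 * m * (c * D)) := by rw [Finset.sum_const, nsmul_eq_mul]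
  rw [mixedMoment, inv_mul_le_iff₀ hc0]
  linarith

/-- The integers in `[1, N]` congruent to `ξ` modulo `q`. -/
noncomputable def residueClass (N q : ℕ) (ξ : ℤ) : Finset ℤ := {x ∈ Icc (1 : ℤ) N | (q : ℤ) ∣ x - ξ}

theorem mem_residueClass {N q : ℕ} {ξ x : ℤ} :
    x ∈ residueClass N q ξ ↔ x ∈ Icc (1 : ℤ) N ∧ (q : ℤ) ∣ x - ξ := Finset.mem_filter

theorem residueClass_subset (N q : ℕ) (ξ : ℤ) : residueClass N q ξ ⊆ Icc (1 : ℤ) N :=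
  Finset.filter_subset _ _

theorem residueClass_one (N : ℕ) : residueClass N 1 0 = Icc (1 : ℤ) N := by
  simp [residueClass]

theorem expSum_residueClass_eq_sum (M N : ℕ) {q r : ℕ} (hq : 0 < q) (hr : 0 < r) (ξ : ℤ)
    (ψ : AddChar (ZMod M × ZMod M × ZMod M) ℂ) :
    expSum M (residueClass N q ξ) ψ =
      ∑ k ∈ range r, expSum M (residueClass N (q * r) (ξ + q * k)) ψ := by
  have hq' : (0 : ℤ) < q := by exact_mod_cast hq
  have hr' : (0 : ℤ) < r := by exact_mod_cast hr
  simp only [expSum]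
  rw [← Finset.sum_fiberwise_of_maps_to (s := residueClass N q ξ) (t := range r)
    (g := fun x => ((x - ξ) / q % r).toNat)]
  · refine Finset.sum_congr rfl fun k hk => Finset.sum_congr ?_ fun _ _ => rfl
    have hk' : (k : ℤ) < r := by exact_mod_cast Finset.mem_range.mp hk
    ext x
    simp only [Finset.mem_filter, mem_residueClass, and_assoc]
    refine and_congr_right fun _ => ⟨?_, ?_⟩
    · rintro ⟨⟨t, ht⟩, hx⟩
      have hx' : t % r = k := by
        rw [ht, Int.mul_ediv_cancel_left _ hq'.ne'] at hx
        have := Int.emod_nonneg t hr'.ne'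
        omega
      refine ⟨t / r, ?_⟩
      have := Int.emod_add_mul_ediv t r
      push_cast
      linear_combination ht + q * hx' - q * this
    · rintro ⟨t, ht⟩
      push_cast at ht
      have e : x - ξ = q * (k + r * t) := by linear_combination ht
      refine ⟨⟨_, e⟩, ?_⟩
      rw [e, Int.mul_ediv_cancel_left _ hq'.ne', Int.add_mul_emod_self_left,
        Int.emod_eq_of_lt (by positivity) hk', Int.toNat_natCast]
  · intro x _
    have h1 := Int.emod_nonneg ((x - ξ) / q) hr'.ne'
    have h2 := Int.emod_lt_of_pos ((x - ξ) / q) hr'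
    rw [Finset.mem_range]
    omega

theorem solutionCount_residueClass_le (s N : ℕ) {q : ℕ} (hq : 0 < q) (η : ℤ) :
    solutionCount s (residueClass N q η) ≤ solutionCount s (Icc (1 : ℤ) (N / q + 1 : ℕ)) := by
  classical
  have hq' : (0 : ℤ) < q := by exact_mod_cast hq
  set c : ℤ := (η - 1) % q + 1 with hc
  have hc1 : 1 ≤ c := by have := Int.emod_nonneg (η - 1) hq'.ne'; omega
  have hc2 : c ≤ q := by have := Int.emod_lt_of_pos (η - 1) hq'; omega
  have hcη : (q : ℤ) ∣ η - c :=
    ⟨(η - 1) / q, by have := Int.emod_add_mul_ediv (η - 1) q; linear_combination -this - hc⟩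
  let g (x : ℤ) : ℤ := (x - c) / q + 1
  have hg (x : ℤ) (hx : x ∈ residueClass N q η) : x = q * g x + (c - q) := by
    obtain ⟨t, ht⟩ : (q : ℤ) ∣ x - c := by
      simpa using dvd_add (mem_residueClass.mp hx).2 hcη
    simp only [g, ht, Int.mul_ediv_cancel_left _ hq'.ne']
    linear_combination ht
  have hgI (x : ℤ) (hx : x ∈ residueClass N q η) : g x ∈ Icc (1 : ℤ) (N / q + 1 : ℕ) := by
    have h := hg x hx
    have hx' := Finset.mem_Icc.mp (mem_residueClass.mp hx).1
    rw [Finset.mem_Icc]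
    constructor
    · by_contra! hlt
      nlinarith
    · push_cast
      have : g x - 1 ≤ N / q := (Int.le_ediv_iff_mul_le hq').mpr (by nlinarith)
      linarith
  unfold solutionCount
  refine Finset.card_le_card_of_injOn
    (fun xy => (fun i => g (xy.1 i), fun i => g (xy.2 i))) ?_ ?_
  · rintro ⟨x, y⟩ hxy
    simp only [Finset.coe_filter, Finset.mem_product, Fintype.mem_piFinset, Set.mem_ofPred_eq]
      at hxy ⊢
    obtain ⟨⟨hx, hy⟩, hP⟩ := hxy
    refine ⟨⟨fun i => hgI _ (hx i), fun i => hgI _ (hy i)⟩, ?_⟩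
    refine EqualPowerSums.of_mul hq'.ne' ?_
    have := hP.add_const (-(c - q))
    have e (z : ℤ) (hz : z ∈ residueClass N q η) : z + -(c - q) = q * g z := by
      linear_combination hg z hz
    simpa only [e _ (hx _), e _ (hy _)] using this
  · rintro ⟨x, y⟩ hxy ⟨x', y'⟩ hxy' h
    simp only [Finset.coe_filter, Finset.mem_product, Fintype.mem_piFinset, Set.mem_ofPred_eq]
      at hxy hxy'
    simp only [Prod.mk.injEq] at h ⊢
    refine ⟨funext fun i => ?_, funext fun i => ?_⟩
    · rw [hg _ (hxy.1.1 i), hg _ (hxy'.1.1 i), congrFun h.1 i]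
    · rw [hg _ (hxy.1.2 i), hg _ (hxy'.1.2 i), congrFun h.2 i]

theorem EqualPowerSums.pow_dvd_sum_sub {m l : ℕ} {x x' : Fin m → ℤ} {y y' : Fin l → ℤ}
    {q η : ℤ} (h : EqualPowerSums (Sum.elim x y) (Sum.elim x' y'))
    (hy : ∀ i, q ∣ y i - η) (hy' : ∀ i, q ∣ y' i - η) {j : ℕ} (hj : j ≤ 3) :
    q ^ j ∣ ∑ i, (x i - η) ^ j - ∑ i, (x' i - η) ^ j := by
  have h1 := h.add_const (-η) j hj
  simp only [Fintype.sum_sum_type, Sum.elim_inl, Sum.elim_inr, ← sub_eq_add_neg] at h1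
  have h2 : ∑ i, (x i - η) ^ j - ∑ i, (x' i - η) ^ j =
      ∑ i, (y' i - η) ^ j - ∑ i, (y i - η) ^ j := by linear_combination h1
  rw [h2]
  exact dvd_sub (Finset.dvd_sum fun i _ => pow_dvd_pow_of_dvd (hy' i) j)
    (Finset.dvd_sum fun i _ => pow_dvd_pow_of_dvd (hy i) j)

theorem Nat.eq_of_lt_of_intCast_dvd_sub {r k k' : ℕ} (hk : k < r) (hk' : k' < r)
    (h : (r : ℤ) ∣ (k : ℤ) - k') : k = k' := by
  obtain ⟨t, ht⟩ := h
  have hr : (0 : ℤ) < r := by omega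
  have h1 : t < 1 := by by_contra! h1; nlinarith
  have h2 : -1 < t := by by_contra! h2; nlinarith
  obtain rfl : t = 0 := by omega
  omega

theorem Int.pow_dvd_of_dvd_mul_of_not_dvd {p n : ℕ} (hp : p.Prime) {x y : ℤ}
    (hx : ¬ (p : ℤ) ∣ x) (h : (p : ℤ) ^ n ∣ x * y) : (p : ℤ) ^ n ∣ y := by
  have hc : IsCoprime ((p : ℤ) ^ n) x :=
    ((Nat.prime_iff_prime_int.mp hp).coprime_iff_not_dvd.mpr hx).pow_left
  exact hc.dvd_of_dvd_mul_left h

theorem Int.Prime.not_dvd_intCast_of_lt {p n : ℕ} (hn : 0 < n) (h : n < p) : ¬ (p : ℤ) ∣ n := by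
  rw [Int.natCast_dvd_natCast]
  exact Nat.not_dvd_of_pos_of_lt hn h

theorem pow_dvd_sub_of_cubes {p b : ℕ} (hp : p.Prime) (hp5 : 5 ≤ p) {z z' ν : ℤ}
    (hz : (p : ℤ) ∣ z - ν) (hz' : (p : ℤ) ∣ z' - ν) (hν : ¬ (p : ℤ) ∣ ν)
    (h : (p : ℤ) ^ b ∣ z ^ 3 - z' ^ 3) : (p : ℤ) ^ b ∣ z - z' := by
  have hp' := Nat.prime_iff_prime_int.mp hp
  refine Int.pow_dvd_of_dvd_mul_of_not_dvd hp (x := z ^ 2 + z * z' + z' ^ 2) (fun hd => ?_)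
    (by convert h using 1; ring)
  have h3 : (p : ℤ) ∣ (3 : ℕ) * ν ^ 2 := by
    obtain ⟨s, hs⟩ := hz
    obtain ⟨t, ht⟩ := hz'
    have e1 : z = ν + p * s := by linear_combination hs
    have e2 : z' = ν + p * t := by linear_combination ht
    obtain ⟨w, hw⟩ := hd
    rw [e1, e2] at hw
    exact ⟨w - (3 * ν * s + 3 * ν * t + p * s ^ 2 + p * s * t + p * t ^ 2), by
      push_cast; linear_combination hw⟩
  rcases hp'.dvd_or_dvd h3 with h | h
  · exact Int.Prime.not_dvd_intCast_of_lt (by norm_num) (by omega) h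
  · exact hν (hp'.dvd_of_dvd_pow h)

theorem mixedMoment_one_five_le {M N p a b : ℕ} [NeZero M] (hM : 6 * N ^ 3 < M) (hp : p.Prime)
    (hp5 : 5 ≤ p) (ha : 1 ≤ a) (hab : a ≤ 3 * b) {ξ η : ℤ} (hξη : ¬ (p : ℤ) ∣ ξ - η) {D : ℝ}
    (hD : ∀ ξ' : ℤ, ¬ (p : ℤ) ∣ ξ' - η →
      mixedMoment M 1 5 (residueClass N (p ^ (3 * b)) ξ') (residueClass N (p ^ b) η) ≤ D) :
    mixedMoment M 1 5 (residueClass N (p ^ a) ξ) (residueClass N (p ^ b) η) ≤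
      p ^ (3 * b - a) * (2 * D) := by
  classical
  have hpa : (p : ℤ) ∣ (p ^ a : ℕ) := by
    push_cast; exact dvd_pow_self _ (by omega)
  have hpow : p ^ a * p ^ (3 * b - a) = p ^ (3 * b) := by rw [← pow_add]; congr 1; omega
  have hξ' (k : ℕ) : ¬ (p : ℤ) ∣ (ξ + (p ^ a : ℕ) * k) - η := fun h => hξη (by
    simpa [add_sub_right_comm] using dvd_sub h (hpa.mul_right k))
  have hD0 : 0 ≤ D := (mixedMoment_nonneg _ _ _ _ _).trans (hD ξ hξη)
  let S : Finset ((Fin 1 → ℕ) × (Fin 1 → ℕ)) :=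
    (range (p ^ (3 * b - a))).image fun k => (fun _ => k, fun _ => k)
  have h := mixedMoment_le_card_mul (M := M) (N := N) (m := 1) (l := 5) one_pos (by simpa using hM)
    (K := range (p ^ (3 * b - a))) (A := residueClass N (p ^ a) ξ)
    (B := residueClass N (p ^ b) η)
    (A' := fun k => residueClass N (p ^ (3 * b)) (ξ + (p ^ a : ℕ) * k)) ?_
    (fun k _ => residueClass_subset _ _ _) (residueClass_subset _ _ _) S ?_ ?_
    (fun k _ => hD _ (hξ' k))
  · refine h.trans ?_
    have hS : (#S : ℝ) ≤ p ^ (3 * b - a) := by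
      have : #S ≤ p ^ (3 * b - a) := Finset.card_image_le.trans_eq (Finset.card_range _)
      exact_mod_cast this
    rw [Nat.cast_one, mul_one]
    exact mul_le_mul_of_nonneg_right hS (by positivity)
  · intro ψ
    rw [expSum_residueClass_eq_sum M N (pow_pos hp.pos a) (pow_pos hp.pos (3 * b - a)), hpow]
  · intro kk hkk i
    obtain ⟨k, hk, rfl⟩ := Finset.mem_image.mp hkk
    exact ⟨hk, hk⟩
  · intro k k' x x' y y' hk hk' hx hx' hy hy' hP
    have h3 := hP.pow_dvd_sum_sub (fun i => (mem_residueClass.mp (hy i)).2)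
      (fun i => (mem_residueClass.mp (hy' i)).2) (j := 3) le_rfl
    simp only [Fin.sum_univ_one, Nat.cast_pow, ← pow_mul, mul_comm b 3] at h3
    have hx1 := (mem_residueClass.mp (hx 0)).2
    have hx1' := (mem_residueClass.mp (hx' 0)).2
    have hclass (t : ℕ) (z : ℤ) (hz : ((p ^ (3 * b) : ℕ) : ℤ) ∣ z - (ξ + (p ^ a : ℕ) * t)) :
        (p : ℤ) ∣ z - η - (ξ - η) := by
      have h1 : (p : ℤ) ∣ z - (ξ + (p ^ a : ℕ) * t) :=
        (show (p : ℤ) ∣ ((p ^ (3 * b) : ℕ) : ℤ) by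
          push_cast; exact dvd_pow_self _ (by omega)).trans hz
      rw [show z - η - (ξ - η) = z - (ξ + (p ^ a : ℕ) * t) + (p ^ a : ℕ) * t by ring]
      exact dvd_add h1 (hpa.mul_right (t : ℤ))
    have hd := pow_dvd_sub_of_cubes hp hp5 (hclass _ _ hx1) (hclass _ _ hx1') hξη h3
    have hd' : ((p ^ a : ℕ) : ℤ) * ((p ^ (3 * b - a) : ℕ) : ℤ) ∣
        ((p ^ a : ℕ) : ℤ) * ((k 0 : ℤ) - k' 0) := by
      rw [← Nat.cast_mul, hpow]
      rw [← Nat.cast_pow] at hd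
      rw [show ((p ^ a : ℕ) : ℤ) * ((k 0 : ℤ) - k' 0) = x 0 - η - (x' 0 - η) -
        (x 0 - (ξ + (p ^ a : ℕ) * k 0)) + (x' 0 - (ξ + (p ^ a : ℕ) * k' 0)) by ring]
      exact dvd_add (dvd_sub hd hx1) hx1'
    have hkk : k 0 = k' 0 := Nat.eq_of_lt_of_intCast_dvd_sub (Finset.mem_range.mp (hk 0))
      (Finset.mem_range.mp (hk' 0))
      ((mul_dvd_mul_iff_left (by exact_mod_cast (pow_pos hp.pos a).ne')).mp hd')
    refine Finset.mem_image.mpr ⟨k 0, hk 0, Prod.ext ?_ ?_⟩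
    · funext i; rw [Fin.fin_one_eq_zero i]
    · funext i; rw [Fin.fin_one_eq_zero i]; exact hkk

theorem pow_dvd_sum_sq_sub_of_pow_dvd {p n : ℕ} (hp : p.Prime) (hp5 : 5 ≤ p) {q ν u₀ u₁ v₀ v₁ : ℤ}
    (hq : (p : ℤ) ∣ q) (hν : ¬ (p : ℤ) ∣ ν)
    (h₁ : (p : ℤ) ^ n ∣ 2 * ν * (u₀ + u₁ - v₀ - v₁) + q * (u₀ ^ 2 + u₁ ^ 2 - v₀ ^ 2 - v₁ ^ 2))
    (h₂ : (p : ℤ) ^ n ∣ 3 * ν * (u₀ ^ 2 + u₁ ^ 2 - v₀ ^ 2 - v₁ ^ 2) +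
      2 * q * (u₀ ^ 3 + u₁ ^ 3 - v₀ ^ 3 - v₁ ^ 3)) :
    (p : ℤ) ^ n ∣ u₀ + u₁ - v₀ - v₁ ∧ (p : ℤ) ^ n ∣ u₀ ^ 2 + u₁ ^ 2 - v₀ ^ 2 - v₁ ^ 2 := by
  have hp' := Nat.prime_iff_prime_int.mp hp
  have h2 : ¬ (p : ℤ) ∣ 2 := Int.Prime.not_dvd_intCast_of_lt (n := 2) (by norm_num) (by omega)
  have h3 : ¬ (p : ℤ) ∣ 3 := Int.Prime.not_dvd_intCast_of_lt (n := 3) (by norm_num) (by omega)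
  set S₁ := u₀ + u₁ - v₀ - v₁ with hS₁
  set S₂ := u₀ ^ 2 + u₁ ^ 2 - v₀ ^ 2 - v₁ ^ 2 with hS₂
  set W := 3 * (v₀ ^ 2 + v₁ ^ 2) - (u₀ + u₁) ^ 2 - (u₀ + u₁) * (v₀ + v₁) - (v₀ + v₁) ^ 2 with hW
  have hdet : ¬ (p : ℤ) ∣ 2 * ν * (3 * ν + 3 * q * (u₀ + u₁)) - q ^ 2 * W := by
    intro h
    have h6 : (p : ℤ) ∣ 2 * (3 * (ν * ν)) := by
      rw [show 2 * (3 * (ν * ν)) = 2 * ν * (3 * ν + 3 * q * (u₀ + u₁)) - q ^ 2 * W -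
        q * (6 * ν * (u₀ + u₁) - q * W) by ring]
      exact dvd_sub h (hq.mul_right _)
    rcases hp'.dvd_or_dvd h6 with h | h
    · exact h2 h
    rcases hp'.dvd_or_dvd h with h | h
    · exact h3 h
    rcases hp'.dvd_or_dvd h with h | h <;> exact hν h
  have hS₂d : (p : ℤ) ^ n ∣ S₂ := by
    refine Int.pow_dvd_of_dvd_mul_of_not_dvd hp hdet ?_
    have := dvd_sub (h₂.mul_left (2 * ν)) (h₁.mul_left (q * W))
    rw [show (2 * ν * (3 * ν + 3 * q * (u₀ + u₁)) - q ^ 2 * W) * S₂ =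
      2 * ν * (3 * ν * S₂ + 2 * q * (u₀ ^ 3 + u₁ ^ 3 - v₀ ^ 3 - v₁ ^ 3)) -
        q * W * (2 * ν * S₁ + q * S₂) by simp only [hS₁, hS₂, hW]; ring]
    exact this
  refine ⟨?_, hS₂d⟩
  have h2ν : ¬ (p : ℤ) ∣ 2 * ν := fun h => (hp'.dvd_or_dvd h).elim h2 hν
  refine Int.pow_dvd_of_dvd_mul_of_not_dvd hp h2ν ?_
  simpa using dvd_sub h₁ (hS₂d.mul_left q)

/-- Residues modulo `p ^ n` satisfying `k₀ + k₁ = k₀' + k₁'` and `(k₀ - k₀') (k₁ - k₀') = 0`. -/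
noncomputable def quadraticResidueSolutions (p n : ℕ) : Finset ((Fin 2 → ℕ) × (Fin 2 → ℕ)) :=
  {kk ∈ Fintype.piFinset (fun _ : Fin 2 => range (p ^ n)) ×ˢ
      Fintype.piFinset fun _ : Fin 2 => range (p ^ n) |
    (p : ℤ) ^ n ∣ kk.1 0 + kk.1 1 - kk.2 0 - kk.2 1 ∧
    (p : ℤ) ^ n ∣ (kk.1 0 - kk.2 0) * (kk.1 1 - kk.2 0)}

theorem Nat.eq_of_div_eq_of_intCast_dvd_sub {d k k' c : ℕ} (h : k / d = k' / d)
    (hk : (d : ℤ) ∣ (k : ℤ) - c) (hk' : (d : ℤ) ∣ (k' : ℤ) - c) : k = k' := by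
  have h1 : (d : ℤ) ∣ (k : ℤ) - k' := by
    rw [← sub_sub_sub_cancel_right (k : ℤ) k' c]
    exact _root_.dvd_sub hk hk'
  have h2 : k' ≡ k [MOD d] := (Nat.modEq_iff_dvd).mpr h1
  rw [← Nat.div_add_mod k d, ← Nat.div_add_mod k' d, h, h2]

theorem card_quadraticResidueSolutions_le {p : ℕ} (hp : p.Prime) (n : ℕ) :
    #(quadraticResidueSolutions p n) ≤ (n + 1) * p ^ (2 * n) := by
  classical
  let T (i : ℕ) : Finset ((Fin 2 → ℕ) × (Fin 2 → ℕ)) :=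
    {kk ∈ quadraticResidueSolutions p n |
      ((p ^ i : ℕ) : ℤ) ∣ kk.1 0 - kk.2 0 ∧ ((p ^ (n - i) : ℕ) : ℤ) ∣ kk.1 1 - kk.2 0}
  have hsub : quadraticResidueSolutions p n ⊆ (range (n + 1)).biUnion T := by
    intro kk hkk
    have h := (Finset.mem_filter.mp hkk).2.2
    rw [← Int.natAbs_dvd_natAbs, Int.natAbs_mul, Int.natAbs_pow, Int.natAbs_natCast] at h
    obtain ⟨d, e, hd, he, hde⟩ := exists_dvd_and_dvd_of_dvd_mul h
    obtain ⟨i, hi, rfl⟩ := (Nat.dvd_prime_pow hp).mp (Dvd.intro _ hde.symm)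
    have he' : e = p ^ (n - i) := by
      refine Nat.eq_of_mul_eq_mul_left (pow_pos hp.pos i) ?_
      rw [← hde, ← pow_add]; congr 1; omega
    rw [he'] at he
    simp only [Finset.mem_biUnion, Finset.mem_range, T, Finset.mem_filter]
    exact ⟨i, by omega, hkk, Int.natCast_dvd.mpr hd, Int.natCast_dvd.mpr he⟩
  refine (Finset.card_le_card hsub).trans (Finset.card_biUnion_le.trans ?_)
  have hT (i : ℕ) (hi : i ∈ range (n + 1)) : #(T i) ≤ p ^ (2 * n) := by
    have hin : i ≤ n := by have := Finset.mem_range.mp hi; omega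
    have hc : #(range (p ^ n) ×ˢ (range (p ^ (n - i)) ×ˢ range (p ^ i))) = p ^ (2 * n) := by
      simp only [Finset.card_product, Finset.card_range, ← pow_add]
      congr 1; omega
    rw [← hc]
    have hmem (kk) (hkk : kk ∈ T i) := Finset.mem_filter.mp hkk
    refine Finset.card_le_card_of_injOn
      (fun kk => (kk.2 0, kk.1 0 / p ^ i, kk.1 1 / p ^ (n - i))) ?_ ?_
    · intro kk hkk
      have h := (Finset.mem_filter.mp (hmem kk hkk).1).1
      simp only [Finset.mem_product, Fintype.mem_piFinset, Finset.mem_range] at h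
      simp only [Finset.coe_product, Set.mem_prod, Finset.mem_coe, Finset.mem_range]
      refine ⟨h.2 0, Nat.div_lt_of_lt_mul ?_, Nat.div_lt_of_lt_mul ?_⟩
      · rw [← pow_add, Nat.add_sub_cancel' hin]; exact h.1 0
      · rw [← pow_add, Nat.sub_add_cancel hin]; exact h.1 1
    · intro kk hkk jj hjj h
      simp only [Prod.mk.injEq] at h
      obtain ⟨h0, h1, h2⟩ := h
      obtain ⟨hk, hk1, hk2⟩ := hmem kk hkk
      obtain ⟨hj, hj1, hj2⟩ := hmem jj hjj
      rw [← h0] at hj1 hj2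
      have e0 := Nat.eq_of_div_eq_of_intCast_dvd_sub h1 hk1 hj1
      have e1 := Nat.eq_of_div_eq_of_intCast_dvd_sub h2 hk2 hj2
      obtain ⟨hkr, hks, -⟩ := Finset.mem_filter.mp hk
      obtain ⟨hjr, hjs, -⟩ := Finset.mem_filter.mp hj
      simp only [Finset.mem_product, Fintype.mem_piFinset, Finset.mem_range] at hkr hjr
      have e2 : kk.2 1 = jj.2 1 := by
        refine Nat.eq_of_lt_of_intCast_dvd_sub (hkr.2 1) (hjr.2 1) ?_
        push_cast
        rw [← e0, ← e1, ← h0] at hjs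
        rw [show (kk.2 1 : ℤ) - jj.2 1 = kk.1 0 + kk.1 1 - kk.2 0 - jj.2 1 -
          (kk.1 0 + kk.1 1 - kk.2 0 - kk.2 1) by ring]
        exact dvd_sub hjs hks
      refine Prod.ext (funext fun t => ?_) (funext fun t => ?_) <;> fin_cases t
      exacts [e0, e1, h0, e2]
  calc ∑ i ∈ range (n + 1), #(T i) ≤ ∑ _i ∈ range (n + 1), p ^ (2 * n) := Finset.sum_le_sum hT
    _ = (n + 1) * p ^ (2 * n) := by simp

theorem mixedMoment_two_four_le {M N p a b : ℕ} [NeZero M] (hM : 6 * N ^ 3 < M) (hp : p.Prime)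
    (hp5 : 5 ≤ p) (ha : 1 ≤ a) (hab : a ≤ b) {ξ η : ℤ} (hξη : ¬ (p : ℤ) ∣ ξ - η) {D : ℝ}
    (hD : ∀ ξ' : ℤ, ¬ (p : ℤ) ∣ ξ' - η →
      mixedMoment M 2 4 (residueClass N (p ^ (2 * b - a)) ξ') (residueClass N (p ^ b) η) ≤ D) :
    mixedMoment M 2 4 (residueClass N (p ^ a) ξ) (residueClass N (p ^ b) η) ≤
      ((2 * (b - a) : ℕ) + 1) * p ^ (4 * (b - a)) * (4 * D) := by
  classical
  set n := 2 * (b - a) with hn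
  have hpa : (p : ℤ) ∣ (p ^ a : ℕ) := by
    push_cast; exact dvd_pow_self _ (by omega)
  have hpa0 : ((p ^ a : ℕ) : ℤ) ≠ 0 := by exact_mod_cast (pow_pos hp.pos a).ne'
  have hpow : p ^ a * p ^ n = p ^ (2 * b - a) := by rw [← pow_add]; congr 1; omega
  have hξ' (k : ℕ) : ¬ (p : ℤ) ∣ (ξ + (p ^ a : ℕ) * k) - η := fun h => hξη (by
    simpa [add_sub_right_comm] using dvd_sub h (hpa.mul_right k))
  have hD0 : 0 ≤ D := (mixedMoment_nonneg _ _ _ _ _).trans (hD ξ hξη)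
  have h := mixedMoment_le_card_mul (M := M) (N := N) (m := 2) (l := 4) two_pos (by simpa using hM)
    (K := range (p ^ n)) (A := residueClass N (p ^ a) ξ)
    (B := residueClass N (p ^ b) η)
    (A' := fun k => residueClass N (p ^ (2 * b - a)) (ξ + (p ^ a : ℕ) * k)) ?_
    (fun k _ => residueClass_subset _ _ _) (residueClass_subset _ _ _)
    (quadraticResidueSolutions p n) ?_ ?_ (fun k _ => hD _ (hξ' k))
  · refine h.trans ?_
    have hS : (#(quadraticResidueSolutions p n) : ℝ) ≤ (n + 1) * p ^ (4 * (b - a)) := by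
      have := card_quadraticResidueSolutions_le hp n
      rw [show 2 * n = 4 * (b - a) by omega] at this
      exact_mod_cast this
    rw [show (2 : ℝ) * (2 : ℕ) * D = 4 * D by push_cast; ring]
    exact mul_le_mul_of_nonneg_right hS (by positivity)
  · intro ψ
    rw [expSum_residueClass_eq_sum M N (pow_pos hp.pos a) (pow_pos hp.pos n), hpow]
  · intro kk hkk i
    have h := (Finset.mem_filter.mp hkk).1
    simp only [Finset.mem_product, Fintype.mem_piFinset] at h
    exact ⟨h.1 i, h.2 i⟩
  · intro k k' x x' y y' hk hk' hx hx' hy hy' hP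
    have hpowdvd (j : ℕ) (hj : j ≤ 3) (hj2 : 2 ≤ j) :
        ((p ^ a : ℕ) : ℤ) * ((p ^ a : ℕ) * (p : ℤ) ^ n) ∣
          ∑ i, (x i - η) ^ j - ∑ i, (x' i - η) ^ j := by
      refine Dvd.dvd.trans ?_ (hP.pow_dvd_sum_sub (fun i => (mem_residueClass.mp (hy i)).2)
        (fun i => (mem_residueClass.mp (hy' i)).2) hj)
      push_cast
      rw [← pow_mul, ← pow_add, ← pow_add]
      refine pow_dvd_pow _ ?_
      interval_cases j <;> omega
    have hex (t : ℕ) (z : ℤ) (hz : z ∈ residueClass N (p ^ (2 * b - a)) (ξ + (p ^ a : ℕ) * t)) :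
        ∃ w : ℤ, z = ξ + (p ^ a : ℕ) * (t + p ^ n * w) := by
      obtain ⟨w, hw⟩ := (mem_residueClass.mp hz).2
      refine ⟨w, ?_⟩
      rw [← hpow] at hw
      push_cast at hw ⊢
      linear_combination hw
    choose w hw using fun i => hex _ _ (hx i)
    choose w' hw' using fun i => hex _ _ (hx' i)
    set q : ℤ := ((p ^ a : ℕ) : ℤ) with hq
    set r : ℤ := (p : ℤ) ^ n with hr
    set u₀ : ℤ := k 0 + r * w 0 with hu₀
    set u₁ : ℤ := k 1 + r * w 1 with hu₁
    set v₀ : ℤ := k' 0 + r * w' 0 with hv₀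
    set v₁ : ℤ := k' 1 + r * w' 1 with hv₁
    have d2 := hpowdvd 2 (by norm_num) le_rfl
    have d3 := hpowdvd 3 le_rfl (by norm_num)
    simp only [Fin.sum_univ_two, hw, hw'] at d2 d3
    rw [show (ξ + q * u₀ - η) ^ 2 + (ξ + q * u₁ - η) ^ 2 -
      ((ξ + q * v₀ - η) ^ 2 + (ξ + q * v₁ - η) ^ 2) =
      q * (2 * (ξ - η) * (u₀ + u₁ - v₀ - v₁) + q * (u₀ ^ 2 + u₁ ^ 2 - v₀ ^ 2 - v₁ ^ 2)) by ring,
      mul_dvd_mul_iff_left hpa0] at d2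
    rw [show (ξ + q * u₀ - η) ^ 3 + (ξ + q * u₁ - η) ^ 3 -
      ((ξ + q * v₀ - η) ^ 3 + (ξ + q * v₁ - η) ^ 3) =
      q * (3 * (ξ - η) ^ 2 * (u₀ + u₁ - v₀ - v₁) +
        3 * (ξ - η) * q * (u₀ ^ 2 + u₁ ^ 2 - v₀ ^ 2 - v₁ ^ 2) +
        q ^ 2 * (u₀ ^ 3 + u₁ ^ 3 - v₀ ^ 3 - v₁ ^ 3)) by ring,
      mul_dvd_mul_iff_left hpa0] at d3
    have d4 := dvd_sub (d3.mul_left 2) (d2.mul_left (3 * (ξ - η)))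
    rw [show 2 * (3 * (ξ - η) ^ 2 * (u₀ + u₁ - v₀ - v₁) +
        3 * (ξ - η) * q * (u₀ ^ 2 + u₁ ^ 2 - v₀ ^ 2 - v₁ ^ 2) +
        q ^ 2 * (u₀ ^ 3 + u₁ ^ 3 - v₀ ^ 3 - v₁ ^ 3)) -
        3 * (ξ - η) * (2 * (ξ - η) * (u₀ + u₁ - v₀ - v₁) +
          q * (u₀ ^ 2 + u₁ ^ 2 - v₀ ^ 2 - v₁ ^ 2)) =
        q * (3 * (ξ - η) * (u₀ ^ 2 + u₁ ^ 2 - v₀ ^ 2 - v₁ ^ 2) +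
          2 * q * (u₀ ^ 3 + u₁ ^ 3 - v₀ ^ 3 - v₁ ^ 3)) by ring,
      mul_dvd_mul_iff_left hpa0] at d4
    obtain ⟨f1, f2⟩ := pow_dvd_sum_sq_sub_of_pow_dvd hp hp5 hpa hξη
      ((dvd_mul_left r q).trans d2) d4
    refine Finset.mem_filter.mpr ⟨?_, ?_, ?_⟩
    · simp only [Finset.mem_product, Fintype.mem_piFinset]
      exact ⟨hk, hk'⟩
    · rw [show (k 0 : ℤ) + k 1 - k' 0 - k' 1 = u₀ + u₁ - v₀ - v₁ -
        r * (w 0 + w 1 - w' 0 - w' 1) by simp only [hu₀, hu₁, hv₀, hv₁]; ring]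
      exact dvd_sub f1 (dvd_mul_right _ _)
    · have g : r ∣ 2 * ((u₀ - v₀) * (u₁ - v₀)) := by
        rw [show 2 * ((u₀ - v₀) * (u₁ - v₀)) = (u₀ + u₁ - v₀ - v₁) * (u₀ + u₁ - v₀ + v₁) -
          (u₀ ^ 2 + u₁ ^ 2 - v₀ ^ 2 - v₁ ^ 2) by ring]
        exact dvd_sub (f1.mul_right _) f2
      have g' := Int.pow_dvd_of_dvd_mul_of_not_dvd hp
        (Int.Prime.not_dvd_intCast_of_lt (n := 2) (by norm_num) (by omega)) g
      rw [show ((k 0 : ℤ) - k' 0) * (k 1 - k' 0) = (u₀ - v₀) * (u₁ - v₀) -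
        r * ((w 0 - w' 0) * (k 1 - k' 0) + (u₀ - v₀) * (w 1 - w' 0)) by
          simp only [hu₀, hu₁, hv₀]; ring]
      exact dvd_sub g' (dvd_mul_right _ _)

theorem Finset.pow_sum_le_sum_mul_pow_sum {ι : Type*} (s : Finset ι) {x a b : ι → ℝ} {n : ℕ}
    (hn : 0 < n) (hx : ∀ i ∈ s, 0 ≤ x i) (ha : ∀ i ∈ s, 0 ≤ a i) (hb : ∀ i ∈ s, 0 ≤ b i)
    (h : ∀ i ∈ s, x i ^ (n + 1) = a i * b i ^ n) :
    (∑ i ∈ s, x i) ^ (n + 1) ≤ (∑ i ∈ s, a i) * (∑ i ∈ s, b i) ^ n := by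
  have hn' : (0 : ℝ) < n := by exact_mod_cast hn
  have hn1 : (0 : ℝ) < n + 1 := by positivity
  have hpq : Real.HolderConjugate ((n : ℝ) + 1) (((n : ℝ) + 1) / n) := by
    rw [Real.holderConjugate_iff]
    refine ⟨by linarith, ?_⟩
    field_simp
    ring
  have hA := Finset.sum_nonneg ha
  have hB := Finset.sum_nonneg hb
  have hroot (i : ι) (hi : i ∈ s) :
      x i = a i ^ ((1 : ℝ) / (n + 1)) * b i ^ ((n : ℝ) / (n + 1)) := by
    rw [← pow_left_inj₀ (hx i hi) (by have := ha i hi; have := hb i hi; positivity)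
      (Nat.succ_ne_zero n), h i hi, mul_pow, ← Real.rpow_mul_natCast (ha i hi),
      ← Real.rpow_mul_natCast (hb i hi)]
    push_cast
    rw [div_mul_cancel₀ _ hn1.ne', div_mul_cancel₀ _ hn1.ne', Real.rpow_one, Real.rpow_natCast]
  have hH := Real.inner_le_Lp_mul_Lq_of_nonneg s hpq
    (f := fun i => a i ^ ((1 : ℝ) / (n + 1))) (g := fun i => b i ^ ((n : ℝ) / (n + 1)))
    (fun i hi => Real.rpow_nonneg (ha i hi) _) (fun i hi => Real.rpow_nonneg (hb i hi) _)
  have e1 : ∑ i ∈ s, (a i ^ ((1 : ℝ) / (n + 1))) ^ ((n : ℝ) + 1) = ∑ i ∈ s, a i :=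
    Finset.sum_congr rfl fun i hi => by
      rw [← Real.rpow_mul (ha i hi), div_mul_cancel₀ _ hn1.ne', Real.rpow_one]
  have e2 : ∑ i ∈ s, (b i ^ ((n : ℝ) / (n + 1))) ^ (((n : ℝ) + 1) / n) = ∑ i ∈ s, b i :=
    Finset.sum_congr rfl fun i hi => by
      rw [← Real.rpow_mul (hb i hi), div_mul_div_cancel₀ hn1.ne', div_self hn'.ne', Real.rpow_one]
  rw [e1, e2, ← Finset.sum_congr rfl hroot, one_div_div] at hH
  calc (∑ i ∈ s, x i) ^ (n + 1) ≤ ((∑ i ∈ s, a i) ^ ((1 : ℝ) / (n + 1)) *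
        (∑ i ∈ s, b i) ^ ((n : ℝ) / (n + 1))) ^ (n + 1) :=
        pow_le_pow_left₀ (Finset.sum_nonneg hx) hH _
    _ = (∑ i ∈ s, a i) * (∑ i ∈ s, b i) ^ n := by
        rw [mul_pow, ← Real.rpow_mul_natCast hA, ← Real.rpow_mul_natCast hB]
        push_cast
        rw [div_mul_cancel₀ _ hn1.ne', div_mul_cancel₀ _ hn1.ne', Real.rpow_one,
          Real.rpow_natCast]

theorem mixedMoment_pow_le {M : ℕ} [NeZero M] {m l m₁ l₁ m₂ l₂ n : ℕ} {A B A₁ B₁ A₂ B₂ : Finset ℤ}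
    (hn : 0 < n)
    (h : ∀ ψ, (‖expSum M A ψ‖ ^ (2 * m) * ‖expSum M B ψ‖ ^ (2 * l)) ^ (n + 1) =
      ‖expSum M A₁ ψ‖ ^ (2 * m₁) * ‖expSum M B₁ ψ‖ ^ (2 * l₁) *
      (‖expSum M A₂ ψ‖ ^ (2 * m₂) * ‖expSum M B₂ ψ‖ ^ (2 * l₂)) ^ n) :
    mixedMoment M m l A B ^ (n + 1) ≤
      mixedMoment M m₁ l₁ A₁ B₁ * mixedMoment M m₂ l₂ A₂ B₂ ^ n := by
  have key := Finset.pow_sum_le_sum_mul_pow_sum univ hn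
    (fun ψ _ => by positivity) (fun ψ _ => by positivity) (fun ψ _ => by positivity)
    (fun ψ _ => h ψ)
  simp only [mixedMoment, mul_pow]
  calc _ ≤ _ := mul_le_mul_of_nonneg_left key (by positivity)
    _ = _ := by ring

theorem mixedMoment_two_four_pow_le (M : ℕ) [NeZero M] (A B : Finset ℤ) :
    mixedMoment M 2 4 A B ^ 3 ≤ mixedMoment M 2 4 B A * mixedMoment M 1 5 A B ^ 2 :=
  mixedMoment_pow_le two_pos fun ψ => by ring

theorem mixedMoment_one_five_pow_le (M : ℕ) [NeZero M] (A B : Finset ℤ) :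
    mixedMoment M 1 5 A B ^ 4 ≤ mixedMoment M 2 4 B A * mixedMoment M 6 0 B B ^ 3 :=
  mixedMoment_pow_le three_pos fun ψ => by ring

theorem mixedMoment_two_four_pow_le_six_zero (M : ℕ) [NeZero M] (A B : Finset ℤ) :
    mixedMoment M 2 4 A B ^ 3 ≤ mixedMoment M 6 0 A A * mixedMoment M 6 0 B B ^ 2 :=
  mixedMoment_pow_le two_pos fun ψ => by ring

theorem pow_norm_sum_le {p : ℕ} (hp : 2 ≤ p) (f : ℕ → ℂ) :
    ‖∑ k ∈ range p, f k‖ ^ 12 ≤ 2 ^ 11 * (∑ k ∈ range p, ‖f k‖ ^ 12 +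
      p ^ 12 * ∑ k ∈ range p, ∑ l ∈ (range p).erase k, ‖f k‖ ^ 4 * ‖f l‖ ^ 8) := by
  classical
  obtain ⟨l, hl, hlmax⟩ := Finset.exists_max_image (range p) (fun k => ‖f k‖)
    ⟨0, Finset.mem_range.mpr (by omega)⟩
  obtain ⟨k, hk, hkmax⟩ := Finset.exists_max_image ((range p).erase l) (fun k => ‖f k‖)
    (Finset.card_pos.mp (by rw [Finset.card_erase_of_mem hl, Finset.card_range]; omega))
  have hkl := Finset.mem_erase.mp hk
  have h1 : ‖∑ k ∈ range p, f k‖ ≤ ‖f l‖ + p * ‖f k‖ := by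
    rw [← Finset.add_sum_erase _ _ hl]
    refine (norm_add_le _ _).trans (add_le_add le_rfl ((norm_sum_le _ _).trans ?_))
    refine (Finset.sum_le_card_nsmul _ _ _ hkmax).trans ?_
    rw [nsmul_eq_mul]
    refine mul_le_mul_of_nonneg_right ?_ (norm_nonneg _)
    exact_mod_cast (Finset.card_le_card (Finset.erase_subset _ _)).trans_eq (Finset.card_range p)
  have h2 : ‖f l‖ ^ 12 ≤ ∑ k ∈ range p, ‖f k‖ ^ 12 :=
    Finset.single_le_sum (f := fun k => ‖f k‖ ^ 12) (fun k _ => by positivity) hl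
  have h3 : ‖f k‖ ^ 12 ≤ ∑ k ∈ range p, ∑ l ∈ (range p).erase k, ‖f k‖ ^ 4 * ‖f l‖ ^ 8 := by
    calc ‖f k‖ ^ 12 = ‖f k‖ ^ 4 * ‖f k‖ ^ 8 := by ring
      _ ≤ ‖f k‖ ^ 4 * ‖f l‖ ^ 8 := by gcongr; exact hlmax k hkl.2
      _ ≤ ∑ l ∈ (range p).erase k, ‖f k‖ ^ 4 * ‖f l‖ ^ 8 :=
          Finset.single_le_sum (f := fun l => ‖f k‖ ^ 4 * ‖f l‖ ^ 8) (fun k _ => by positivity)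
            (Finset.mem_erase.mpr ⟨hkl.1.symm, hl⟩)
      _ ≤ _ := Finset.single_le_sum
          (f := fun k => ∑ l ∈ (range p).erase k, ‖f k‖ ^ 4 * ‖f l‖ ^ 8)
          (fun k _ => by positivity) hkl.2
  calc ‖∑ k ∈ range p, f k‖ ^ 12 ≤ (‖f l‖ + p * ‖f k‖) ^ 12 := by gcongr
    _ ≤ 2 ^ 11 * (‖f l‖ ^ 12 + (p * ‖f k‖) ^ 12) :=
        add_pow_le (norm_nonneg _) (by positivity) 12
    _ ≤ _ := by rw [mul_pow]; gcongr

theorem mixedMoment_six_zero_le (M N : ℕ) [NeZero M] {p : ℕ} (hp : 2 ≤ p) (B : Finset ℤ) :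
    mixedMoment M 6 0 (Icc (1 : ℤ) N) B ≤ 2 ^ 11 *
      (∑ k ∈ range p, mixedMoment M 6 0 (residueClass N p k) (residueClass N p k) +
        p ^ 12 * ∑ k ∈ range p, ∑ l ∈ (range p).erase k,
          mixedMoment M 2 4 (residueClass N p k) (residueClass N p l)) := by
  have hsplit (ψ : AddChar (ZMod M × ZMod M × ZMod M) ℂ) :
      expSum M (Icc (1 : ℤ) N) ψ = ∑ k ∈ range p, expSum M (residueClass N p k) ψ := by
    rw [← residueClass_one, expSum_residueClass_eq_sum M N one_pos (show 0 < p by omega)]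
    simp
  simp only [mixedMoment, hsplit]
  simp only [← Finset.mul_sum]
  rw [show ∀ c x y : ℝ, 2 ^ 11 * (c * x + p ^ 12 * (c * y)) =
    c * (2 ^ 11 * (x + p ^ 12 * y)) by intros; ring]
  refine mul_le_mul_of_nonneg_left ?_ (by positivity)
  refine (Finset.sum_le_sum fun ψ _ =>
    (?_ : _ ≤ 2 ^ 11 * (∑ k ∈ range p, ‖expSum M (residueClass N p k) ψ‖ ^ 12 +
      p ^ 12 * ∑ k ∈ range p, ∑ l ∈ (range p).erase k, ‖expSum M (residueClass N p k) ψ‖ ^ 4 *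
        ‖expSum M (residueClass N p l) ψ‖ ^ 8))).trans_eq ?_
  · simpa using pow_norm_sum_le hp fun k => expSum M (residueClass N p k) ψ
  · rw [← Finset.mul_sum, Finset.sum_add_distrib, ← Finset.mul_sum, Finset.sum_comm,
      Finset.sum_comm (s := univ) (t := range p)]
    simp only [Finset.sum_comm (s := univ)]
    simp

/-- The twelfth moment bound with exponent `6 + Δ`. -/
def TwelfthMomentBound (Δ : ℝ) : Prop :=
  ∃ C : ℝ, 0 ≤ C ∧ ∀ N : ℕ, 1 ≤ N →
    (solutionCount 6 (Icc (1 : ℤ) N) : ℝ) ≤ C * (N : ℝ) ^ (6 + Δ)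

theorem mixedMoment_residueClass_le {C Δ : ℝ} (hΔ : 0 ≤ Δ) (hC : 0 ≤ C)
    (hJ : ∀ N : ℕ, 1 ≤ N → (solutionCount 6 (Icc (1 : ℤ) N) : ℝ) ≤ C * (N : ℝ) ^ (6 + Δ))
    {M N p b : ℕ} [NeZero M] (hM : 6 * N ^ 3 < M) (hp : 0 < p) (hpN : p ^ b ≤ N) (η : ℤ)
    (B : Finset ℤ) :
    mixedMoment M 6 0 (residueClass N (p ^ b) η) B ≤
      C * 2 ^ (6 + Δ) * (N : ℝ) ^ (6 + Δ) * (p : ℝ) ^ (-(6 + Δ) * b) := by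
  have hq : 0 < p ^ b := pow_pos hp b
  have hp' : (0 : ℝ) < p := by exact_mod_cast hp
  have hq' : (0 : ℝ) < (p : ℝ) ^ b := by positivity
  have hqN : (p : ℝ) ^ b ≤ N := by exact_mod_cast hpN
  rw [mixedMoment_zero_eq_solutionCount B (residueClass_subset N _ η) hM]
  calc (solutionCount 6 (residueClass N (p ^ b) η) : ℝ)
      ≤ solutionCount 6 (Icc (1 : ℤ) (N / p ^ b + 1 : ℕ)) := by
        exact_mod_cast solutionCount_residueClass_le 6 N hq η
    _ ≤ C * ((N / p ^ b + 1 : ℕ) : ℝ) ^ (6 + Δ) := hJ _ (Nat.le_add_left 1 _)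
    _ ≤ C * (2 * (N * ((p : ℝ) ^ b)⁻¹)) ^ (6 + Δ) := by
        gcongr
        push_cast
        have h1 : ((N / p ^ b : ℕ) : ℝ) ≤ N * ((p : ℝ) ^ b)⁻¹ := by
          have := Nat.cast_div_le (α := ℝ) (m := N) (n := p ^ b)
          rwa [Nat.cast_pow, div_eq_mul_inv] at this
        have h2 : 1 ≤ N * ((p : ℝ) ^ b)⁻¹ := by
          rw [← div_eq_mul_inv]; exact (one_le_div hq').mpr hqN
        linarith
    _ = C * 2 ^ (6 + Δ) * (N : ℝ) ^ (6 + Δ) * (p : ℝ) ^ (-(6 + Δ) * b) := by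
        rw [Real.mul_rpow (by norm_num) (by positivity), Real.mul_rpow (by positivity)
          (by positivity), ← Real.rpow_natCast, ← Real.rpow_neg hp'.le, ← Real.rpow_mul hp'.le]
        rw [show -(b : ℝ) * (6 + Δ) = -(6 + Δ) * b by ring]
        ring

theorem le_of_pow_le_mul_rpow {k : ℕ} (hk : k ≠ 0) {x K Y P e : ℝ} (hK : 0 ≤ K) (hY : 0 ≤ Y)
    (hP : 0 ≤ P) (h : x ^ k ≤ K * Y ^ k * P ^ (k * e)) : x ≤ (1 + K) * Y * P ^ e := by
  refine le_of_pow_le_pow_left₀ hk (by positivity) (h.trans ?_)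
  rw [mul_pow, mul_pow, ← Real.rpow_mul_natCast hP, mul_comm e]
  gcongr
  exact (by linarith : K ≤ 1 + K).trans (le_self_pow₀ (by linarith) hk)

theorem exists_mixedMoment_two_four_le {C Δ : ℝ} (hΔ : 0 ≤ Δ) (hC : 0 ≤ C)
    (hJ : ∀ N : ℕ, 1 ≤ N → (solutionCount 6 (Icc (1 : ℤ) N) : ℝ) ≤ C * (N : ℝ) ^ (6 + Δ))
    (n a b : ℕ) (ha : 1 ≤ a) (hab : a ≤ b) :
    ∃ D : ℝ, 0 ≤ D ∧ ∀ (M N p : ℕ) (_ : NeZero M) (ξ η : ℤ), 6 * N ^ 3 < M → p.Prime → 5 ≤ p →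
      p ^ (3 ^ n * b) ≤ N → ¬ (p : ℤ) ∣ ξ - η →
      mixedMoment M 2 4 (residueClass N (p ^ a) ξ) (residueClass N (p ^ b) η) ≤
        D * (N : ℝ) ^ (6 + Δ) * (p : ℝ) ^ (-(2 * a + 4 * b) - n * Δ * (3 * b - a) / 6 : ℝ) := by
  set C₀ := C * 2 ^ (6 + Δ) with hC₀
  have hC₀0 : 0 ≤ C₀ := by positivity
  induction n generalizing a b with
  | zero =>
    refine ⟨1 + C₀ ^ 3, by positivity, fun M N p _ ξ η hM hp hp5 hpN hξη => ?_⟩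
    have hp0 : (0 : ℝ) < p := by exact_mod_cast hp.pos
    have hp1 : (1 : ℝ) ≤ p := by exact_mod_cast hp.one_le
    rw [pow_zero, one_mul] at hpN
    have hpNa : p ^ a ≤ N := (Nat.pow_le_pow_right hp.pos hab).trans hpN
    have h1 := mixedMoment_residueClass_le hΔ hC hJ hM hp.pos hpNa ξ (residueClass N (p ^ a) ξ)
    have h2 := mixedMoment_residueClass_le hΔ hC hJ hM hp.pos hpN η (residueClass N (p ^ b) η)
    refine le_of_pow_le_mul_rpow three_ne_zero (by positivity) (by positivity) hp0.le ?_
    refine (mixedMoment_two_four_pow_le_six_zero M _ _).trans ?_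
    calc _ ≤ (C₀ * (N : ℝ) ^ (6 + Δ) * (p : ℝ) ^ (-(6 + Δ) * a)) *
          (C₀ * (N : ℝ) ^ (6 + Δ) * (p : ℝ) ^ (-(6 + Δ) * b)) ^ 2 :=
          mul_le_mul h1 (pow_le_pow_left₀ (mixedMoment_nonneg _ _ _ _ _) h2 2)
            (pow_nonneg (mixedMoment_nonneg _ _ _ _ _) 2) (by positivity)
      _ = C₀ ^ 3 * ((N : ℝ) ^ (6 + Δ)) ^ 3 *
          (p : ℝ) ^ (-(6 + Δ) * a + -(6 + Δ) * b * (2 : ℕ)) := by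
          rw [Real.rpow_add hp0, Real.rpow_mul_natCast hp0.le (-(6 + Δ) * b) 2]; ring
      _ ≤ _ := by
          gcongr
          have : 0 ≤ Δ * a := by positivity
          have : 0 ≤ Δ * b := by positivity
          push_cast
          nlinarith
  | succ n ih =>
    obtain ⟨D₁, hD₁, h₁⟩ := ih b (2 * b - a) (by omega) (by omega)
    obtain ⟨D₂, hD₂, h₂⟩ := ih b (3 * b) (by omega) (by omega)
    set K₁ := 1 + D₂ * C₀ ^ 3 with hK₁
    set K₂ := 1 + D₁ * (2 * K₁) ^ 2 with hK₂
    refine ⟨((2 * (b - a) : ℕ) + 1) * (4 * K₂), by positivity,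
      fun M N p _ ξ η hM hp hp5 hpN hξη => ?_⟩
    have hp0 : (0 : ℝ) < p := by exact_mod_cast hp.pos
    have hp1 : (1 : ℝ) ≤ p := by exact_mod_cast hp.one_le
    have hbN : p ^ b ≤ N :=
      (Nat.pow_le_pow_right hp.pos (Nat.le_mul_of_pos_left b (by positivity))).trans hpN
    have h3b : p ^ (3 ^ n * (3 * b)) ≤ N := by rwa [← mul_assoc, ← pow_succ]
    have h2b : p ^ (3 ^ n * (2 * b - a)) ≤ N :=
      (Nat.pow_le_pow_right hp.pos (Nat.mul_le_mul_left _ (by omega))).trans h3b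
    have hswap (ξ' : ℤ) (h : ¬ (p : ℤ) ∣ ξ' - η) : ¬ (p : ℤ) ∣ η - ξ' := by
      rwa [dvd_sub_comm]
    have h₀ := mixedMoment_residueClass_le hΔ hC hJ hM hp.pos hbN η (residueClass N (p ^ b) η)
    set Y := (N : ℝ) ^ (6 + Δ) with hY
    have hY0 : 0 ≤ Y := by positivity
    have hI₁ (ξ' : ℤ) (h : ¬ (p : ℤ) ∣ ξ' - η) :
        mixedMoment M 1 5 (residueClass N (p ^ (3 * b)) ξ') (residueClass N (p ^ b) η) ≤
          K₁ * Y * (p : ℝ) ^ (-8 * b - n * Δ * b / 3 - 3 * Δ * b / 4 : ℝ) := by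
      refine le_of_pow_le_mul_rpow four_ne_zero (by positivity) hY0 hp0.le ?_
      refine (mixedMoment_one_five_pow_le M _ _).trans ?_
      calc _ ≤ (D₂ * Y * (p : ℝ) ^
              (-(2 * b + 4 * (3 * b : ℕ)) - n * Δ * (3 * (3 * b : ℕ) - b) / 6 : ℝ)) *
            (C₀ * Y * (p : ℝ) ^ (-(6 + Δ) * b)) ^ 3 :=
            mul_le_mul (h₂ M N p _ η ξ' hM hp hp5 h3b (hswap ξ' h))
              (pow_le_pow_left₀ (mixedMoment_nonneg _ _ _ _ _) h₀ 3)
              (pow_nonneg (mixedMoment_nonneg _ _ _ _ _) 3) (by positivity)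
        _ = D₂ * C₀ ^ 3 * Y ^ 4 * (p : ℝ) ^
            ((-(2 * b + 4 * (3 * b : ℕ)) - n * Δ * (3 * (3 * b : ℕ) - b) / 6 : ℝ) +
              -(6 + Δ) * b * (3 : ℕ)) := by
            rw [Real.rpow_add hp0, Real.rpow_mul_natCast hp0.le (-(6 + Δ) * b) 3]; ring
        _ = _ := by
            congr 2
            push_cast
            ring
    have hI₁' (ξ' : ℤ) (h : ¬ (p : ℤ) ∣ ξ' - η) :
        mixedMoment M 1 5 (residueClass N (p ^ (2 * b - a)) ξ') (residueClass N (p ^ b) η) ≤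
          2 * K₁ * Y *
            (p : ℝ) ^ ((a + b : ℕ) + (-8 * b - n * Δ * b / 3 - 3 * Δ * b / 4) : ℝ) := by
      refine (mixedMoment_one_five_le hM hp hp5 (by omega) (by omega) h hI₁).trans_eq ?_
      rw [show 3 * b - (2 * b - a) = a + b by omega, Real.rpow_add hp0, Real.rpow_natCast]
      ring
    have hI₂ (ξ' : ℤ) (h : ¬ (p : ℤ) ∣ ξ' - η) :
        mixedMoment M 2 4 (residueClass N (p ^ (2 * b - a)) ξ') (residueClass N (p ^ b) η) ≤
          K₂ * Y * (p : ℝ) ^ (2 * a - 8 * b - n * Δ * (3 * b - a) / 6 - Δ * b / 2 : ℝ) := by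
      refine le_of_pow_le_mul_rpow three_ne_zero (by positivity) hY0 hp0.le ?_
      refine (mixedMoment_two_four_pow_le M _ _).trans ?_
      calc _ ≤ (D₁ * Y * (p : ℝ) ^
              (-(2 * b + 4 * (2 * b - a : ℕ)) - n * Δ * (3 * (2 * b - a : ℕ) - b) / 6 : ℝ)) *
            (2 * K₁ * Y *
              (p : ℝ) ^ ((a + b : ℕ) + (-8 * b - n * Δ * b / 3 - 3 * Δ * b / 4) : ℝ)) ^ 2 :=
            mul_le_mul (h₁ M N p _ η ξ' hM hp hp5 h2b (hswap ξ' h))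
              (pow_le_pow_left₀ (mixedMoment_nonneg _ _ _ _ _) (hI₁' ξ' h) 2)
              (pow_nonneg (mixedMoment_nonneg _ _ _ _ _) 2) (by positivity)
        _ = D₁ * (2 * K₁) ^ 2 * Y ^ 3 * (p : ℝ) ^
            ((-(2 * b + 4 * (2 * b - a : ℕ)) - n * Δ * (3 * (2 * b - a : ℕ) - b) / 6 : ℝ) +
              ((a + b : ℕ) + (-8 * b - n * Δ * b / 3 - 3 * Δ * b / 4)) * (2 : ℕ)) := by
            rw [Real.rpow_add hp0 _ (_ * _), Real.rpow_mul_natCast hp0.le]; ring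
        _ = _ := by
            congr 2
            rw [Nat.cast_sub (by omega)]
            push_cast
            ring
    refine (mixedMoment_two_four_le hM hp hp5 ha hab hξη hI₂).trans ?_
    calc _ = ((2 * (b - a) : ℕ) + 1) * (4 * K₂) * Y * (p : ℝ) ^ ((4 * (b - a) : ℕ) +
          (2 * a - 8 * b - n * Δ * (3 * b - a) / 6 - Δ * b / 2) : ℝ) := by
          rw [Real.rpow_add hp0, Real.rpow_natCast]; ring
      _ ≤ _ := by
          gcongr
          have : 0 ≤ Δ * a := by positivity
          push_cast [Nat.cast_sub hab]
          nlinarith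

theorem exists_solutionCount_six_le_div_prime {C Δ : ℝ} (hΔ : 0 ≤ Δ) (hC : 0 ≤ C)
    (hJ : ∀ N : ℕ, 1 ≤ N → (solutionCount 6 (Icc (1 : ℤ) N) : ℝ) ≤ C * (N : ℝ) ^ (6 + Δ))
    {n : ℕ} (hn : 27 ≤ n * Δ) :
    ∃ D : ℝ, 0 ≤ D ∧ ∀ N p : ℕ, p.Prime → 5 ≤ p → p ^ 3 ^ n ≤ N →
      (solutionCount 6 (Icc (1 : ℤ) N) : ℝ) ≤ D * (N : ℝ) ^ (6 + Δ) * (p : ℝ)⁻¹ := by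
  obtain ⟨D, hD, h⟩ := exists_mixedMoment_two_four_le hΔ hC hJ n 1 1 le_rfl le_rfl
  set C₀ := C * 2 ^ (6 + Δ) with hC₀
  refine ⟨2 ^ 11 * (C₀ + D), by positivity, fun N p hp hp5 hpN => ?_⟩
  have hp0 : (0 : ℝ) < p := by exact_mod_cast hp.pos
  have hp1 : (1 : ℝ) ≤ p := by exact_mod_cast hp.one_le
  set M := 6 * N ^ 3 + 1 with hM
  have hM' : 6 * N ^ 3 < M := Nat.lt_succ_self _
  have hpN' : p ^ 1 ≤ N := (Nat.pow_le_pow_right hp.pos (Nat.one_le_pow _ _ (by norm_num))).trans hpN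
  rw [← mixedMoment_zero_eq_solutionCount ∅ subset_rfl hM']
  refine (mixedMoment_six_zero_le M N hp.two_le ∅).trans ?_
  have h1 (k : ℕ) : mixedMoment M 6 0 (residueClass N p k) (residueClass N p k) ≤
      C₀ * (N : ℝ) ^ (6 + Δ) * (p : ℝ) ^ (-2 : ℝ) := by
    have := mixedMoment_residueClass_le hΔ hC hJ hM' hp.pos hpN' k (residueClass N p k)
    rw [pow_one] at this
    refine this.trans ?_
    gcongr
    push_cast; linarith
  have h2 (k l : ℕ) (hk : k ∈ range p) (hl : l ∈ (range p).erase k) :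
      mixedMoment M 2 4 (residueClass N p k) (residueClass N p l) ≤
        D * (N : ℝ) ^ (6 + Δ) * (p : ℝ) ^ (-15 : ℝ) := by
    obtain ⟨hlk, hl⟩ := Finset.mem_erase.mp hl
    have := h M N p inferInstance k l hM' hp hp5 (by rwa [mul_one]) fun hd => hlk
      (Nat.eq_of_lt_of_intCast_dvd_sub (Finset.mem_range.mp hk) (Finset.mem_range.mp hl) hd).symm
    rw [pow_one] at this
    refine this.trans ?_
    gcongr
    push_cast; linarith
  have e1 : (p : ℝ) * (p : ℝ) ^ (-2 : ℝ) = (p : ℝ)⁻¹ := by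
    rw [← Real.rpow_one_add' hp0.le (by norm_num), ← Real.rpow_neg_one]; norm_num
  have e2 : (p : ℝ) ^ 14 * (p : ℝ) ^ (-15 : ℝ) = (p : ℝ)⁻¹ := by
    rw [← Real.rpow_natCast, ← Real.rpow_add hp0, ← Real.rpow_neg_one]; norm_num
  calc _ ≤ 2 ^ 11 * (∑ _k ∈ range p, C₀ * (N : ℝ) ^ (6 + Δ) * (p : ℝ) ^ (-2 : ℝ) +
        p ^ 12 * ∑ _k ∈ range p, ∑ _l ∈ range p, D * (N : ℝ) ^ (6 + Δ) * (p : ℝ) ^ (-15 : ℝ)) := by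
        gcongr with k hk k hk
        · exact h1 k
        · refine (Finset.sum_le_sum fun l hl => h2 k l hk hl).trans ?_
          exact Finset.sum_le_sum_of_subset_of_nonneg (Finset.erase_subset _ _)
            fun _ _ _ => by positivity
    _ = 2 ^ 11 * (C₀ * (N : ℝ) ^ (6 + Δ) * (p * (p : ℝ) ^ (-2 : ℝ)) +
        D * (N : ℝ) ^ (6 + Δ) * (p ^ 14 * (p : ℝ) ^ (-15 : ℝ))) := by
        simp only [Finset.sum_const, Finset.card_range, nsmul_eq_mul]; ring
    _ = _ := by rw [e1, e2]; ring

theorem TwelfthMomentBound.improve {δ : ℝ} (hδ : 0 < δ) :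
    ∃ η : ℝ, 0 < η ∧ ∀ Δ : ℝ, δ ≤ Δ → TwelfthMomentBound Δ → TwelfthMomentBound (Δ - η) := by
  obtain ⟨n, hn⟩ := exists_nat_gt (27 / δ)
  set T : ℕ := 3 ^ n with hT
  have hT0 : (0 : ℝ) < T := by rw [hT]; positivity
  refine ⟨1 / T, by positivity, fun Δ hΔ ⟨C, hC, hJ⟩ => ?_⟩
  have hnΔ : 27 ≤ n * Δ := by
    rw [div_lt_iff₀ hδ] at hn
    exact hn.le.trans (by gcongr)
  obtain ⟨D, hD, hDp⟩ := exists_solutionCount_six_le_div_prime (hδ.le.trans hΔ) hC hJ hnΔ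
  refine ⟨2 * D + 10 * C, by positivity, fun N hN => ?_⟩
  have hN0 : (0 : ℝ) < N := by exact_mod_cast hN
  set Z := (N : ℝ) ^ (1 / T : ℝ) with hZ
  have hZ0 : 0 < Z := by positivity
  have hsplit : (N : ℝ) ^ (6 + Δ) = (N : ℝ) ^ (6 + (Δ - 1 / T)) * Z := by
    rw [hZ, ← Real.rpow_add hN0]; congr 1; ring
  have hR := Nat.floor_le hZ0.le
  have hR' := Nat.lt_floor_add_one Z
  set R := ⌊Z⌋₊ with hRdef
  rcases lt_or_ge R 10 with h | h
  · have hZ10 : Z ≤ 10 := hR'.le.trans (by exact_mod_cast h)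
    calc _ ≤ C * (N : ℝ) ^ (6 + Δ) := hJ N hN
      _ = C * (N : ℝ) ^ (6 + (Δ - 1 / T)) * Z := by rw [hsplit]; ring
      _ ≤ C * (N : ℝ) ^ (6 + (Δ - 1 / T)) * 10 := by gcongr
      _ ≤ (2 * D + 10 * C) * (N : ℝ) ^ (6 + (Δ - 1 / T)) := by
          have : 0 ≤ D * (N : ℝ) ^ (6 + (Δ - 1 / T)) := by positivity
          linarith
  · obtain ⟨p, hp, hp1, hp2⟩ := Nat.exists_prime_lt_and_le_two_mul (R / 2) (by omega)
    have hp0 : (0 : ℝ) < p := by exact_mod_cast hp.pos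
    have hpR : (p : ℝ) ≤ Z := (by exact_mod_cast (by omega : p ≤ R) : (p : ℝ) ≤ R).trans hR
    have hpN : p ^ T ≤ N := by
      have : (p : ℝ) ^ T ≤ Z ^ T := by gcongr
      rw [hZ, ← Real.rpow_mul_natCast hN0.le, one_div_mul_cancel hT0.ne', Real.rpow_one] at this
      exact_mod_cast this
    have hZp : Z * (p : ℝ)⁻¹ ≤ 2 := by
      rw [← div_eq_mul_inv, div_le_iff₀ hp0]
      have : (R : ℝ) + 1 ≤ 2 * p := by exact_mod_cast (by omega : R + 1 ≤ 2 * p)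
      linarith
    calc _ ≤ D * (N : ℝ) ^ (6 + Δ) * (p : ℝ)⁻¹ := hDp N p hp (by omega) hpN
      _ = D * (N : ℝ) ^ (6 + (Δ - 1 / T)) * (Z * (p : ℝ)⁻¹) := by rw [hsplit]; ring
      _ ≤ D * (N : ℝ) ^ (6 + (Δ - 1 / T)) * 2 := by gcongr
      _ ≤ (2 * D + 10 * C) * (N : ℝ) ^ (6 + (Δ - 1 / T)) := by
          have : 0 ≤ C * (N : ℝ) ^ (6 + (Δ - 1 / T)) := by positivity
          linarith

theorem TwelfthMomentBound.mono {Δ Δ' : ℝ} (h : TwelfthMomentBound Δ) (hΔ : Δ ≤ Δ') :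
    TwelfthMomentBound Δ' := by
  obtain ⟨C, hC, hJ⟩ := h
  refine ⟨C, hC, fun N hN => (hJ N hN).trans ?_⟩
  gcongr
  exact_mod_cast hN

theorem twelfthMomentBound_six : TwelfthMomentBound 6 := by
  classical
  refine ⟨1, zero_le_one, fun N _ => ?_⟩
  have h : solutionCount 6 (Icc (1 : ℤ) N) ≤ N ^ 12 := by
    refine (Finset.card_filter_le _ _).trans_eq ?_
    simp [Finset.card_product, Fintype.card_piFinset, ← pow_add]
  rw [one_mul, show (6 : ℝ) + 6 = (12 : ℕ) by norm_num, Real.rpow_natCast]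
  exact_mod_cast h

theorem twelfthMomentBound {δ : ℝ} (hδ : 0 < δ) : TwelfthMomentBound δ := by
  obtain ⟨η, hη, h⟩ := TwelfthMomentBound.improve hδ
  have key (k : ℕ) : TwelfthMomentBound (max δ (6 - k * η)) := by
    induction k with
    | zero => exact twelfthMomentBound_six.mono (by simp)
    | succ k ih =>
      refine (h _ (le_max_left _ _) ih).mono ?_
      rcases max_cases δ (6 - k * η) with ⟨e, -⟩ | ⟨e, -⟩ <;> rw [e]
      · exact le_max_of_le_left (by linarith)
      · exact le_max_of_le_right (by push_cast; linarith)
  obtain ⟨k, hk⟩ := exists_nat_gt (6 / η)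
  rw [div_lt_iff₀ hη] at hk
  simpa [max_eq_left (show 6 - k * η ≤ δ by linarith)] using key k

theorem norm_expSum_le (M : ℕ) [NeZero M] (A : Finset ℤ)
    (ψ : AddChar (ZMod M × ZMod M × ZMod M) ℂ) : ‖expSum M A ψ‖ ≤ #A := by
  refine (norm_sum_le _ _).trans_eq ?_
  simp [AddChar.norm_apply]

theorem solutionCount_add_le (s t N : ℕ) :
    (solutionCount (s + t) (Icc (1 : ℤ) N) : ℝ) ≤
      (N : ℝ) ^ (2 * t) * solutionCount s (Icc (1 : ℤ) N) := by
  set M := (s + t) * N ^ 3 + 1 with hM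
  have h : s * N ^ 3 < M := Nat.lt_succ_of_le (Nat.mul_le_mul_right _ (by omega))
  have h' : (s + t) * N ^ 3 < M := Nat.lt_succ_self _
  rw [← mixedMoment_zero_eq_solutionCount ∅ subset_rfl h',
    ← mixedMoment_zero_eq_solutionCount ∅ subset_rfl h]
  simp only [mixedMoment, mul_zero, pow_zero, mul_one]
  rw [mul_left_comm, Finset.mul_sum _ _ ((N : ℝ) ^ (2 * t))]
  refine mul_le_mul_of_nonneg_left (Finset.sum_le_sum fun ψ _ => ?_)
    (inv_nonneg.mpr (Nat.cast_nonneg _))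
  have := norm_expSum_le M (Icc (1 : ℤ) N) ψ
  simp only [Int.card_Icc, add_sub_cancel_right, Int.toNat_natCast] at this
  rw [mul_add, pow_add, mul_comm]
  gcongr

theorem solutionCount_le_rpow {s t : ℕ} (hs : 0 < s) (hst : s ≤ t) (N : ℕ) :
    (solutionCount s (Icc (1 : ℤ) N) : ℝ) ≤
      (solutionCount t (Icc (1 : ℤ) N) : ℝ) ^ (s / t : ℝ) := by
  set M := t * N ^ 3 + 1 with hM
  have h : s * N ^ 3 < M := Nat.lt_succ_of_le (Nat.mul_le_mul_right _ hst)
  have hs' : (0 : ℝ) < s := by exact_mod_cast hs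
  have ht' : (0 : ℝ) < t := by exact_mod_cast hs.trans_le hst
  have h' : t * N ^ 3 < M := Nat.lt_succ_self _
  rw [← mixedMoment_zero_eq_solutionCount ∅ subset_rfl h',
    ← mixedMoment_zero_eq_solutionCount ∅ subset_rfl h]
  set c : ℝ := (Fintype.card (ZMod M × ZMod M × ZMod M) : ℝ)
  have hc : c ≠ 0 := Nat.cast_ne_zero.mpr Fintype.card_ne_zero
  have hw : ∑ _ψ : AddChar (ZMod M × ZMod M × ZMod M) ℂ, c⁻¹ = 1 := by
    rw [Finset.sum_const, Finset.card_univ, AddChar.card_eq, nsmul_eq_mul, mul_inv_cancel₀ hc]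
  have key := Real.rpow_arith_mean_le_arith_mean_rpow univ (fun _ => c⁻¹)
    (fun ψ => ‖expSum M (Icc (1 : ℤ) N) ψ‖ ^ (2 * s)) (fun _ _ => by positivity) hw
    (fun _ _ => by positivity) (p := t / s) ((one_le_div hs').mpr (by exact_mod_cast hst))
  have e (x : ℝ) (hx : 0 ≤ x) : (x ^ (2 * s)) ^ (t / s : ℝ) = x ^ (2 * t) := by
    rw [← Real.rpow_natCast, ← Real.rpow_natCast, ← Real.rpow_mul hx]
    congr 1
    push_cast
    field_simp
  simp only [e _ (norm_nonneg _), ← Finset.mul_sum] at key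
  simp only [mixedMoment, mul_zero, pow_zero, mul_one]
  rw [← inv_div (t : ℝ) s]
  exact (Real.le_rpow_inv_iff_of_pos (by positivity) (by positivity) (by positivity)).mpr key

theorem Jcount_le_solutionCount (s : ℕ) (X : ℝ) :
    Jcount s 3 X ≤ solutionCount s (Icc (1 : ℤ) ⌊X⌋₊) := by
  classical
  have hmem (x : ℕ) (hx : 1 ≤ x ∧ (x : ℝ) ≤ X) : (x : ℤ) ∈ Icc (1 : ℤ) ⌊X⌋₊ :=
    Finset.mem_Icc.mpr ⟨by exact_mod_cast hx.1, by exact_mod_cast Nat.le_floor hx.2⟩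
  rw [Jcount, solutionCount, ← Nat.card_eq_finsetCard]
  refine Nat.card_le_card_of_injective
    (fun xy => ⟨(fun i => (xy.1.1 i : ℤ), fun i => (xy.1.2 i : ℤ)), ?_⟩) ?_
  · obtain ⟨hx, hy, h⟩ := xy.2
    simp only [Finset.mem_filter, Finset.mem_product, Fintype.mem_piFinset]
    refine ⟨⟨fun i => hmem _ (hx i), fun i => hmem _ (hy i)⟩, fun j hj => ?_⟩
    rcases Nat.eq_zero_or_pos j with rfl | hj0
    · simp
    · change ∑ i, (xy.1.1 i : ℤ) ^ j = ∑ i, (xy.1.2 i : ℤ) ^ j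
      exact_mod_cast h j (Finset.mem_Icc.mpr ⟨hj0, hj⟩)
  · rintro ⟨⟨x, y⟩, hxy⟩ ⟨⟨x', y'⟩, hxy'⟩ h
    simpa [funext_iff] using h

end

/-- The main conjecture for `k = 3` in all numbers of variables: for every positive
integer `s` and every `ε > 0` there is `C(s,ε)` with
`J_{s,3}(X) ≤ C(s,ε) · X^ε · (X^s + X^(2s−6))` for all real `X ≥ 1`. -/
theorem vinogradov_cubic_all_s :
    ∀ s : ℕ, 1 ≤ s → ∀ ε : ℝ, 0 < ε → ∃ C : ℝ, ∀ X : ℝ, 1 ≤ X →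
      (Jcount s 3 X : ℝ) ≤ C * X ^ ε * (X ^ (s : ℝ) + X ^ (2 * (s : ℝ) - 6)) := by
  intro s hs ε hε
  obtain ⟨C, hC, hJ⟩ := twelfthMomentBound hε
  refine ⟨C ^ (s / 6 : ℝ) + C, fun X hX => ?_⟩
  have hX0 : 0 < X := zero_lt_one.trans_le hX
  have hN : 1 ≤ ⌊X⌋₊ := Nat.le_floor (by exact_mod_cast hX)
  have hNX : (⌊X⌋₊ : ℝ) ≤ X := Nat.floor_le hX0.le
  have h6 : (solutionCount 6 (Finset.Icc (1 : ℤ) ⌊X⌋₊) : ℝ) ≤ C * X ^ (6 + ε) :=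
    (hJ _ hN).trans (by gcongr)
  have hle : (Jcount s 3 X : ℝ) ≤ solutionCount s (Finset.Icc (1 : ℤ) ⌊X⌋₊) := by
    exact_mod_cast Jcount_le_solutionCount s X
  refine hle.trans ?_
  rcases le_or_gt s 6 with h | h
  · have hs6 : (s : ℝ) ≤ 6 := by exact_mod_cast h
    calc (solutionCount s (Finset.Icc (1 : ℤ) ⌊X⌋₊) : ℝ)
        ≤ (solutionCount 6 (Finset.Icc (1 : ℤ) ⌊X⌋₊) : ℝ) ^ (s / 6 : ℝ) := by
          exact_mod_cast solutionCount_le_rpow hs h ⌊X⌋₊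
      _ ≤ (C * X ^ (6 + ε)) ^ (s / 6 : ℝ) := by gcongr
      _ = C ^ (s / 6 : ℝ) * X ^ ((6 + ε) * (s / 6)) := by
          rw [Real.mul_rpow hC (by positivity), ← Real.rpow_mul hX0.le]
      _ ≤ C ^ (s / 6 : ℝ) * X ^ (ε + s) := by
          gcongr
          nlinarith
      _ = C ^ (s / 6 : ℝ) * X ^ ε * (X ^ (s : ℝ) + 0) := by
          rw [Real.rpow_add hX0]; ring
      _ ≤ _ := by
          gcongr
          · linarith
          · positivity
  · obtain ⟨t, rfl⟩ := Nat.exists_eq_add_of_le h.le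
    calc (solutionCount (6 + t) (Finset.Icc (1 : ℤ) ⌊X⌋₊) : ℝ)
        ≤ (⌊X⌋₊ : ℝ) ^ (2 * t) * solutionCount 6 (Finset.Icc (1 : ℤ) ⌊X⌋₊) :=
          solutionCount_add_le 6 t _
      _ ≤ X ^ (2 * t) * (C * X ^ (6 + ε)) := by gcongr
      _ = C * X ^ ε * (0 + X ^ (2 * ((6 + t : ℕ) : ℝ) - 6)) := by
          rw [show 2 * ((6 + t : ℕ) : ℝ) - 6 = (2 * t : ℕ) + 6 by push_cast; ring,
            Real.rpow_add hX0, Real.rpow_add hX0, Real.rpow_natCast]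
          ring
      _ ≤ _ := by
          gcongr
          · exact le_add_of_nonneg_left (by positivity)
          · positivity
end

section
/- There is an absolute constant C such that for every prime p with 5 ≤ p ≤ X one has J(X) ≤ C ( p · J(2X/p) + p^{12} · I_2(X;1,1) ). -/
/-- `Icount p X m a b ξ η` is the number of 12-tuples `(x₁,…,x₆,x₇,…,x₁₂)` of positive
integers `≤ X` (encoded as a pair of 6-tuples) satisfying
`x₁ʲ+⋯+x₆ʲ = x₇ʲ+⋯+x₁₂ʲ` for `j = 1,2,3`, with `xᵢ ≡ ξ (mod pᵃ)` for
`1 ≤ i ≤ m` and `7 ≤ i ≤ 6+m`, and `xᵢ ≡ η (mod pᵇ)` for the remaining indices. -/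
noncomputable def Icount (p : ℕ) (X : ℝ) (m a b : ℕ) (ξ η : ℤ) : ℕ :=
  Nat.card {xy : (Fin 6 → ℕ) × (Fin 6 → ℕ) //
    (∀ i, 1 ≤ xy.1 i ∧ (xy.1 i : ℝ) ≤ X) ∧
    (∀ i, 1 ≤ xy.2 i ∧ (xy.2 i : ℝ) ≤ X) ∧
    (∀ j ∈ Finset.Icc 1 3, ∑ i, xy.1 i ^ j = ∑ i, xy.2 i ^ j) ∧
    (∀ i : Fin 6, if (i : ℕ) < m then (xy.1 i : ℤ) ≡ ξ [ZMOD (p : ℤ) ^ a]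
      else (xy.1 i : ℤ) ≡ η [ZMOD (p : ℤ) ^ b]) ∧
    (∀ i : Fin 6, if (i : ℕ) < m then (xy.2 i : ℤ) ≡ ξ [ZMOD (p : ℤ) ^ a]
      else (xy.2 i : ℤ) ≡ η [ZMOD (p : ℤ) ^ b])}

/-- `Imax p X m a b` : for `m = 0`, the maximum of `Icount p X 0 a b ξ η` over residues
`η mod pᵇ` (it is independent of `ξ`); for `1 ≤ m ≤ 5`, the maximum of
`Icount p X m a b ξ η` over residues `ξ mod pᵃ`, `η mod pᵇ` with `ξ ≢ η (mod p)`. -/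
noncomputable def Imax (p : ℕ) (X : ℝ) (m a b : ℕ) : ℕ :=
  if m = 0 then sSup {n : ℕ | ∃ η : ℤ, n = Icount p X 0 a b 0 η}
  else sSup {n : ℕ | ∃ ξ η : ℤ, ¬ ξ ≡ η [ZMOD (p : ℤ)] ∧ n = Icount p X m a b ξ η}

/-- The solutions of the cubic Vinogradov system in six plus six variables whose `i`-th variables
on both sides are restricted to the finite set `A i`. -/
def vinogradovSolutions (A : Fin 6 → Finset ℕ) : Finset ((Fin 6 → ℕ) × (Fin 6 → ℕ)) :=
  (Fintype.piFinset A ×ˢ Fintype.piFinset A).filter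
    fun xy => ∀ j ∈ Finset.Icc 1 3, ∑ i, xy.1 i ^ j = ∑ i, xy.2 i ^ j

/-- The positive integers up to `n` leaving the remainder `r` modulo `p`. -/
def residueBlock (p n r : ℕ) : Finset ℕ := (Finset.Icc 1 n).filter (· % p = r)

/-- The point `(x, x², x³)` of the twisted cubic modulo `N`. -/
def momentPoint (N x : ℕ) : Fin 3 → ZMod N := fun j => (x : ZMod N) ^ (j.val + 1)

lemma Jcount_six_three_eq_card {X : ℝ} (hX : 0 ≤ X) :
    Jcount 6 3 X = (vinogradovSolutions fun _ => Finset.Icc 1 ⌊X⌋₊).card := by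
  unfold Jcount
  refine Nat.subtype_card _ fun xy => ?_
  simp only [vinogradovSolutions, Finset.mem_filter, Finset.mem_product, Fintype.mem_piFinset]
  rw [and_assoc]
  simp only [Finset.mem_Icc (a := 1) (b := ⌊X⌋₊), Nat.le_floor_iff hX]

lemma modEq_pow_one_iff_mod_eq {p r x : ℕ} (hr : r < p) :
    (x : ℤ) ≡ (r : ℤ) [ZMOD (p : ℤ) ^ 1] ↔ x % p = r := by
  rw [pow_one, Int.natCast_modEq_iff, Nat.ModEq, Nat.mod_eq_of_lt hr]

lemma Icount_eq_card {p r s : ℕ} (hr : r < p) (hs : s < p) {X : ℝ} (hX : 0 ≤ X) (m : ℕ) :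
    Icount p X m 1 1 r s = (vinogradovSolutions fun i =>
      if (i : ℕ) < m then residueBlock p ⌊X⌋₊ r else residueBlock p ⌊X⌋₊ s).card := by
  unfold Icount
  refine Nat.subtype_card _ fun xy => ?_
  simp only [vinogradovSolutions, Finset.mem_filter, Finset.mem_product, Fintype.mem_piFinset,
    modEq_pow_one_iff_mod_eq hr, modEq_pow_one_iff_mod_eq hs]
  have key : ∀ x : Fin 6 → ℕ, (∀ i : Fin 6, x i ∈ (if (i : ℕ) < m then residueBlock p ⌊X⌋₊ r
      else residueBlock p ⌊X⌋₊ s)) ↔ (∀ i, 1 ≤ x i ∧ (x i : ℝ) ≤ X) ∧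
      ∀ i : Fin 6, if (i : ℕ) < m then x i % p = r else x i % p = s := by
    intro x
    rw [← forall_and]
    refine forall_congr' fun i => ?_
    split_ifs <;> simp [residueBlock, Nat.le_floor_iff hX]
  rw [key, key]
  tauto

lemma Icount_le_Jcount (p m a b : ℕ) {X : ℝ} (hX : 0 ≤ X) (ξ η : ℤ) :
    Icount p X m a b ξ η ≤ Jcount 6 3 X := by
  have : Finite {xy : (Fin 6 → ℕ) × (Fin 6 → ℕ) //
    (∀ i, 1 ≤ xy.1 i ∧ (xy.1 i : ℝ) ≤ X) ∧
    (∀ i, 1 ≤ xy.2 i ∧ (xy.2 i : ℝ) ≤ X) ∧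
    ∀ j ∈ Finset.Icc 1 3, ∑ i, xy.1 i ^ j = ∑ i, xy.2 i ^ j} := by
    refine Set.Finite.subset
      (vinogradovSolutions fun _ => Finset.Icc 1 ⌊X⌋₊).finite_toSet fun xy h => ?_
    simp only [vinogradovSolutions, Finset.coe_filter, Finset.mem_product, Fintype.mem_piFinset]
    simp only [Finset.mem_Icc (a := 1) (b := ⌊X⌋₊), Nat.le_floor_iff hX]
    exact ⟨⟨h.1, h.2.1⟩, h.2.2⟩
  exact Nat.card_le_card_of_injective
    (fun z => ⟨z.1, z.2.1, z.2.2.1, z.2.2.2.1⟩) fun z w h => Subtype.ext (Subtype.mk.inj h)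

lemma Icount_le_Imax {p m a b : ℕ} (hm : m ≠ 0) {X : ℝ} (hX : 0 ≤ X) {ξ η : ℤ}
    (h : ¬ ξ ≡ η [ZMOD (p : ℤ)]) : Icount p X m a b ξ η ≤ Imax p X m a b := by
  rw [Imax, if_neg hm]
  refine le_csSup ⟨Jcount 6 3 X, ?_⟩ ⟨ξ, η, h, rfl⟩
  rintro _ ⟨ξ, η, -, rfl⟩
  exact Icount_le_Jcount p m a b hX ξ η

lemma sum_succ_pow_eq_of_sum_affine_pow_eq {p r : ℕ} (hp : 0 < p) {u v : Fin 6 → ℕ}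
    (h : ∀ j ∈ Finset.Icc 1 3, ∑ i, (p * u i + r) ^ j = ∑ i, (p * v i + r) ^ j) :
    ∀ j ∈ Finset.Icc 1 3, ∑ i, (u i + 1) ^ j = ∑ i, (v i + 1) ^ j := by
  have s1 := h 1 (by decide)
  have s2 := h 2 (by decide)
  have s3 := h 3 (by decide)
  have hpz : (p : ℤ) ≠ 0 := by exact_mod_cast hp.ne'
  zify at s1 s2 s3
  simp only [Fin.sum_univ_six] at s1 s2 s3
  have t1 : (u 0 + u 1 + u 2 + u 3 + u 4 + u 5 : ℤ) = v 0 + v 1 + v 2 + v 3 + v 4 + v 5 := by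
    refine mul_left_cancel₀ hpz ?_
    linear_combination s1
  have t2 : (u 0 ^ 2 + u 1 ^ 2 + u 2 ^ 2 + u 3 ^ 2 + u 4 ^ 2 + u 5 ^ 2 : ℤ) =
      v 0 ^ 2 + v 1 ^ 2 + v 2 ^ 2 + v 3 ^ 2 + v 4 ^ 2 + v 5 ^ 2 := by
    refine mul_left_cancel₀ (pow_ne_zero 2 hpz) ?_
    linear_combination s2 - 2 * p * r * t1
  have t3 : (u 0 ^ 3 + u 1 ^ 3 + u 2 ^ 3 + u 3 ^ 3 + u 4 ^ 3 + u 5 ^ 3 : ℤ) =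
      v 0 ^ 3 + v 1 ^ 3 + v 2 ^ 3 + v 3 ^ 3 + v 4 ^ 3 + v 5 ^ 3 := by
    refine mul_left_cancel₀ (pow_ne_zero 3 hpz) ?_
    linear_combination s3 - 3 * p ^ 2 * r * t2 - 3 * p * r ^ 2 * t1
  intro j hj
  rw [Finset.mem_Icc] at hj
  obtain ⟨hj1, hj3⟩ := hj
  zify
  simp only [Fin.sum_univ_six]
  interval_cases j
  · linear_combination t1
  · linear_combination t2 + 2 * t1
  · linear_combination t3 + 3 * t2 + 3 * t1

lemma card_vinogradovSolutions_residueBlock_le {p r : ℕ} (hp : 0 < p) {X : ℝ} (hX : (p : ℝ) ≤ X) :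
    (vinogradovSolutions fun _ => residueBlock p ⌊X⌋₊ r).card ≤ Jcount 6 3 (2 * X / p) := by
  have hp' : (0 : ℝ) < p := by exact_mod_cast hp
  have hX0 : 0 ≤ X := hp'.le.trans hX
  rw [Jcount_six_three_eq_card (by positivity)]
  have hdm : ∀ x : ℕ, x % p = r → x = p * (x / p) + r := fun x hx => by
    have := Nat.div_add_mod x p
    omega
  refine Finset.card_le_card_of_injOn
    (fun xy => (fun i => xy.1 i / p + 1, fun i => xy.2 i / p + 1)) ?_ ?_
  · intro xy hxy
    simp only [vinogradovSolutions, Finset.mem_coe, Finset.mem_filter, Finset.mem_product,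
      Fintype.mem_piFinset, residueBlock] at hxy ⊢
    simp only [Finset.mem_Icc (b := ⌊X⌋₊), Nat.le_floor_iff hX0] at hxy
    simp only [Finset.mem_Icc (b := ⌊2 * X / p⌋₊),
      Nat.le_floor_iff (show 0 ≤ 2 * X / p by positivity)]
    obtain ⟨⟨h1, h2⟩, h3⟩ := hxy
    have hb : ∀ x : ℕ, (x : ℝ) ≤ X → ((x / p + 1 : ℕ) : ℝ) ≤ 2 * X / p := by
      intro x hx
      have h4 : ((x / p : ℕ) : ℝ) ≤ x / p := Nat.cast_div_le
      have h5 : (x : ℝ) / p ≤ X / p := by gcongr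
      have h6 : 1 ≤ X / p := (one_le_div hp').2 hX
      push_cast
      rw [mul_div_assoc]
      linarith
    refine ⟨⟨fun i => ⟨Nat.le_add_left 1 _, hb _ (h1 i).1.2⟩, fun i => ⟨Nat.le_add_left 1 _, hb _ (h2 i).1.2⟩⟩, ?_⟩
    obtain ⟨q, hq⟩ : ∃ q : Fin 6 → ℕ, ∀ i, xy.1 i / p = q i := ⟨_, fun _ => rfl⟩
    obtain ⟨q', hq'⟩ : ∃ q : Fin 6 → ℕ, ∀ i, xy.2 i / p = q i := ⟨_, fun _ => rfl⟩
    have e1 : ∀ i, xy.1 i = p * q i + r := fun i => hq i ▸ hdm _ (h1 i).2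
    have e2 : ∀ i, xy.2 i = p * q' i + r := fun i => hq' i ▸ hdm _ (h2 i).2
    simp only [e1, e2] at h3
    simp only [hq, hq']
    exact sum_succ_pow_eq_of_sum_affine_pow_eq hp h3
  · intro xy hxy zw hzw h
    simp only [vinogradovSolutions, Finset.mem_coe, Finset.mem_filter, Finset.mem_product,
      Fintype.mem_piFinset, residueBlock] at hxy hzw
    simp only [Prod.mk.injEq, funext_iff, add_left_inj] at h
    refine Prod.ext (funext fun i => ?_) (funext fun i => ?_)
    · rw [hdm _ (hxy.1.1 i).2, hdm _ (hzw.1.1 i).2, h.1]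
    · rw [hdm _ (hxy.1.2 i).2, hdm _ (hzw.1.2 i).2, h.2]

lemma momentPoint_sum_eq_iff {N n : ℕ} (hN : 6 * n ^ 3 < N) {x y : Fin 6 → ℕ}
    (hx : ∀ i, x i ≤ n) (hy : ∀ i, y i ≤ n) :
    ∑ i, momentPoint N (x i) = ∑ i, momentPoint N (y i) ↔
      ∀ j ∈ Finset.Icc 1 3, ∑ i, x i ^ j = ∑ i, y i ^ j := by
  have hlt : ∀ z : Fin 6 → ℕ, (∀ i, z i ≤ n) → ∀ j ∈ Finset.Icc 1 3, ∑ i, z i ^ j < N := by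
    intro z hz j hj
    rw [Finset.mem_Icc] at hj
    refine lt_of_le_of_lt ?_ hN
    calc ∑ i, z i ^ j ≤ ∑ _i : Fin 6, n ^ 3 := Finset.sum_le_sum fun i _ => by
          rcases Nat.eq_zero_or_pos (z i) with h | h
          · rw [h, zero_pow (by omega)]; exact Nat.zero_le _
          · exact (Nat.pow_le_pow_right h hj.2).trans (Nat.pow_le_pow_left (hz i) 3)
      _ = 6 * n ^ 3 := by simp
  have hcoord : ∀ j ∈ Finset.Icc 1 3, (((∑ i, x i ^ j : ℕ) : ZMod N) = ((∑ i, y i ^ j : ℕ) : ZMod N)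
      ↔ ∑ i, x i ^ j = ∑ i, y i ^ j) := fun j hj => by
    rw [ZMod.natCast_eq_natCast_iff', Nat.mod_eq_of_lt (hlt x hx j hj),
      Nat.mod_eq_of_lt (hlt y hy j hj)]
  constructor
  · intro h j hj
    rw [← hcoord j hj]
    rw [Finset.mem_Icc] at hj
    have := congrFun h ⟨j - 1, by omega⟩
    simpa [momentPoint, Nat.sub_add_cancel hj.1] using this
  · intro h
    funext j
    have := (hcoord (j + 1) (by simp)).2 (h (j + 1) (by simp))
    simpa [momentPoint] using this

lemma AddChar.sum_norm_sq_sum {G T : Type*} [AddCommGroup G] [Fintype G] [DecidableEq G]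
    (S : Finset T) (h : T → G) :
    ∑ ψ : AddChar G ℂ, ‖∑ t ∈ S, ψ (h t)‖ ^ 2 =
      Fintype.card G * ((S ×ˢ S).filter fun t => h t.1 = h t.2).card := by
  have key : ∀ ψ : AddChar G ℂ, ((‖∑ t ∈ S, ψ (h t)‖ ^ 2 : ℝ) : ℂ) =
      ∑ t ∈ S ×ˢ S, ψ (h t.1 - h t.2) := fun ψ => by
    push_cast
    rw [← Complex.mul_conj', map_sum, Finset.sum_mul_sum, Finset.sum_product]
    simp only [← AddChar.map_neg_eq_conj, sub_eq_add_neg, AddChar.map_add_eq_mul]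
  rw [← Complex.ofReal_inj, Complex.ofReal_sum]
  simp only [key]
  rw [Finset.sum_comm]
  simp only [AddChar.sum_apply_eq_ite, sub_eq_zero]
  rw [← Finset.sum_filter, Finset.sum_const, nsmul_eq_mul]
  push_cast
  ring

lemma sum_prod_norm_sq_eq {N n : ℕ} [NeZero N] (hN : 6 * n ^ 3 < N) {A : Fin 6 → Finset ℕ}
    (hA : ∀ i, A i ⊆ Finset.Icc 1 n) :
    ∑ ψ : AddChar (Fin 3 → ZMod N) ℂ, ∏ i, ‖∑ x ∈ A i, ψ (momentPoint N x)‖ ^ 2 =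
      Fintype.card (Fin 3 → ZMod N) * (vinogradovSolutions A).card := by
  have hcard : vinogradovSolutions A = (Fintype.piFinset A ×ˢ Fintype.piFinset A).filter
      fun xy => ∑ i, momentPoint N (xy.1 i) = ∑ i, momentPoint N (xy.2 i) := by
    refine Finset.filter_congr fun xy hxy => ?_
    simp only [Finset.mem_product, Fintype.mem_piFinset] at hxy
    exact (momentPoint_sum_eq_iff hN (fun i => (Finset.mem_Icc.1 (hA i (hxy.1 i))).2)
      (fun i => (Finset.mem_Icc.1 (hA i (hxy.2 i))).2)).symm
  rw [hcard, ← AddChar.sum_norm_sq_sum (Fintype.piFinset A) fun x => ∑ i, momentPoint N (x i)]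
  refine Finset.sum_congr rfl fun ψ _ => ?_
  have hmul : ∀ x : Fin 6 → ℕ, ψ (∑ i, momentPoint N (x i)) = ∏ i, ψ (momentPoint N (x i)) :=
    fun x => by simp only [Fin.sum_univ_six, Fin.prod_univ_six, AddChar.map_add_eq_mul]
  simp only [hmul]
  rw [Finset.prod_pow, ← norm_prod, Finset.prod_univ_sum]

lemma pow_twelve_le_diagonal_add_offDiagonal {ι : Type*} [DecidableEq ι] (S : Finset ι) {g : ι → ℝ}
    (hg : ∀ i, 0 ≤ g i) {F : ℝ} (hF : 0 ≤ F) (hFg : F ≤ ∑ i ∈ S, g i) :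
    F ^ 12 ≤ 2 ^ 12 * ∑ i ∈ S, g i ^ 12 +
      16 * (S.card : ℝ) ^ 10 * ∑ j ∈ S, ∑ i ∈ S.erase j, g i ^ 4 * g j ^ 8 := by
  have hoff : 0 ≤ ∑ j ∈ S, ∑ i ∈ S.erase j, g i ^ 4 * g j ^ 8 :=
    Finset.sum_nonneg fun j _ => Finset.sum_nonneg fun i _ =>
      mul_nonneg (pow_nonneg (hg i) _) (pow_nonneg (hg j) _)
  by_cases h : ∃ k ∈ S, F / 2 ≤ g k
  · obtain ⟨k, hk, hk'⟩ := h
    have h1 : g k ^ 12 ≤ ∑ i ∈ S, g i ^ 12 :=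
      Finset.single_le_sum (f := fun i => g i ^ 12) (fun i _ => pow_nonneg (hg i) _) hk
    have h2 : (F / 2) ^ 12 ≤ g k ^ 12 := pow_le_pow_left₀ (by positivity) hk' _
    have h3 : 0 ≤ 16 * (S.card : ℝ) ^ 10 * ∑ j ∈ S, ∑ i ∈ S.erase j, g i ^ 4 * g j ^ 8 :=
      mul_nonneg (mul_nonneg (by norm_num) (pow_nonneg (Nat.cast_nonneg _) _)) hoff
    rw [div_pow] at h2
    linarith
  · push Not at h
    have h8 : F ^ 8 ≤ (S.card : ℝ) ^ 7 * ∑ j ∈ S, g j ^ 8 :=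
      (pow_le_pow_left₀ hF hFg 8).trans (pow_sum_le_card_mul_sum_pow (fun i _ => hg i) 7)
    have h4 : ∀ j ∈ S, F ^ 4 ≤ 16 * (S.card : ℝ) ^ 3 * ∑ i ∈ S.erase j, g i ^ 4 := by
      intro j hj
      have e := Finset.add_sum_erase S g hj
      have e1 : F / 2 ≤ ∑ i ∈ S.erase j, g i := by linarith [h j hj]
      have e2 : (F / 2) ^ 4 ≤ ((S.erase j).card : ℝ) ^ 3 * ∑ i ∈ S.erase j, g i ^ 4 :=
        (pow_le_pow_left₀ (by positivity) e1 4).trans (pow_sum_le_card_mul_sum_pow (fun i _ => hg i) 3)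
      have e3 : ((S.erase j).card : ℝ) ^ 3 * ∑ i ∈ S.erase j, g i ^ 4 ≤
          (S.card : ℝ) ^ 3 * ∑ i ∈ S.erase j, g i ^ 4 := by
        have : 0 ≤ ∑ i ∈ S.erase j, g i ^ 4 := Finset.sum_nonneg fun i _ => pow_nonneg (hg i) _
        have : (S.erase j).card ≤ S.card := Finset.card_erase_le
        gcongr
      rw [div_pow] at e2
      linarith
    calc F ^ 12 = F ^ 8 * F ^ 4 := by ring
      _ ≤ ((S.card : ℝ) ^ 7 * ∑ j ∈ S, g j ^ 8) * F ^ 4 := by gcongr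
      _ = (S.card : ℝ) ^ 7 * ∑ j ∈ S, g j ^ 8 * F ^ 4 := by rw [← Finset.sum_mul]; ring
      _ ≤ (S.card : ℝ) ^ 7 * ∑ j ∈ S, g j ^ 8 *
            (16 * (S.card : ℝ) ^ 3 * ∑ i ∈ S.erase j, g i ^ 4) := by
          gcongr with j hj
          exact h4 j hj
      _ = 16 * (S.card : ℝ) ^ 10 * ∑ j ∈ S, ∑ i ∈ S.erase j, g i ^ 4 * g j ^ 8 := by
          simp only [Finset.mul_sum]
          refine Finset.sum_congr rfl fun j _ => Finset.sum_congr rfl fun i _ => ?_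
          ring
      _ ≤ _ := le_add_of_nonneg_left
          (mul_nonneg (by norm_num) (Finset.sum_nonneg fun i _ => pow_nonneg (hg i) _))

/-- Lemma 2: there is an absolute constant `C` such that for every prime `p` with
`5 ≤ p ≤ X` one has `J(X) ≤ C (p · J(2X/p) + p¹² · I₂(X;1,1))`. -/
theorem J_le_I2 :
    ∃ C : ℝ, ∀ p : ℕ, p.Prime → 5 ≤ p → ∀ X : ℝ, 1 ≤ X → (p : ℝ) ≤ X →
      (Jcount 6 3 X : ℝ) ≤
        C * ((p : ℝ) * (Jcount 6 3 (2 * X / (p : ℝ)) : ℝ)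
          + (p : ℝ) ^ 12 * (Imax p X 2 1 1 : ℝ)) := by
  refine ⟨2 ^ 12, fun p hp _ X hX1 hpX => ?_⟩
  have hX0 : 0 ≤ X := zero_le_one.trans hX1
  set n := ⌊X⌋₊
  obtain ⟨N, hN⟩ : ∃ N, N = 6 * n ^ 3 + 1 := ⟨_, rfl⟩
  have hnN : 6 * n ^ 3 < N := by omega
  have : NeZero N := ⟨by omega⟩
  have hblock : ∀ r, residueBlock p n r ⊆ Finset.Icc 1 n := fun r => Finset.filter_subset _ _
  let g : AddChar (Fin 3 → ZMod N) ℂ → ℕ → ℝ :=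
    fun ψ r => ‖∑ x ∈ residueBlock p n r, ψ (momentPoint N x)‖
  have hJ := sum_prod_norm_sq_eq hnN (A := fun _ => Finset.Icc 1 n) fun _ => subset_rfl
  rw [← Jcount_six_three_eq_card hX0] at hJ
  have hdiag : ∀ r, ∑ ψ, g ψ r ^ 12 ≤
      Fintype.card (Fin 3 → ZMod N) * (Jcount 6 3 (2 * X / p) : ℝ) := fun r => by
    have h := sum_prod_norm_sq_eq hnN (A := fun _ => residueBlock p n r) fun _ => hblock r
    have h' : (((vinogradovSolutions fun _ => residueBlock p n r).card : ℕ) : ℝ) ≤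
        Jcount 6 3 (2 * X / p) := by
      exact_mod_cast card_vinogradovSolutions_residueBlock_le hp.pos hpX
    simp only [Finset.prod_const, Finset.card_univ, Fintype.card_fin, ← pow_mul] at h
    norm_num only at h
    simp only [g]
    rw [h]
    gcongr
  have hoff : ∀ s ∈ Finset.range p, ∀ r ∈ (Finset.range p).erase s,
      ∑ ψ, g ψ r ^ 4 * g ψ s ^ 8 ≤
        Fintype.card (Fin 3 → ZMod N) * (Imax p X 2 1 1 : ℝ) := fun s hs r hr => by
    rw [Finset.mem_erase, Finset.mem_range] at hr
    rw [Finset.mem_range] at hs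
    have h := sum_prod_norm_sq_eq hnN
      (A := fun i => if (i : ℕ) < 2 then residueBlock p n r else residueBlock p n s)
      fun i => by split_ifs <;> exact hblock _
    rw [← Icount_eq_card hr.2 hs hX0 2] at h
    have hne : ¬ (r : ℤ) ≡ (s : ℤ) [ZMOD (p : ℤ)] := by
      rw [Int.natCast_modEq_iff, Nat.ModEq, Nat.mod_eq_of_lt hr.2, Nat.mod_eq_of_lt hs]
      exact hr.1
    have h' : (Icount p X 2 1 1 r s : ℝ) ≤ Imax p X 2 1 1 := by
      exact_mod_cast Icount_le_Imax two_ne_zero hX0 hne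
    calc ∑ ψ, g ψ r ^ 4 * g ψ s ^ 8 = Fintype.card (Fin 3 → ZMod N) * Icount p X 2 1 1 r s := by
          rw [← h]
          refine Finset.sum_congr rfl fun ψ _ => ?_
          simp [Fin.prod_univ_six, g]
          ring
      _ ≤ _ := by gcongr
  have hpt : ∀ ψ : AddChar (Fin 3 → ZMod N) ℂ,
      ‖∑ x ∈ Finset.Icc 1 n, ψ (momentPoint N x)‖ ^ 12 ≤
        2 ^ 12 * ∑ r ∈ Finset.range p, g ψ r ^ 12 + 16 * (p : ℝ) ^ 10 *
          ∑ s ∈ Finset.range p, ∑ r ∈ (Finset.range p).erase s, g ψ r ^ 4 * g ψ s ^ 8 := fun ψ => by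
    have h := pow_twelve_le_diagonal_add_offDiagonal (Finset.range p) (g := g ψ)
      (F := ‖∑ x ∈ Finset.Icc 1 n, ψ (momentPoint N x)‖) (fun _ => norm_nonneg _)
      (norm_nonneg _) ?_
    · rwa [Finset.card_range] at h
    · rw [← Finset.sum_fiberwise_of_maps_to (t := Finset.range p) (g := (· % p))
        fun x _ => Finset.mem_range.2 (Nat.mod_lt x hp.pos)]
      exact norm_sum_le _ _
  have hpos : (0 : ℝ) < Fintype.card (Fin 3 → ZMod N) := by exact_mod_cast Fintype.card_pos
  refine le_of_mul_le_mul_left ?_ hpos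
  set c : ℝ := (Fintype.card (Fin 3 → ZMod N) : ℝ)
  rw [← hJ]
  simp only [Finset.prod_const, Finset.card_univ, Fintype.card_fin, ← pow_mul]
  norm_num only
  calc ∑ ψ : AddChar (Fin 3 → ZMod N) ℂ, ‖∑ x ∈ Finset.Icc 1 n, ψ (momentPoint N x)‖ ^ 12
      ≤ ∑ ψ, (2 ^ 12 * ∑ r ∈ Finset.range p, g ψ r ^ 12 + 16 * (p : ℝ) ^ 10 *
          ∑ s ∈ Finset.range p, ∑ r ∈ (Finset.range p).erase s, g ψ r ^ 4 * g ψ s ^ 8) :=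
        Finset.sum_le_sum fun ψ _ => hpt ψ
    _ = 2 ^ 12 * ∑ r ∈ Finset.range p, ∑ ψ, g ψ r ^ 12 + 16 * (p : ℝ) ^ 10 *
          ∑ s ∈ Finset.range p, ∑ r ∈ (Finset.range p).erase s, ∑ ψ, g ψ r ^ 4 * g ψ s ^ 8 := by
        rw [Finset.sum_add_distrib, ← Finset.mul_sum, ← Finset.mul_sum, Finset.sum_comm,
          Finset.sum_comm (s := Finset.univ)]
        congr 2
        exact Finset.sum_congr rfl fun s _ => Finset.sum_comm
    _ ≤ 2 ^ 12 * ∑ r ∈ Finset.range p, c * (Jcount 6 3 (2 * X / p) : ℝ) + 16 * (p : ℝ) ^ 10 *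
          ∑ s ∈ Finset.range p, ∑ r ∈ Finset.range p, c * (Imax p X 2 1 1 : ℝ) := by
        gcongr with r hr s hs
        · exact hdiag r
        · exact (Finset.sum_le_sum (hoff s hs)).trans (Finset.sum_le_sum_of_subset_of_nonneg
            (Finset.erase_subset _ _) fun _ _ _ => by positivity)
    _ ≤ _ := by
        simp only [Finset.sum_const, Finset.card_range, nsmul_eq_mul]
        have : 0 ≤ c * (p : ℝ) ^ 12 * (Imax p X 2 1 1 : ℝ) := by positivity
        linarith
end
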